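/- The tensor product variety Π_{V,D•} is pure-dimensional of dimension (1/2)·dim E(V,D), and the number of its irreducible components equals Σ # Irr(L^s_{V¹,D¹} × L_{V²,D²}), summed over pairs (ν¹,ν²) of dimension vectors with ν¹ + ν² = dim V. -/

import Mathlib

noncomputable section
open scoped Classical

/-- The algebra of polynomial functions on a complex vector space `M`: the
subalgebra of `M → ℂ` generated by the linear functionals. -/
def polyFuns (M : Type) [AddCommGroup M] [Module ℂ M] : Subalgebra ℂ (M → ℂ) :=
  Algebra.adjoin ℂ (Set.range fun l : Module.Dual ℂ M => (l : M → ℂ))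

/-- The Zariski topology on a complex vector space `M`: generated by the
complements of zero sets of polynomial functions. -/
def zariski (M : Type) [AddCommGroup M] [Module ℂ M] : TopologicalSpace M :=
  TopologicalSpace.generateFrom {u | ∃ P ∈ polyFuns M, u = {x : M | P x ≠ 0}}

/-- The subspace (Zariski) topology on a subset `S ⊆ M`. -/
def subTop {M : Type} [AddCommGroup M] [Module ℂ M] (S : Set M) :
    TopologicalSpace S :=
  TopologicalSpace.induced Subtype.val (zariski M)

/-- The set of irreducible components of a subset `S ⊆ M` for the Zariski topology. -/
def zIrr {M : Type} [AddCommGroup M] [Module ℂ M] (S : Set M) : Set (Set S) :=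
  @irreducibleComponents S (subTop S)

/-- The dimension (topological Krull dimension for the Zariski topology) of a
subset `S ⊆ M`. -/
def zDim {M : Type} [AddCommGroup M] [Module ℂ M] (S : Set M) : WithBot ℕ∞ :=
  @topologicalKrullDim S (subTop S)

/-- The dimension of a subset `C` of `S ⊆ M` (e.g. an irreducible component). -/
def zDimC {M : Type} [AddCommGroup M] [Module ℂ M] {S : Set M} (C : Set S) :
    WithBot ℕ∞ :=
  @topologicalKrullDim C (TopologicalSpace.induced Subtype.val (subTop S))

/-- The number of irreducible components of a product `S × T` (with the product of
the Zariski subspace topologies). -/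
def zIrrProdCount {M M' : Type} [AddCommGroup M] [Module ℂ M]
    [AddCommGroup M'] [Module ℂ M'] (S : Set M) (T : Set M') : ℕ :=
  (@irreducibleComponents (S × T) (@instTopologicalSpaceProd _ _ (subTop S) (subTop T))).ncard

variable {I H : Type} [Fintype I] [DecidableEq I] [Fintype H]

/-- The `I`-graded vector space with dimension vector `ν`. -/
abbrev Vec (ν : I → ℕ) : Type := (i : I) → (Fin (ν i) → ℂ)

/-- The projection onto the `i`-th graded piece of `Vec ν`. -/
def pr (ν : I → ℕ) (i : I) : Module.End ℂ (Vec ν) :=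
  (LinearMap.single ℂ (fun j => Fin (ν j) → ℂ) i).comp (LinearMap.proj i)

variable (s t : H → I) (bar : H → H) (eps : H → ℤ)

/-- A family `x : H → End(Vec ν)` is a graded representation of the graph:
each `x h` is supported on the block from piece `s h` to piece `t h`. -/
def gradedX (ν : I → ℕ) (x : H → Module.End ℂ (Vec ν)) : Prop :=
  ∀ h, pr ν (t h) ∘ₗ x h ∘ₗ pr ν (s h) = x h

/-- Nilpotency of a representation of the graph `Γ`. -/
def NilpGraph {ν : I → ℕ} (x : H → Module.End ℂ (Vec ν)) : Prop :=
  ∃ n : ℕ, ∀ l : List H, l.length = n → (l.map x).prod = 0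

/-- Lusztig's nilpotent variety `Λ_V`: graded representations satisfying the
moment map equation `Σ_{h''=i} ε(h) x_h x_{h̄} = 0` which are nilpotent. -/
def ΛV (ν : I → ℕ) : Set (H → Module.End ℂ (Vec ν)) :=
  {x | gradedX s t ν x ∧ (∑ h : H, eps h • (x h * x (bar h))) = 0 ∧ NilpGraph x}

/-- A graded homomorphism between graded vector spaces. -/
def gradedHom (ν μ : I → ℕ) (q : Vec ν →ₗ[ℂ] Vec μ) : Prop :=
  ∀ i, pr μ i ∘ₗ q = q ∘ₗ pr ν i

/-- The variety `L_{V,D} = Λ_V × Hom(V,D)`. -/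
def LSet (ν μ : I → ℕ) :
    Set ((H → Module.End ℂ (Vec ν)) × (Vec ν →ₗ[ℂ] Vec μ)) :=
  {X | X.1 ∈ ΛV s t bar eps ν ∧ gradedHom ν μ X.2}

/-- The stable (open) subvariety `L^s_{V,D}`: the locus where all the maps
`X(i) = q_i ⊕ ⊕_{h'=i} x_h` are injective. -/
def LsSet (ν μ : I → ℕ) :
    Set ((H → Module.End ℂ (Vec ν)) × (Vec ν →ₗ[ℂ] Vec μ)) :=
  {X | X ∈ LSet s t bar eps ν μ ∧
    ∀ (i : I) (u : Vec ν), pr ν i u = u → X.2 u = 0 →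
      (∀ h, s h = i → X.1 h u = 0) → u = 0}

/-- The framing space `D = D² ⊕ D¹`. -/
abbrev Dsp (μ2 μ1 : I → ℕ) : Type := Vec μ2 × Vec (I := I) μ1

/-- The grading projections on `D`. -/
def eD (μ2 μ1 : I → ℕ) (i : I) : Module.End ℂ (Dsp μ2 μ1) :=
  (pr μ2 i).prodMap (pr μ1 i)

/-- The ambient linear space containing `E(V,D)`: triples `(x, p, q)`. -/
abbrev Msp (ν μ2 μ1 : I → ℕ) : Type :=
  (H → Module.End ℂ (Vec ν)) × (Dsp μ2 μ1 →ₗ[ℂ] Vec ν) × (Vec ν →ₗ[ℂ] Dsp μ2 μ1)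

/-- `D² ⊆ D` as a subspace. -/
def D2sub (μ2 μ1 : I → ℕ) : Submodule ℂ (Dsp μ2 μ1) :=
  LinearMap.range (LinearMap.inl ℂ (Vec μ2) (Vec (I := I) μ1))

/-- The maps of the framed quiver attached to a triple `X = (x,p,q)`, acting on
`V ⊕ D`; used to formulate nilpotency of `X` as a framed representation. -/
def edgeMap {ν μ2 μ1 : I → ℕ} (X : Msp (H := H) ν μ2 μ1) :
    H ⊕ (I ⊕ I) → Module.End ℂ (Vec ν × Dsp μ2 μ1) :=
  Sum.elim (fun h => (X.1 h).prodMap 0)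
    (Sum.elim
      (fun i => (LinearMap.inl ℂ (Vec ν) (Dsp μ2 μ1)) ∘ₗ
        (X.2.1 ∘ₗ eD μ2 μ1 i) ∘ₗ (LinearMap.snd ℂ (Vec ν) (Dsp μ2 μ1)))
      (fun i => (LinearMap.inr ℂ (Vec ν) (Dsp μ2 μ1)) ∘ₗ
        (eD μ2 μ1 i ∘ₗ X.2.2) ∘ₗ (LinearMap.fst ℂ (Vec ν) (Dsp μ2 μ1))))

/-- Nilpotency of `X = (x,p,q)` as a representation of the framed graph. -/
def NilpFramed {ν μ2 μ1 : I → ℕ} (X : Msp (H := H) ν μ2 μ1) : Prop :=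
  ∃ n : ℕ, ∀ l : List (H ⊕ (I ⊕ I)), l.length = n →
    (l.map (edgeMap X)).prod = 0

/-- `x`-invariance of a subspace. -/
def xInv {ν : I → ℕ} (x : H → Module.End ℂ (Vec ν)) (U : Submodule ℂ (Vec ν)) : Prop :=
  ∀ h, ∀ v ∈ U, x h v ∈ U

/-- The smallest `x`-invariant subspace containing `S` (written `S̄`). -/
def invClosure {ν : I → ℕ} (x : H → Module.End ℂ (Vec ν)) (S : Submodule ℂ (Vec ν)) :
    Submodule ℂ (Vec ν) :=
  sInf {U | S ≤ U ∧ xInv x U}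

/-- The largest `x`-invariant subspace contained in `S` (written `S̲`). -/
def invCore {ν : I → ℕ} (x : H → Module.End ℂ (Vec ν)) (S : Submodule ℂ (Vec ν)) :
    Submodule ℂ (Vec ν) :=
  sSup {U | U ≤ S ∧ xInv x U}

/-- The tensor product variety `Π_{V,D•}` (for the two-step flag `D ⊇ D² ⊇ 0`):
nilpotent graded solutions `X = (x,p,q)` of the moment map equation with
`closure of p(D) ⊆ core of q⁻¹(D²)` and `p(D²) = 0`. -/
def PiSet (ν μ2 μ1 : I → ℕ) : Set (Msp (H := H) ν μ2 μ1) :=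
  {X | gradedX s t ν X.1 ∧
    (∀ i, pr ν i ∘ₗ X.2.1 = X.2.1 ∘ₗ eD μ2 μ1 i) ∧
    (∀ i, eD μ2 μ1 i ∘ₗ X.2.2 = X.2.2 ∘ₗ pr ν i) ∧
    (∑ h : H, eps h • (X.1 h * X.1 (bar h))) = X.2.1 ∘ₗ X.2.2 ∧
    NilpFramed X ∧
    invClosure X.1 (LinearMap.range X.2.1) ≤
      invCore X.1 (Submodule.comap X.2.2 (D2sub μ2 μ1)) ∧
    (∀ d ∈ D2sub μ2 μ1, X.2.1 d = 0)}

end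

noncomputable section
open scoped Classical

section RegularFunctions

variable {M N P Q : Type} [AddCommGroup M] [Module ℂ M] [AddCommGroup N] [Module ℂ N]
  [AddCommGroup P] [Module ℂ P] [AddCommGroup Q] [Module ℂ Q]

theorem polyFuns_dual (l : Module.Dual ℂ M) : (fun m => l m) ∈ polyFuns M :=
  Algebra.subset_adjoin ⟨l, rfl⟩

/-- The functions on `M` whose restriction to `Z` is locally a quotient of polynomial functions. -/
def Rg (Z : Set M) : Subalgebra ℂ (M → ℂ) where
  carrier := {f | ∀ z ∈ Z, ∃ a ∈ polyFuns M, ∃ b ∈ polyFuns M, b z ≠ 0 ∧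
    ∀ z' ∈ Z, b z' ≠ 0 → b z' * f z' = a z'}
  mul_mem' := by
    intro f g hf hg z hz
    obtain ⟨a, ha, b, hb, hbz, h⟩ := hf z hz
    obtain ⟨a', ha', b', hb', hbz', h'⟩ := hg z hz
    refine ⟨a * a', mul_mem ha ha', b * b', mul_mem hb hb', by simp [hbz, hbz'], ?_⟩
    intro w hw hbw
    simp only [Pi.mul_apply, ne_eq, mul_eq_zero, not_or] at hbw ⊢
    rw [← h w hw hbw.1, ← h' w hw hbw.2]; ring
  add_mem' := by
    intro f g hf hg z hz
    obtain ⟨a, ha, b, hb, hbz, h⟩ := hf z hz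
    obtain ⟨a', ha', b', hb', hbz', h'⟩ := hg z hz
    refine ⟨a * b' + b * a', add_mem (mul_mem ha hb') (mul_mem hb ha'),
      b * b', mul_mem hb hb', by simp [hbz, hbz'], ?_⟩
    intro w hw hbw
    simp only [Pi.mul_apply, Pi.add_apply, ne_eq, mul_eq_zero, not_or] at hbw ⊢
    rw [← h w hw hbw.1, ← h' w hw hbw.2]; ring
  algebraMap_mem' := by
    intro r z hz
    exact ⟨algebraMap ℂ _ r, algebraMap_mem _ r, 1, one_mem _, by simp, by simp⟩

theorem polyFuns_le_Rg (Z : Set M) : polyFuns M ≤ Rg Z := fun f hf _ _ =>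
  ⟨f, hf, 1, one_mem _, by simp, by simp⟩

theorem Rg_mono {Z Z' : Set M} (h : Z ⊆ Z') : Rg Z' ≤ Rg Z := by
  intro f hf z hz
  obtain ⟨a, ha, b, hb, hbz, h'⟩ := hf z (h hz)
  exact ⟨a, ha, b, hb, hbz, fun w hw => h' w (h hw)⟩

theorem Rg_inv {Z : Set M} {f : M → ℂ} (hf : f ∈ Rg Z) (h0 : ∀ z ∈ Z, f z ≠ 0) :
    (fun z => (f z)⁻¹) ∈ Rg Z := by
  intro z hz
  obtain ⟨a, ha, b, hb, hbz, h⟩ := hf z hz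
  refine ⟨b * b, mul_mem hb hb, a * b, mul_mem ha hb, ?_, ?_⟩
  · have := h z hz hbz
    simp only [Pi.mul_apply, ← this]
    simp [hbz, h0 z hz]
  · intro w hw hab
    simp only [Pi.mul_apply, ne_eq, mul_eq_zero, not_or] at hab ⊢
    have := h0 w hw
    rw [← h w hw hab.2]; field_simp

/-- Maps to a vector space that are regular along `Z`. -/
def RegMap (Z : Set M) (f : M → N) : Prop :=
  ∀ l : Module.Dual ℂ N, (fun m => l (f m)) ∈ Rg Z

theorem RegMap.mono {Z Z' : Set M} {f : M → N} (hf : RegMap Z' f) (h : Z ⊆ Z') : RegMap Z f :=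
  fun l => Rg_mono h (hf l)

theorem regMap_linear (Z : Set M) (f : M →ₗ[ℂ] N) : RegMap Z f := fun l =>
  polyFuns_le_Rg Z (polyFuns_dual (l ∘ₗ f))

theorem regMap_id (Z : Set M) : RegMap Z (fun m => m) := regMap_linear Z LinearMap.id

theorem regMap_const (Z : Set M) (c : N) : RegMap Z (fun _ => c) := fun l =>
  algebraMap_mem (Rg Z) (l c)

theorem RegMap.linear {Z : Set M} {f : M → N} (hf : RegMap Z f) (g : N →ₗ[ℂ] P) :
    RegMap Z (fun m => g (f m)) := fun l => hf (l ∘ₗ g)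

theorem RegMap.add {Z : Set M} {f g : M → N} (hf : RegMap Z f) (hg : RegMap Z g) :
    RegMap Z (fun m => f m + g m) := fun l => by
  simp only [map_add]; exact add_mem (hf l) (hg l)

theorem RegMap.neg {Z : Set M} {f : M → N} (hf : RegMap Z f) :
    RegMap Z (fun m => - f m) := fun l => by
  simp only [map_neg]; exact neg_mem (hf l)

theorem RegMap.sub {Z : Set M} {f g : M → N} (hf : RegMap Z f) (hg : RegMap Z g) :
    RegMap Z (fun m => f m - g m) := fun l => by
  simp only [map_sub]; exact sub_mem (hf l) (hg l)

theorem RegMap.sum {ι : Type*} (T : Finset ι) {Z : Set M} {f : ι → M → N}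
    (hf : ∀ i ∈ T, RegMap Z (f i)) : RegMap Z (fun m => ∑ i ∈ T, f i m) := fun l => by
  simp only [map_sum]
  have : (fun m => ∑ i ∈ T, l (f i m)) = ∑ i ∈ T, fun m => l (f i m) := by
    ext m; simp
  rw [this]; exact sum_mem fun i hi => hf i hi l

theorem RegMap.smul_fun {Z : Set M} {f : M → N} {a : M → ℂ} (ha : a ∈ Rg Z) (hf : RegMap Z f) :
    RegMap Z (fun m => a m • f m) := fun l => by
  simp only [map_smul, smul_eq_mul]; exact mul_mem ha (hf l)

theorem RegMap.zsmul {Z : Set M} {f : M → N} (c : ℤ) (hf : RegMap Z f) :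
    RegMap Z (fun m => c • f m) := fun l => by
  simp only [map_zsmul]; exact zsmul_mem (hf l) c

theorem RegMap.bilin [FiniteDimensional ℂ N] (B : N →ₗ[ℂ] P →ₗ[ℂ] Q) {Z : Set M} {f : M → N}
    {g : M → P} (hf : RegMap Z f) (hg : RegMap Z g) : RegMap Z (fun m => B (f m) (g m)) := by
  let e := Module.finBasis ℂ N
  have : (fun m => B (f m) (g m)) = fun m => ∑ i, e.coord i (f m) • B (e i) (g m) := by
    ext m
    conv_lhs => rw [← e.sum_repr (f m)]
    simp only [map_sum, map_smul, LinearMap.sum_apply, LinearMap.smul_apply,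
      Module.Basis.coord_apply]
  rw [this]
  exact RegMap.sum _ fun i _ => RegMap.smul_fun (hf _) (hg.linear _)

theorem RegMap.mem {Z : Set M} {f : M → ℂ} (hf : RegMap Z f) : f ∈ Rg Z :=
  hf LinearMap.id

theorem regMap_of_mem {Z : Set M} {f : M → ℂ} (hf : f ∈ Rg Z) : RegMap Z f := fun l => by
  have : (fun m => l (f m)) = fun m => f m * l 1 := by
    ext m; rw [← smul_eq_mul, ← map_smul]; simp
  rw [this]; exact mul_mem hf (algebraMap_mem (Rg Z) (l 1))

theorem RegMap.prodMk {Z : Set M} {f : M → N} {g : M → P} (hf : RegMap Z f) (hg : RegMap Z g) :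
    RegMap Z (fun m => (f m, g m)) := by
  have : (fun m => (f m, g m)) = fun m =>
      LinearMap.inl ℂ N P (f m) + LinearMap.inr ℂ N P (g m) := by ext m <;> simp
  rw [this]; exact (hf.linear _).add (hg.linear _)

theorem regMap_pi {ι : Type} [Finite ι] {N : ι → Type} [∀ i, AddCommGroup (N i)]
    [∀ i, Module ℂ (N i)] {Z : Set M} {f : M → ∀ i, N i}
    (hf : ∀ i, RegMap Z (fun m => f m i)) : RegMap Z f := by
  have := Fintype.ofFinite ι
  have : f = fun m => ∑ i, LinearMap.single ℂ N i (f m i) := by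
    ext m i; simp
  rw [this]; exact RegMap.sum _ fun i _ => (hf i).linear _

theorem RegMap.proj {ι : Type} {N : ι → Type} [∀ i, AddCommGroup (N i)]
    [∀ i, Module ℂ (N i)] {Z : Set M} {f : M → ∀ i, N i} (hf : RegMap Z f) (i : ι) :
    RegMap Z (fun m => f m i) := hf.linear (LinearMap.proj i)

theorem RegMap.fst {Z : Set M} {f : M → N × P} (hf : RegMap Z f) :
    RegMap Z (fun m => (f m).1) := hf.linear (LinearMap.fst ℂ N P)

theorem RegMap.snd {Z : Set M} {f : M → N × P} (hf : RegMap Z f) :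
    RegMap Z (fun m => (f m).2) := hf.linear (LinearMap.snd ℂ N P)

theorem RegMap.lcomp [FiniteDimensional ℂ N] [FiniteDimensional ℂ P] [FiniteDimensional ℂ Q]
    {Z : Set M} {f : M → P →ₗ[ℂ] Q} {g : M → N →ₗ[ℂ] P} (hf : RegMap Z f) (hg : RegMap Z g) :
    RegMap Z (fun m => f m ∘ₗ g m) :=
  RegMap.bilin (LinearMap.llcomp ℂ N P Q) hf hg

theorem RegMap.lmul [FiniteDimensional ℂ N]
    {Z : Set M} {f g : M → Module.End ℂ N} (hf : RegMap Z f) (hg : RegMap Z g) :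
    RegMap Z (fun m => f m * g m) := RegMap.lcomp hf hg

theorem RegMap.lapply [FiniteDimensional ℂ N] [FiniteDimensional ℂ P]
    {Z : Set M} {f : M → N →ₗ[ℂ] P} {g : M → N} (hf : RegMap Z f) (hg : RegMap Z g) :
    RegMap Z (fun m => f m (g m)) :=
  RegMap.bilin (LinearMap.id) hf hg

theorem RegMap.comp_poly {Z : Set M} {f : M → N} (hf : RegMap Z f) {g : N → ℂ}
    (hg : g ∈ polyFuns N) : (fun m => g (f m)) ∈ Rg Z := by
  induction hg using Algebra.adjoin_induction with
  | mem x hx => obtain ⟨l, rfl⟩ := hx; exact hf l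
  | algebraMap r => exact algebraMap_mem (Rg Z) r
  | add x y _ _ hx hy => exact add_mem hx hy
  | mul x y _ _ hx hy => exact mul_mem hx hy

theorem RegMap.comp_fun {Z : Set M} {f : M → N} (hf : RegMap Z f) {Z' : Set N}
    (hm : ∀ z ∈ Z, f z ∈ Z') {g : N → ℂ} (hg : g ∈ Rg Z') : (fun m => g (f m)) ∈ Rg Z := by
  intro z hz
  obtain ⟨a, ha, b, hb, hbz, h⟩ := hg _ (hm z hz)
  obtain ⟨a1, ha1, b1, hb1, hbz1, h1⟩ := hf.comp_poly ha z hz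
  obtain ⟨a2, ha2, b2, hb2, hbz2, h2⟩ := hf.comp_poly hb z hz
  refine ⟨a1 * b2 * b2, mul_mem (mul_mem ha1 hb2) hb2, b1 * a2 * b2,
    mul_mem (mul_mem hb1 ha2) hb2, ?_, ?_⟩
  · simp only [Pi.mul_apply, ← h2 z hz hbz2]
    simp [hbz, hbz1, hbz2]
  · intro w hw hbw
    simp only [Pi.mul_apply, ne_eq, mul_eq_zero, not_or] at hbw ⊢
    have e2 := h2 w hw hbw.2
    have e1 := h1 w hw hbw.1.1
    beta_reduce at e1 e2
    have e0 := h _ (hm w hw) (fun h0 => hbw.1.2 (by rw [← e2, h0, mul_zero]))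
    rw [← e1, ← e2, ← e0]; ring

theorem RegMap.comp {Z : Set M} {f : M → N} (hf : RegMap Z f) {Z' : Set N}
    (hm : ∀ z ∈ Z, f z ∈ Z') {g : N → P} (hg : RegMap Z' g) : RegMap Z (fun m => g (f m)) :=
  fun l => hf.comp_fun hm (hg l)

theorem Rg_congr {Z : Set M} {f g : M → ℂ} (hf : f ∈ Rg Z) (h : ∀ z ∈ Z, g z = f z) :
    g ∈ Rg Z := by
  intro z hz
  obtain ⟨a, ha, b, hb, hbz, h'⟩ := hf z hz
  exact ⟨a, ha, b, hb, hbz, fun w hw hbw => by rw [h w hw]; exact h' w hw hbw⟩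

theorem RegMap.congr {Z : Set M} {f g : M → N} (hf : RegMap Z f) (h : ∀ z ∈ Z, g z = f z) :
    RegMap Z g := fun l => Rg_congr (hf l) fun z hz => by rw [h z hz]

/-- `U` is a relatively open subset of `S` for the Zariski topology. -/
def RelOpen (S U : Set M) : Prop :=
  U ⊆ S ∧ ∀ z ∈ U, ∃ b ∈ polyFuns M, b z ≠ 0 ∧ ∀ z' ∈ S, b z' ≠ 0 → z' ∈ U

theorem RelOpen.refl (S : Set M) : RelOpen S S :=
  ⟨subset_rfl, fun _ _ => ⟨1, one_mem _, by simp, fun _ h _ => h⟩⟩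

theorem RelOpen.inter {S U V : Set M} (hU : RelOpen S U) (hV : RelOpen S V) :
    RelOpen S (U ∩ V) := by
  refine ⟨fun z hz => hU.1 hz.1, fun z hz => ?_⟩
  obtain ⟨b, hb, hbz, h⟩ := hU.2 z hz.1
  obtain ⟨b', hb', hbz', h'⟩ := hV.2 z hz.2
  refine ⟨b * b', mul_mem hb hb', by simp [hbz, hbz'], fun w hw hbw => ?_⟩
  simp only [Pi.mul_apply, ne_eq, mul_eq_zero, not_or] at hbw
  exact ⟨h w hw hbw.1, h' w hw hbw.2⟩

theorem RelOpen.restrict {S U S' : Set M} (hU : RelOpen S U) (h : S' ⊆ S) :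
    RelOpen S' (S' ∩ U) := by
  refine ⟨Set.inter_subset_left, fun z hz => ?_⟩
  obtain ⟨b, hb, hbz, h'⟩ := hU.2 z hz.2
  exact ⟨b, hb, hbz, fun w hw hbw => ⟨hw, h' w (h hw) hbw⟩⟩

theorem relOpen_of_local {S U : Set M} (hU : U ⊆ S)
    (h : ∀ z ∈ U, ∃ V, RelOpen S V ∧ z ∈ V ∧ V ⊆ U) : RelOpen S U := by
  refine ⟨hU, fun z hz => ?_⟩
  obtain ⟨V, hV, hzV, hVU⟩ := h z hz
  obtain ⟨b, hb, hbz, h'⟩ := hV.2 z hzV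
  exact ⟨b, hb, hbz, fun w hw hbw => hVU (h' w hw hbw)⟩

theorem relOpen_ne_zero {S : Set M} {f : M → ℂ} (hf : f ∈ Rg S) :
    RelOpen S {z | z ∈ S ∧ f z ≠ 0} := by
  refine ⟨fun z hz => hz.1, fun z hz => ?_⟩
  obtain ⟨a, ha, b, hb, hbz, h⟩ := hf z hz.1
  refine ⟨a * b, mul_mem ha hb, ?_, fun w hw hbw => ⟨hw, fun h0 => ?_⟩⟩
  · simp [← h z hz.1 hbz, hbz, hz.2]
  · simp only [Pi.mul_apply, ne_eq, mul_eq_zero, not_or] at hbw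
    exact hbw.1 (by rw [← h w hw hbw.2, h0, mul_zero])

theorem RelOpen.preimage {S : Set M} {S' U' : Set N} {f : M → N} (hf : RegMap S f)
    (hm : ∀ z ∈ S, f z ∈ S') (hU : RelOpen S' U') : RelOpen S {z | z ∈ S ∧ f z ∈ U'} := by
  refine relOpen_of_local (fun z hz => hz.1) fun z hz => ?_
  obtain ⟨b, hb, hbz, h⟩ := hU.2 _ hz.2
  exact ⟨_, relOpen_ne_zero (hf.comp_poly hb), ⟨hz.1, hbz⟩,
    fun w hw => ⟨hw.1, h _ (hm w hw.1) hw.2⟩⟩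

theorem Rg_of_local {S : Set M} {f : M → ℂ}
    (h : ∀ z ∈ S, ∃ U, RelOpen S U ∧ z ∈ U ∧ f ∈ Rg U) : f ∈ Rg S := by
  intro z hz
  obtain ⟨U, hU, hzU, hf⟩ := h z hz
  obtain ⟨a, ha, b, hb, hbz, h1⟩ := hf z hzU
  obtain ⟨c, hc, hcz, h2⟩ := hU.2 z hzU
  refine ⟨a * c, mul_mem ha hc, b * c, mul_mem hb hc, by simp [hbz, hcz], fun w hw hbw => ?_⟩
  simp only [Pi.mul_apply, ne_eq, mul_eq_zero, not_or] at hbw ⊢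
  rw [← h1 w (h2 w hw hbw.2) hbw.1]; ring

theorem regMap_of_local {S : Set M} {f : M → N}
    (h : ∀ z ∈ S, ∃ U, RelOpen S U ∧ z ∈ U ∧ RegMap U f) : RegMap S f := fun l =>
  Rg_of_local fun z hz => by
    obtain ⟨U, hU, hzU, hf⟩ := h z hz
    exact ⟨U, hU, hzU, hf l⟩

/-- Evaluation of regular functions at a point. -/
def evRg (Z : Set M) (m : M) : Rg Z →+* ℂ :=
  (Pi.evalRingHom (fun _ => ℂ) m).comp (Rg Z).val.toRingHom

theorem det_mem_Rg {ι : Type} [Fintype ι] [DecidableEq ι] {Z : Set M} {f : M → Matrix ι ι ℂ}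
    (hf : ∀ i j, (fun m => f m i j) ∈ Rg Z) : (fun m => (f m).det) ∈ Rg Z := by
  let A : Matrix ι ι (Rg Z) := fun i j => ⟨_, hf i j⟩
  have : (fun m => (f m).det) = (A.det : Rg Z) := by
    ext m
    have h := (evRg Z m).map_det A
    exact h.symm
  rw [this]; exact (A.det).2

theorem adjugate_mem_Rg {ι : Type} [Fintype ι] [DecidableEq ι] {Z : Set M} {f : M → Matrix ι ι ℂ}
    (hf : ∀ i j, (fun m => f m i j) ∈ Rg Z) (i j : ι) :
    (fun m => (f m).adjugate i j) ∈ Rg Z := by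
  let A : Matrix ι ι (Rg Z) := fun i j => ⟨_, hf i j⟩
  have : (fun m => (f m).adjugate i j) = (A.adjugate i j : Rg Z) := by
    ext m
    have h := (evRg Z m).map_adjugate A
    exact (congrFun (congrFun h i) j).symm
  rw [this]; exact (A.adjugate i j).2

theorem regMap_toMatrix [FiniteDimensional ℂ N] {Z : Set M} {f : M → Module.End ℂ N}
    (hf : RegMap Z f) (i j) :
    (fun m => LinearMap.toMatrix (Module.finBasis ℂ N) (Module.finBasis ℂ N) (f m) i j) ∈ Rg Z := by
  have := (hf.lapply (regMap_const Z (Module.finBasis ℂ N j))).linear ((Module.finBasis ℂ N).coord i)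
  simpa [LinearMap.toMatrix_apply] using this.mem

theorem RegMap.det [FiniteDimensional ℂ N] {Z : Set M} {f : M → Module.End ℂ N}
    (hf : RegMap Z f) : (fun m => LinearMap.det (f m)) ∈ Rg Z := by
  simp_rw [← LinearMap.det_toMatrix (Module.finBasis ℂ N)]
  exact det_mem_Rg (regMap_toMatrix hf)

theorem RegMap.inverse [FiniteDimensional ℂ N] {Z : Set M} {f : M → Module.End ℂ N}
    (hf : RegMap Z f) (hd : ∀ z ∈ Z, LinearMap.det (f z) ≠ 0) :
    ∃ g : M → Module.End ℂ N, RegMap Z g ∧ ∀ z ∈ Z, g z * f z = 1 ∧ f z * g z = 1 := by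
  let b := Module.finBasis ℂ N
  let e := LinearMap.toMatrixAlgEquiv b
  refine ⟨fun m => (LinearMap.det (f m))⁻¹ • e.symm ((e (f m)).adjugate), ?_, ?_⟩
  · refine RegMap.smul_fun (Rg_inv hf.det hd) ?_
    have : RegMap Z (fun m => (e (f m)).adjugate) := by
      refine regMap_pi fun i => regMap_pi fun j => regMap_of_mem ?_
      exact adjugate_mem_Rg (regMap_toMatrix hf) i j
    exact this.linear e.symm.toLinearMap
  · intro z hz
    have h1 : e (f z) * (e (f z)).adjugate = LinearMap.det (f z) • 1 := by
      rw [Matrix.mul_adjugate, ← LinearMap.det_toMatrix b]; rfl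
    have h2 : (e (f z)).adjugate * e (f z) = LinearMap.det (f z) • 1 := by
      rw [Matrix.adjugate_mul, ← LinearMap.det_toMatrix b]; rfl
    constructor <;> apply e.injective
    · rw [map_mul, map_smul, AlgEquiv.apply_symm_apply, smul_mul_assoc, h2, smul_smul,
        inv_mul_cancel₀ (hd z hz), one_smul, map_one]
    · rw [map_mul, map_smul, AlgEquiv.apply_symm_apply, mul_smul_comm, h1, smul_smul,
        inv_mul_cancel₀ (hd z hz), one_smul, map_one]

theorem relOpen_injective [FiniteDimensional ℂ N] [FiniteDimensional ℂ P] {S : Set M}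
    {f : M → N →ₗ[ℂ] P} (hf : RegMap S f) :
    RelOpen S {z | z ∈ S ∧ Function.Injective (f z)} := by
  refine relOpen_of_local (fun z hz => hz.1) fun z hz => ?_
  obtain ⟨g, hg⟩ := LinearMap.exists_leftInverse_of_injective (f z) (LinearMap.ker_eq_bot.2 hz.2)
  refine ⟨_, relOpen_ne_zero (RegMap.det (f := fun m => g ∘ₗ f m)
    (RegMap.lcomp (regMap_const S g) hf)), ⟨hz.1, by simp [hg]⟩, fun w hw => ⟨hw.1, ?_⟩⟩
  have : Function.Injective (g ∘ₗ f w) := by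
    rw [← LinearMap.ker_eq_bot]
    by_contra h
    exact hw.2 (LinearMap.det_eq_zero_iff_ker_ne_bot.2 h)
  exact Function.Injective.of_comp this

end RegularFunctions

section Irreducible

variable {M N : Type} [AddCommGroup M] [Module ℂ M] [AddCommGroup N] [Module ℂ N]

/-- Irreducibility of a subset of a vector space for the Zariski topology, in terms of
polynomial functions. -/
def Irr (Z : Set M) : Prop :=
  Z.Nonempty ∧ ∀ a ∈ polyFuns M, ∀ b ∈ polyFuns M, (∃ z ∈ Z, a z ≠ 0) → (∃ z ∈ Z, b z ≠ 0) →
    ∃ z ∈ Z, a z ≠ 0 ∧ b z ≠ 0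

theorem Irr.inter {Z U V : Set M} (hZ : Irr Z) (hU : RelOpen Z U) (hV : RelOpen Z V)
    (hU0 : U.Nonempty) (hV0 : V.Nonempty) : (U ∩ V).Nonempty := by
  obtain ⟨u, hu⟩ := hU0
  obtain ⟨v, hv⟩ := hV0
  obtain ⟨a, ha, hau, h⟩ := hU.2 u hu
  obtain ⟨b, hb, hbv, h'⟩ := hV.2 v hv
  obtain ⟨z, hz, h1, h2⟩ := hZ.2 a ha b hb ⟨u, hU.1 hu, hau⟩ ⟨v, hV.1 hv, hbv⟩
  exact ⟨z, h z hz h1, h' z hz h2⟩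

theorem Irr.Rg_mul {Z : Set M} (hZ : Irr Z) {f g : M → ℂ} (hf : f ∈ Rg Z) (hg : g ∈ Rg Z)
    (h1 : ∃ z ∈ Z, f z ≠ 0) (h2 : ∃ z ∈ Z, g z ≠ 0) : ∃ z ∈ Z, f z ≠ 0 ∧ g z ≠ 0 := by
  obtain ⟨z, hz1, hz2⟩ := hZ.inter (relOpen_ne_zero hf) (relOpen_ne_zero hg)
    (by obtain ⟨z, h⟩ := h1; exact ⟨z, h⟩) (by obtain ⟨z, h⟩ := h2; exact ⟨z, h⟩)
  exact ⟨z, hz1.1, hz1.2, hz2.2⟩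

theorem Irr.image {Z : Set M} (hZ : Irr Z) {f : M → N} (hf : RegMap Z f) : Irr (f '' Z) := by
  refine ⟨hZ.1.image f, fun a ha b hb h1 h2 => ?_⟩
  simp only [Set.exists_mem_image] at *
  exact hZ.Rg_mul (hf.comp_poly ha) (hf.comp_poly hb) h1 h2

theorem Irr.relOpen {Z U : Set M} (hZ : Irr Z) (hU : RelOpen Z U) (h0 : U.Nonempty) : Irr U := by
  refine ⟨h0, fun a ha b hb ⟨z, hz, haz⟩ ⟨w, hw, hbw⟩ => ?_⟩
  obtain ⟨x, h1, h2⟩ := hZ.inter (relOpen_ne_zero (polyFuns_le_Rg Z ha))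
    (relOpen_ne_zero (polyFuns_le_Rg Z hb)) ⟨z, hU.1 hz, haz⟩ ⟨w, hU.1 hw, hbw⟩
  obtain ⟨y, h3, h4⟩ := hZ.inter ((relOpen_ne_zero (polyFuns_le_Rg Z ha)).inter
    (relOpen_ne_zero (polyFuns_le_Rg Z hb))) hU ⟨x, h1, h2⟩ h0
  exact ⟨y, h4, h3.1.2, h3.2.2⟩

theorem polyFuns_line {f : M → ℂ} (hf : f ∈ polyFuns M) (x y : M) :
    ∃ p : Polynomial ℂ, ∀ t, f (x + t • (y - x)) = p.eval t := by
  induction hf using Algebra.adjoin_induction with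
  | mem g hg =>
    obtain ⟨l, rfl⟩ := hg
    exact ⟨Polynomial.C (l x) + Polynomial.X * Polynomial.C (l (y - x)), fun t => by simp⟩
  | algebraMap r => exact ⟨Polynomial.C r, fun t => by simp⟩
  | add g g' _ _ h h' =>
    obtain ⟨p, hp⟩ := h
    obtain ⟨p', hp'⟩ := h'
    exact ⟨p + p', fun t => by simp [hp, hp']⟩
  | mul g g' _ _ h h' =>
    obtain ⟨p, hp⟩ := h
    obtain ⟨p', hp'⟩ := h'
    exact ⟨p * p', fun t => by simp [hp, hp']⟩

theorem irr_of_lines {Z : Set M} (h0 : Z.Nonempty)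
    (h : ∀ x ∈ Z, ∀ y ∈ Z, ∀ t : ℂ, x + t • (y - x) ∈ Z) : Irr Z := by
  refine ⟨h0, fun a ha b hb ⟨z, hz, haz⟩ ⟨w, hw, hbw⟩ => ?_⟩
  obtain ⟨p, hp⟩ := polyFuns_line ha z w
  obtain ⟨q, hq⟩ := polyFuns_line hb z w
  have hp0 : p ≠ 0 := by
    rintro rfl
    exact haz (by simpa using hp 0)
  have hq0 : q ≠ 0 := by
    rintro rfl
    exact hbw (by simpa using hq 1)
  obtain ⟨t, ht⟩ : ∃ t, (p * q).eval t ≠ 0 := by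
    by_contra! hc
    exact mul_ne_zero hp0 hq0 (Polynomial.funext fun t => by simpa using hc t)
  rw [Polynomial.eval_mul, mul_ne_zero_iff] at ht
  exact ⟨_, h z hz w hw t, by rw [hp]; exact ht.1, by rw [hq]; exact ht.2⟩

theorem irr_submodule (W : Submodule ℂ M) : Irr (W : Set M) :=
  irr_of_lines ⟨0, W.zero_mem⟩ fun _ hx _ hy _ =>
    W.add_mem hx (W.smul_mem _ (W.sub_mem hy hx))

/-- The zero locus, over `B`, of a family of linear maps. -/
def bundle (B : Set M) {F : Type} [AddCommGroup F] [Module ℂ F] (A : M → N →ₗ[ℂ] F) :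
    Set (M × N) := {e | e.1 ∈ B ∧ A e.1 e.2 = 0}

section Bundle

variable {F : Type} [AddCommGroup F] [Module ℂ F] [FiniteDimensional ℂ N] [FiniteDimensional ℂ F]

/-- Near every point a surjective family of linear maps has a regular family of right inverses. -/
theorem exists_local_rightInverse {C : Set M} {A : M → N →ₗ[ℂ] F} (hA : RegMap C A) {z : M}
    (hz : z ∈ C) (hs : Function.Surjective (A z)) :
    ∃ U, RelOpen C U ∧ z ∈ U ∧ ∃ (R : F →ₗ[ℂ] N) (g : M → Module.End ℂ F), RegMap U g ∧
      A z ∘ₗ R = LinearMap.id ∧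
      ∀ w ∈ U, (∀ v, g w (A w (R v)) = v) ∧ ∀ v, A w (R (g w v)) = v := by
  obtain ⟨R, hR⟩ := LinearMap.exists_rightInverse_of_surjective (A z) (LinearMap.range_eq_top.2 hs)
  have hAR : RegMap C (fun w => A w ∘ₗ R) := hA.lcomp (regMap_const C R)
  have hU := relOpen_ne_zero (RegMap.det (f := fun w => A w ∘ₗ R) hAR)
  obtain ⟨g, hg, hgi⟩ := RegMap.inverse (f := fun w => A w ∘ₗ R) (hAR.mono hU.1) (fun w hw => hw.2)
  exact ⟨_, hU, ⟨hz, by simp [hR]⟩, R, g, hg, hR, fun w hw =>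
    ⟨fun v => LinearMap.congr_fun (hgi w hw).1 v, fun v => LinearMap.congr_fun (hgi w hw).2 v⟩⟩

theorem Irr.bundle {C : Set M} (hC : Irr C) {A : M → N →ₗ[ℂ] F} (hA : RegMap C A)
    (hs : ∀ z ∈ C, Function.Surjective (A z)) : Irr (bundle C A) := by
  have key : ∀ a ∈ polyFuns (M × N), ∀ e ∈ _root_.bundle C A, a e ≠ 0 → ∃ U, RelOpen C U ∧ e.1 ∈ U ∧
      ∀ z ∈ U, ∃ w, A z w = 0 ∧ a (z, w) ≠ 0 := by
    intro a ha e he hae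
    obtain ⟨U, hU, hzU, R, g, hg, -, hAR⟩ := exists_local_rightInverse hA he.1 (hs _ he.1)
    have hsec : RegMap U (fun z => (z, e.2 - R (g z (A z e.2)))) :=
      (regMap_id U).prodMk ((regMap_const U e.2).sub
        ((hg.lapply ((hA.mono hU.1).lapply (regMap_const U e.2))).linear R))
    have h1 := relOpen_ne_zero (hsec.comp_poly ha)
    refine ⟨{z | z ∈ U ∧ a (z, e.2 - R (g z (A z e.2))) ≠ 0}, ?_, ⟨hzU, ?_⟩, ?_⟩
    · refine relOpen_of_local (fun z hz => hU.1 hz.1) fun z hz => ?_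
      obtain ⟨b, hb, hbz, h⟩ := h1.2 z hz
      exact ⟨U ∩ {z | z ∈ C ∧ b z ≠ 0}, hU.inter (relOpen_ne_zero (polyFuns_le_Rg C hb)),
        ⟨hz.1, hU.1 hz.1, hbz⟩, fun w hw => h w hw.1 hw.2.2⟩
    · rw [he.2]; simpa using hae
    · intro z hz
      refine ⟨_, ?_, hz.2⟩
      rw [map_sub, (hAR z hz.1).2, sub_self]
  obtain ⟨c, hc⟩ := hC.1
  refine ⟨⟨(c, 0), hc, map_zero _⟩, fun a ha b hb ⟨e, he, hae⟩ ⟨e', he', hbe⟩ => ?_⟩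
  obtain ⟨U, hU, heU, h⟩ := key a ha e he hae
  obtain ⟨V, hV, heV, h'⟩ := key b hb e' he' hbe
  obtain ⟨z, hzU, hzV⟩ := hC.inter hU hV ⟨_, heU⟩ ⟨_, heV⟩
  obtain ⟨w, hw, haw⟩ := h z hzU
  obtain ⟨w', hw', hbw'⟩ := h' z hzV
  have hirr : Irr ((fun w => (z, w)) '' (LinearMap.ker (A z) : Set N)) :=
    (irr_submodule _).image ((regMap_const _ z).prodMk (regMap_id _))
  obtain ⟨_, ⟨x, hx, rfl⟩, hx1, hx2⟩ := hirr.2 a ha b hb ⟨_, ⟨w, hw, rfl⟩, haw⟩ ⟨_, ⟨w', hw', rfl⟩, hbw'⟩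
  exact ⟨(z, x), ⟨hU.1 hzU, hx⟩, hx1, hx2⟩

end Bundle

theorem Irr.prod {Z : Set M} {W : Set N} (hZ : Irr Z) (hW : Irr W) : Irr (Z ×ˢ W) := by
  refine ⟨hZ.1.prod hW.1, fun a ha b hb ⟨e, he, hae⟩ ⟨e', he', hbe⟩ => ?_⟩
  have h1 : ∀ w : N, RegMap Z (fun z => (z, w)) := fun w => (regMap_id Z).prodMk (regMap_const Z w)
  have h2 : ∀ z : M, RegMap W (fun w => (z, w)) := fun z => (regMap_const W z).prodMk (regMap_id W)
  obtain ⟨z, hz, hz1, hz2⟩ := hZ.Rg_mul ((h1 e.2).comp_poly ha) ((h1 e'.2).comp_poly hb)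
    ⟨e.1, he.1, hae⟩ ⟨e'.1, he'.1, hbe⟩
  obtain ⟨w, hw, hw1, hw2⟩ := hW.Rg_mul ((h2 z).comp_poly ha) ((h2 z).comp_poly hb)
    ⟨e.2, he.2, hz1⟩ ⟨e'.2, he'.2, hz2⟩
  exact ⟨(z, w), ⟨hz, hw⟩, hw1, hw2⟩

end Irreducible

section Dimension

variable {M N : Type} [AddCommGroup M] [Module ℂ M] [AddCommGroup N] [Module ℂ N]

/-- Restriction of functions to a subset. -/
def resHom (Z : Set M) : (M → ℂ) →ₐ[ℂ] (Z → ℂ) :=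
  AlgHom.pi fun z => Pi.evalAlgHom ℂ _ z.1

omit [AddCommGroup M] [Module ℂ M] in
@[simp] theorem resHom_apply (Z : Set M) (f : M → ℂ) (z : Z) : resHom Z f z = f z := rfl

/-- Restrictions to `Z` of polynomial functions. -/
def CR (Z : Set M) : Subalgebra ℂ (Z → ℂ) := (polyFuns M).map (resHom Z)

/-- Restrictions to `Z` of regular functions. -/
def OR (Z : Set M) : Subalgebra ℂ (Z → ℂ) := (Rg Z).map (resHom Z)

theorem CR_le_OR (Z : Set M) : CR Z ≤ OR Z := Subalgebra.map_mono (polyFuns_le_Rg Z)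

/-- The transcendence degree of the ring of polynomial functions on `Z`. -/
def zd (Z : Set M) : Cardinal := Algebra.trdeg ℂ (CR Z)

theorem Irr.noZeroDivisors_OR {Z : Set M} (hZ : Irr Z) : NoZeroDivisors (OR Z) := by
  refine ⟨fun {a b} hab => ?_⟩
  obtain ⟨a, f, hf, rfl⟩ := a
  obtain ⟨b, g, hg, rfl⟩ := b
  by_contra! h
  have key : ∀ f : M → ℂ, resHom Z f ≠ 0 → ∃ z ∈ Z, f z ≠ 0 := by
    intro f hf
    obtain ⟨z, hz⟩ := Function.ne_iff.1 hf
    exact ⟨z.1, z.2, hz⟩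
  obtain ⟨z, hz, h1, h2⟩ := hZ.Rg_mul hf hg (key f fun h0 => h.1 (Subtype.ext h0))
    (key g fun h0 => h.2 (Subtype.ext h0))
  have := congrFun (congrArg Subtype.val hab) ⟨z, hz⟩
  exact mul_ne_zero h1 h2 this

theorem Irr.isDomain_OR {Z : Set M} (hZ : Irr Z) : IsDomain (OR Z) := by
  have := hZ.noZeroDivisors_OR
  have : Nonempty Z := hZ.1.to_subtype
  have : Nontrivial (OR Z) := inferInstance
  exact NoZeroDivisors.to_isDomain _

theorem Irr.isDomain_CR {Z : Set M} (hZ : Irr Z) : IsDomain (CR Z) := by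
  have := hZ.isDomain_OR
  exact (Subalgebra.inclusion_injective (CR_le_OR Z)).isDomain (Subalgebra.inclusion (CR_le_OR Z)).toRingHom

theorem faithful_CR {Z : Set M} (h0 : Z.Nonempty) : FaithfulSMul ℂ (CR Z) := by
  obtain ⟨z, hz⟩ := h0
  refine (faithfulSMul_iff_algebraMap_injective _ _).2 fun a b h => ?_
  exact congrFun (congrArg Subtype.val h) ⟨z, hz⟩

theorem Irr.trdeg_OR {Z : Set M} (hZ : Irr Z) : Algebra.trdeg ℂ (OR Z) = zd Z := by
  have := hZ.isDomain_OR
  have := hZ.isDomain_CR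
  have hinj := Subalgebra.inclusion_injective (CR_le_OR Z)
  let : Algebra (CR Z) (OR Z) := (Subalgebra.inclusion (CR_le_OR Z)).toRingHom.toAlgebra
  have hs : IsScalarTower ℂ (CR Z) (OR Z) := IsScalarTower.of_algebraMap_eq fun r => rfl
  have hf : FaithfulSMul (CR Z) (OR Z) := (faithfulSMul_iff_algebraMap_injective _ _).2 hinj
  have := faithful_CR hZ.1
  have halg : Algebra.IsAlgebraic (CR Z) (OR Z) := by
    refine ⟨fun ⟨x, f, hf, hx⟩ => ?_⟩
    subst hx
    obtain ⟨z, hz⟩ := hZ.1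
    obtain ⟨a, ha, b, hb, hbz, h⟩ := hf z hz
    let b' : CR Z := ⟨resHom Z (b * b), _, mul_mem hb hb, rfl⟩
    let a' : CR Z := ⟨resHom Z (a * b), _, mul_mem ha hb, rfl⟩
    refine ⟨Polynomial.C b' * Polynomial.X - Polynomial.C a', fun h0 => ?_, ?_⟩
    · have h1 := congrArg (fun p => Polynomial.coeff p 1) h0
      simp [Polynomial.coeff_C] at h1
      have := congrFun (congrArg Subtype.val h1) ⟨z, hz⟩
      exact mul_ne_zero hbz hbz this
    · simp only [map_sub, map_mul, Polynomial.aeval_C, Polynomial.aeval_X]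
      rw [sub_eq_zero]
      apply Subtype.ext
      funext w
      change b w * b w * f w = a w * b w
      by_cases hbw : b w = 0
      · simp [hbw]
      · rw [mul_assoc, h w w.2 hbw, mul_comm]
  rw [zd, ← trdeg_add_eq ℂ (CR Z) (A := OR Z),
    trdeg_eq_zero (R := CR Z) (A := OR Z), add_zero]

/-- `Y` is Zariski dense in `Z`. -/
def ZDense (Y Z : Set M) : Prop :=
  ∀ a ∈ polyFuns M, (∀ y ∈ Y, a y = 0) → ∀ z ∈ Z, a z = 0

theorem zd_mono {Y Z : Set M} (h : Y ⊆ Z) : zd Y ≤ zd Z := by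
  let r : (Z → ℂ) →ₐ[ℂ] (Y → ℂ) := AlgHom.pi fun y => Pi.evalAlgHom ℂ _ ⟨y.1, h y.2⟩
  refine trdeg_le_of_surjective ((r.comp (CR Z).val).codRestrict (CR Y) ?_) ?_
  · rintro ⟨_, f, hf, rfl⟩
    exact ⟨f, hf, rfl⟩
  · rintro ⟨_, f, hf, rfl⟩
    exact ⟨⟨_, f, hf, rfl⟩, rfl⟩

theorem Irr.zd_image_le {Z : Set M} (hZ : Irr Z) {f : M → N} (hf : RegMap Z f) :
    zd (f '' Z) ≤ zd Z := by
  rw [← hZ.trdeg_OR]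
  let r : (f '' Z → ℂ) →ₐ[ℂ] (Z → ℂ) :=
    AlgHom.pi fun z => Pi.evalAlgHom ℂ _ ⟨f z.1, z.1, z.2, rfl⟩
  refine trdeg_le_of_injective ((r.comp (CR (f '' Z)).val).codRestrict (OR Z) ?_) ?_
  · rintro ⟨_, g, hg, rfl⟩
    exact ⟨_, hf.comp_poly hg, rfl⟩
  · rintro ⟨g, hg⟩ ⟨g', hg'⟩ h
    apply Subtype.ext
    funext ⟨_, z, hz, rfl⟩
    exact congrFun (congrArg Subtype.val h) ⟨z, hz⟩

theorem zd_dense {Y Z : Set M} (h : Y ⊆ Z) (hd : ZDense Y Z) : zd Z = zd Y := by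
  refine le_antisymm ?_ (zd_mono h)
  let r : (Z → ℂ) →ₐ[ℂ] (Y → ℂ) := AlgHom.pi fun y => Pi.evalAlgHom ℂ _ ⟨y.1, h y.2⟩
  refine trdeg_le_of_injective ((r.comp (CR Z).val).codRestrict (CR Y) ?_) ?_
  · rintro ⟨_, f, hf, rfl⟩
    exact ⟨f, hf, rfl⟩
  · rw [injective_iff_map_eq_zero]
    rintro ⟨_, g, hg, rfl⟩ h
    apply Subtype.ext
    funext z
    exact hd g hg (fun y hy => congrFun (congrArg Subtype.val h) ⟨y, hy⟩) z z.2

theorem Irr.zDense {Z U : Set M} (hZ : Irr Z) (hU : RelOpen Z U) (h0 : U.Nonempty) :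
    ZDense U Z := by
  intro a ha h z hz
  by_contra haz
  obtain ⟨w, hw, hw'⟩ := hZ.inter hU (relOpen_ne_zero (polyFuns_le_Rg Z ha)) h0 ⟨z, hz, haz⟩
  exact hw'.2 (h w hw)

theorem Irr.zd_relOpen {Z U : Set M} (hZ : Irr Z) (hU : RelOpen Z U) (h0 : U.Nonempty) :
    zd U = zd Z := (zd_dense hU.1 (hZ.zDense hU h0)).symm

theorem zd_univ [FiniteDimensional ℂ M] : zd (Set.univ : Set M) = Module.finrank ℂ M := by
  let n := Module.finrank ℂ M
  let b := Module.finBasis ℂ M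
  let φ : MvPolynomial (Fin n) ℂ →ₐ[ℂ] (M → ℂ) := MvPolynomial.aeval fun i m => b.coord i m
  have hφ : ∀ p m, φ p m = MvPolynomial.eval (fun i => b.coord i m) p := by
    intro p m
    have : (Pi.evalAlgHom ℂ (fun _ => ℂ) m).comp φ = MvPolynomial.aeval (fun i => b.coord i m) := by
      ext i; simp [φ]
    exact DFunLike.congr_fun this p
  have hr : ∀ p, φ p ∈ polyFuns M := by
    intro p
    induction p using MvPolynomial.induction_on with
    | C a => simpa [φ] using algebraMap_mem (polyFuns M) a
    | add p q hp hq => simp [add_mem hp hq]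
    | mul_X p i hp => simpa [φ] using mul_mem hp (polyFuns_dual (b.coord i))
  let ψ : MvPolynomial (Fin n) ℂ →ₐ[ℂ] CR (Set.univ : Set M) :=
    ((resHom Set.univ).comp φ).codRestrict _ fun p => ⟨_, hr p, rfl⟩
  have hb : Function.Bijective ψ := by
    constructor
    · rw [injective_iff_map_eq_zero]
      intro p hp
      apply MvPolynomial.funext
      intro x
      have h1 := congrFun (congrArg Subtype.val hp) ⟨b.equivFun.symm x, trivial⟩
      change φ p _ = 0 at h1
      rw [hφ] at h1
      have h2 : (fun i => b.coord i (b.equivFun.symm x)) = x := by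
        funext i
        rw [Module.Basis.coord_apply, ← Module.Basis.equivFun_apply, LinearEquiv.apply_symm_apply]
      rwa [h2] at h1
    · rintro ⟨_, f, hf, rfl⟩
      suffices h : ∃ p, φ p = f by
        obtain ⟨p, rfl⟩ := h
        exact ⟨p, rfl⟩
      induction hf using Algebra.adjoin_induction with
      | mem g hg =>
        obtain ⟨l, rfl⟩ := hg
        refine ⟨∑ i, MvPolynomial.C (l (b i)) * MvPolynomial.X i, ?_⟩
        funext m
        conv_rhs => rw [← b.sum_repr m]
        rw [hφ]
        simp only [map_sum, map_mul, MvPolynomial.eval_C, MvPolynomial.eval_X, map_smul, smul_eq_mul,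
          Module.Basis.coord_apply]
        exact Finset.sum_congr rfl fun i _ => mul_comm _ _
      | algebraMap r => exact ⟨MvPolynomial.C r, by simp [φ]⟩
      | add g g' _ _ h h' =>
        obtain ⟨p, hp⟩ := h
        obtain ⟨p', hp'⟩ := h'
        exact ⟨p + p', by simp [hp, hp']⟩
      | mul g g' _ _ h h' =>
        obtain ⟨p, hp⟩ := h
        obtain ⟨p', hp'⟩ := h'
        exact ⟨p * p', by simp [hp, hp']⟩
  rw [zd, ← (AlgEquiv.ofBijective ψ hb).trdeg_eq, MvPolynomial.trdeg_of_isDomain]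
  simp [n]

theorem zd_lt_aleph0 [FiniteDimensional ℂ M] (Z : Set M) : zd Z < Cardinal.aleph0 :=
  (zd_mono (Set.subset_univ Z)).trans_lt (zd_univ (M := M) ▸ Cardinal.natCast_lt_aleph0)

/-- Regular isomorphisms between subsets of vector spaces. -/
structure RIso (S : Set M) (T : Set N) where
  f : M → N
  g : N → M
  rf : RegMap S f
  rg : RegMap T g
  mf : ∀ z ∈ S, f z ∈ T
  mg : ∀ z ∈ T, g z ∈ S
  gf : ∀ z ∈ S, g (f z) = z
  fg : ∀ z ∈ T, f (g z) = z

namespace RIso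

variable {S : Set M} {T : Set N}

def symm (e : RIso S T) : RIso T S := ⟨e.g, e.f, e.rg, e.rf, e.mg, e.mf, e.fg, e.gf⟩

theorem image_image (e : RIso S T) {C : Set M} (hC : C ⊆ S) : e.g '' (e.f '' C) = C := by
  rw [← Set.image_comp]
  conv_rhs => rw [← Set.image_id C]
  exact Set.image_congr fun z hz => e.gf z (hC hz)

theorem zd_image (e : RIso S T) {C : Set M} (hC : C ⊆ S) (hI : Irr C) : zd (e.f '' C) = zd C := by
  have h1 : RegMap C e.f := e.rf.mono hC
  have hs : e.f '' C ⊆ T := by rintro _ ⟨z, hz, rfl⟩; exact e.mf z (hC hz)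
  refine le_antisymm (hI.zd_image_le h1) ?_
  conv_lhs => rw [← e.image_image hC]
  exact (hI.image h1).zd_image_le (e.rg.mono hs)

theorem image_eq (e : RIso S T) : e.f '' S = T := by
  apply Set.Subset.antisymm
  · rintro _ ⟨z, hz, rfl⟩; exact e.mf z hz
  · exact fun w hw => ⟨e.g w, e.mg w hw, e.fg w hw⟩

theorem zd_eq (e : RIso S T) (hI : Irr S) : zd T = zd S := by
  rw [← e.zd_image subset_rfl hI, e.image_eq]

end RIso

theorem zd_submodule [FiniteDimensional ℂ M] (W : Submodule ℂ M) :
    zd (W : Set M) = Module.finrank ℂ W := by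
  obtain ⟨g, hg⟩ := W.exists_isCompl
  let e : RIso (Set.univ : Set W) (W : Set M) :=
    ⟨W.subtype, W.projectionOnto g hg, regMap_linear _ _, regMap_linear _ _, fun z _ => z.2,
      fun _ _ => trivial, fun z _ => by simp, fun z hz => by
        simpa using congrArg Subtype.val (Submodule.projectionOnto_apply_left hg ⟨z, hz⟩)⟩
  rw [e.zd_eq (by simpa using irr_submodule (⊤ : Submodule ℂ W)), zd_univ]

/-- Pulling back polynomial functions. -/
def CRpull {Z : Set M} {W : Set N} (f : M →ₗ[ℂ] N) (h : ∀ z ∈ Z, f z ∈ W) : CR W →ₐ[ℂ] CR Z :=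
  ((AlgHom.pi fun z : Z => Pi.evalAlgHom ℂ (fun _ : W => ℂ) ⟨f z.1, h _ z.2⟩).comp
    (CR W).val).codRestrict (CR Z) (by
      rintro ⟨_, g, hg, rfl⟩
      refine ⟨fun m => g (f m), ?_, rfl⟩
      induction hg using Algebra.adjoin_induction with
      | mem x hx => obtain ⟨l, rfl⟩ := hx; exact polyFuns_dual (l ∘ₗ f)
      | algebraMap r => exact algebraMap_mem (polyFuns M) r
      | add x y _ _ hx hy => exact add_mem hx hy
      | mul x y _ _ hx hy => exact mul_mem hx hy)

/-- Evaluation of functions at a point. -/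
def CRev {Z : Set M} (z : Z) : CR Z →ₐ[ℂ] ℂ := (Pi.evalAlgHom ℂ _ z).comp (CR Z).val

theorem Irr.zd_prod {Z : Set M} {W : Set N} (hZ : Irr Z) (hW : Irr W) :
    zd (Z ×ˢ W) = zd Z + zd W := by
  have := hZ.isDomain_CR
  have := hW.isDomain_CR
  have := (hZ.prod hW).isDomain_CR
  have := faithful_CR hZ.1
  have := faithful_CR hW.1
  let pZ : CR Z →ₐ[ℂ] CR (Z ×ˢ W) := CRpull (LinearMap.fst ℂ M N) fun z hz => hz.1
  let pW : CR W →ₐ[ℂ] CR (Z ×ˢ W) := CRpull (LinearMap.snd ℂ M N) fun z hz => hz.2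
  obtain ⟨z0, hz0⟩ := hZ.1
  obtain ⟨w0, hw0⟩ := hW.1
  have hinj : Function.Injective pZ := by
    intro a b h
    apply Subtype.ext
    funext z
    exact congrFun (congrArg Subtype.val h) ⟨(z.1, w0), z.2, hw0⟩
  let : Algebra (CR Z) (CR (Z ×ˢ W)) := pZ.toRingHom.toAlgebra
  have hs : IsScalarTower ℂ (CR Z) (CR (Z ×ˢ W)) :=
    IsScalarTower.of_algebraMap_eq fun r => (pZ.commutes r).symm
  have hf : FaithfulSMul (CR Z) (CR (Z ×ˢ W)) := (faithfulSMul_iff_algebraMap_injective _ _).2 hinj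
  obtain ⟨ι, x, hx⟩ := exists_isTranscendenceBasis' ℂ (CR W)
  have hy1 : AlgebraicIndependent (CR Z) (fun i => pW (x i)) := by
    rw [algebraicIndependent_iff]
    intro p hp
    have key : ∀ z : Z, MvPolynomial.map (CRev z).toRingHom p = 0 := by
      intro z
      refine (algebraicIndependent_iff.1 hx.1) _ ?_
      apply Subtype.ext
      funext w
      have h1 : ∀ q : MvPolynomial ι (CR Z),
          CRev w (MvPolynomial.aeval x (MvPolynomial.map (CRev z).toRingHom q)) =
          CRev (Z := Z ×ˢ W) ⟨(z.1, w.1), z.2, w.2⟩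
            (MvPolynomial.aeval (fun i => pW (x i)) q) := by
        intro q
        induction q using MvPolynomial.induction_on with
        | C a => simp; rfl
        | add p q hp hq => simp only [map_add, hp, hq]
        | mul_X p i hp =>
          simp only [map_mul, hp, MvPolynomial.map_X, MvPolynomial.aeval_X]
          rfl
      have h2 := h1 p
      rw [hp, map_zero] at h2
      exact h2
    ext m z
    have := congrArg (MvPolynomial.coeff m) (key z)
    rw [MvPolynomial.coeff_map] at this
    exact this
  have hy2 : Algebra.IsAlgebraic (Algebra.adjoin (CR Z) (Set.range fun i => pW (x i)))
      (CR (Z ×ˢ W)) := by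
    have hdom : IsDomain (Algebra.adjoin (CR Z) (Set.range fun i => pW (x i))) := inferInstance
    have hA := hx.isAlgebraic
    have h2 : ∀ b : CR W, IsAlgebraic (Algebra.adjoin (CR Z) (Set.range fun i => pW (x i)))
        (pW b) := by
      intro b
      have hm : ∀ c ∈ Algebra.adjoin ℂ (Set.range x),
          pW c ∈ Algebra.adjoin (CR Z) (Set.range fun i => pW (x i)) := by
        intro c hc
        induction hc using Algebra.adjoin_induction with
        | mem y hy => obtain ⟨i, rfl⟩ := hy; exact Algebra.subset_adjoin ⟨i, rfl⟩
        | algebraMap r =>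
          have : pW (algebraMap ℂ _ r) = algebraMap (CR Z) _ (algebraMap ℂ _ r) := rfl
          rw [this]
          exact algebraMap_mem _ _
        | add x y _ _ hx hy => rw [map_add]; exact add_mem hx hy
        | mul x y _ _ hx hy => rw [map_mul]; exact mul_mem hx hy
      let g : Algebra.adjoin ℂ (Set.range x) →+*
          Algebra.adjoin (CR Z) (Set.range fun i => pW (x i)) :=
        (pW.toRingHom.comp (Subalgebra.val _).toRingHom).codRestrict
          (Algebra.adjoin (CR Z) (Set.range fun i => pW (x i))).toSubring fun c => hm c.1 c.2
      refine (hA.isAlgebraic b).ringHom_of_comp_eq g pW.toRingHom ?_ rfl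
      intro c d h
      apply Subtype.ext
      apply Subtype.ext
      funext w
      exact congrFun (congrArg Subtype.val (congrArg Subtype.val h)) ⟨(z0, w.1), hz0, w.2⟩
    refine ⟨fun ⟨a, f, hf, ha⟩ => ?_⟩
    have h1 : ∃ hm : resHom (Z ×ˢ W) f ∈ CR (Z ×ˢ W), IsAlgebraic
        (Algebra.adjoin (CR Z) (Set.range fun i => pW (x i)))
        (⟨resHom (Z ×ˢ W) f, hm⟩ : CR (Z ×ˢ W)) := by
      clear ha
      induction hf using Algebra.adjoin_induction with
      | mem y hy =>
        refine ⟨⟨_, Algebra.subset_adjoin hy, rfl⟩, ?_⟩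
        obtain ⟨l, rfl⟩ := id hy
        let u : CR Z := ⟨_, _, polyFuns_dual (l ∘ₗ LinearMap.inl ℂ M N), rfl⟩
        let v : CR W := ⟨_, _, polyFuns_dual (l ∘ₗ LinearMap.inr ℂ M N), rfl⟩
        have h3 : IsAlgebraic (Algebra.adjoin (CR Z) (Set.range fun i => pW (x i))) (pZ u) :=
          isAlgebraic_algebraMap (A := CR (Z ×ˢ W))
            (algebraMap (CR Z) (Algebra.adjoin (CR Z) (Set.range fun i => pW (x i))) u)
        have he : (⟨resHom (Z ×ˢ W) l, ⟨_, Algebra.subset_adjoin hy, rfl⟩⟩ : CR (Z ×ˢ W)) =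
            pZ u + pW v := ?_
        · rw [he]
          exact h3.add (h2 v)
        apply Subtype.ext
        funext e
        change l e.1 = l (e.1.1, 0) + l (0, e.1.2)
        rw [← map_add]
        simp
      | algebraMap r =>
        refine ⟨⟨_, algebraMap_mem (polyFuns _) r, rfl⟩, ?_⟩
        exact isAlgebraic_algebraMap (A := CR (Z ×ˢ W))
            (algebraMap (CR Z) (Algebra.adjoin (CR Z) (Set.range fun i => pW (x i)))
              (algebraMap ℂ _ r))
      | add x y _ _ hx hy =>
        obtain ⟨h1, h1'⟩ := hx
        obtain ⟨h2, h2'⟩ := hy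
        exact ⟨by rw [map_add]; exact add_mem h1 h2, h1'.add h2'⟩
      | mul x y _ _ hx hy =>
        obtain ⟨h1, h1'⟩ := hx
        obtain ⟨h2, h2'⟩ := hy
        exact ⟨by rw [map_mul]; exact mul_mem h1 h2, h1'.mul h2'⟩
    obtain ⟨_, h1⟩ := h1
    subst ha
    exact h1
  have hy := hy1.isTranscendenceBasis_iff_isAlgebraic.2 hy2
  rw [zd, zd, zd, ← trdeg_add_eq ℂ (CR Z) (A := CR (Z ×ˢ W)), ← hx.cardinalMk_eq_trdeg,
    ← hy.cardinalMk_eq_trdeg]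

end Dimension

section Components

variable {M N : Type} [AddCommGroup M] [Module ℂ M] [AddCommGroup N] [Module ℂ N]

/-- The Zariski closure of a subset of a vector space. -/
def zcl (Y : Set M) : Set M := {z | ∀ a ∈ polyFuns M, (∀ y ∈ Y, a y = 0) → a z = 0}

theorem subset_zcl (Y : Set M) : Y ⊆ zcl Y := fun y hy _ _ h => h y hy

theorem zcl_mono {Y Z : Set M} (h : Y ⊆ Z) : zcl Y ⊆ zcl Z :=
  fun _ hz a ha h' => hz a ha fun y hy => h' y (h hy)

theorem Irr.of_dense {Y Z : Set M} (hY : Irr Y) (h : Y ⊆ Z) (h' : Z ⊆ zcl Y) : Irr Z := by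
  refine ⟨hY.1.mono h, fun a ha b hb ⟨z, hz, haz⟩ ⟨w, hw, hbw⟩ => ?_⟩
  have key : ∀ a ∈ polyFuns M, ∀ z ∈ Z, a z ≠ 0 → ∃ y ∈ Y, a y ≠ 0 := by
    intro a ha z hz haz
    by_contra! hc
    exact haz (h' hz a ha hc)
  obtain ⟨y, hy, h1⟩ := hY.2 a ha b hb (key a ha z hz haz) (key b hb w hw hbw)
  exact ⟨y, h hy, h1⟩

theorem Irr.dense_irr {Y Z : Set M} (hZ : Irr Z) (h : Y ⊆ Z) (h' : Z ⊆ zcl Y) : Irr Y := by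
  have key : ∀ a ∈ polyFuns M, (∃ z ∈ Z, a z ≠ 0) → ∃ y ∈ Y, a y ≠ 0 := by
    rintro a ha ⟨z, hz, haz⟩
    by_contra! hc
    exact haz (h' hz a ha hc)
  refine ⟨?_, fun a ha b hb ⟨z, hz, haz⟩ ⟨w, hw, hbw⟩ => ?_⟩
  · obtain ⟨z, hz⟩ := hZ.1
    obtain ⟨y, hy, -⟩ := key 1 (one_mem _) ⟨z, hz, by simp⟩
    exact ⟨y, hy⟩
  · obtain ⟨z, hz, h1, h2⟩ := hZ.2 a ha b hb ⟨z, h hz, haz⟩ ⟨w, h hw, hbw⟩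
    obtain ⟨y, hy, h3⟩ := key (a * b) (mul_mem ha hb) ⟨z, hz, mul_ne_zero h1 h2⟩
    exact ⟨y, hy, left_ne_zero_of_mul h3, right_ne_zero_of_mul h3⟩

theorem zd_of_dense {Y Z : Set M} (h : Y ⊆ Z) (h' : Z ⊆ zcl Y) : zd Z = zd Y :=
  zd_dense h fun a ha hy _ hz => h' hz a ha hy

theorem RelOpen.meets {S U Y : Set M} (hU : RelOpen S U) (hY : Y ⊆ S) {z : M} (hz : z ∈ U)
    (hc : z ∈ zcl Y) : (U ∩ Y).Nonempty := by
  obtain ⟨b, hb, hbz, h⟩ := hU.2 z hz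
  by_contra hn
  refine hbz (hc b hb fun y hy => ?_)
  by_contra hby
  exact hn ⟨y, h y (hY hy) hby, hy⟩

theorem Irr.subset_zcl_of_cover {Y : Set M} (hY : Irr Y) {𝒞 : Set (Set M)} (hf : 𝒞.Finite)
    (h : Y ⊆ ⋃₀ 𝒞) : ∃ C ∈ 𝒞, Y ⊆ zcl (Y ∩ C) := by
  by_contra! hc
  have key : ∀ T : Finset (Set M), (∀ C ∈ T, ¬ Y ⊆ zcl (Y ∩ C)) →
      ∃ a ∈ polyFuns M, (∃ y ∈ Y, a y ≠ 0) ∧ ∀ C ∈ T, ∀ y ∈ Y ∩ C, a y = 0 := by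
    intro T
    induction T using Finset.induction_on with
    | empty => exact fun _ => ⟨1, one_mem _, by obtain ⟨y, hy⟩ := hY.1; exact ⟨y, hy, by simp⟩, by simp⟩
    | insert C T _ ih =>
      intro hT
      obtain ⟨a, ha, ha1, ha2⟩ := ih fun C hC => hT C (Finset.mem_insert_of_mem hC)
      obtain ⟨z, hz, hz'⟩ := Set.not_subset.1 (hT C (Finset.mem_insert_self _ _))
      simp only [zcl, Set.mem_ofPred_eq, not_forall] at hz'
      obtain ⟨b, hb, hb1, hb2⟩ := hz'
      obtain ⟨y, hy, h1, h2⟩ := hY.2 a ha b hb ha1 ⟨z, hz, hb2⟩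
      refine ⟨a * b, mul_mem ha hb, ⟨y, hy, mul_ne_zero h1 h2⟩, fun D hD y hy => ?_⟩
      rcases Finset.mem_insert.1 hD with rfl | hD
      · simp [hb1 y hy]
      · simp [ha2 D hD y hy]
  obtain ⟨a, ha, ⟨y, hy, hay⟩, h2⟩ := key hf.toFinset fun C hC => hc C (hf.mem_toFinset.1 hC)
  obtain ⟨C, hC, hyC⟩ := h hy
  exact hay (h2 C (hf.mem_toFinset.2 hC) y ⟨hy, hyC⟩)

/-- The irreducible components of `S`, as subsets of the ambient vector space. -/
def comps (S : Set M) : Set (Set M) := {C | Maximal (fun C => C ⊆ S ∧ Irr C) C}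

/-- Every irreducible component of `S` has dimension `d`. -/
def PureDim (S : Set M) (d : ℕ) : Prop := ∀ C ∈ comps S, zd C = d

theorem comps_irr {S C : Set M} (h : C ∈ comps S) : Irr C := h.1.2

theorem comps_subset {S C : Set M} (h : C ∈ comps S) : C ⊆ S := h.1.1

theorem comps_eq {S C D : Set M} (h : C ∈ comps S) (hD : Irr D) (hDS : D ⊆ S) (hCD : C ⊆ D) :
    D = C := (h.2 ⟨hDS, hD⟩ hCD).antisymm hCD

theorem comps_closed {S C : Set M} (h : C ∈ comps S) : S ∩ zcl C = C :=
  comps_eq h ((comps_irr h).of_dense (fun _ hz => ⟨comps_subset h hz, subset_zcl _ hz⟩)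
    Set.inter_subset_right) Set.inter_subset_left fun _ hz => ⟨comps_subset h hz, subset_zcl _ hz⟩

theorem Irr.closure_inter {S C : Set M} (h : Irr C) (hC : C ⊆ S) : Irr (S ∩ zcl C) :=
  h.of_dense (fun _ hz => ⟨hC hz, subset_zcl _ hz⟩) Set.inter_subset_right

theorem isOpen_zariski {U : Set M} : @IsOpen M (zariski M) U ↔ RelOpen Set.univ U := by
  constructor
  · intro h
    induction h with
    | basic s hs =>
      obtain ⟨P, hP, rfl⟩ := hs
      exact ⟨Set.subset_univ _, fun z hz => ⟨P, hP, hz, fun _ _ h => h⟩⟩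
    | univ => exact RelOpen.refl _
    | inter s t _ _ hs ht => exact hs.inter ht
    | sUnion 𝒮 _ h =>
      exact relOpen_of_local (Set.subset_univ _) fun z ⟨s, hs, hz⟩ =>
        ⟨s, h s hs, hz, Set.subset_sUnion_of_mem hs⟩
  · intro h
    choose! b hb hbz h' using h.2
    have : U = ⋃ z ∈ U, {x | b z x ≠ 0} := by
      ext x
      simp only [Set.mem_iUnion, Set.mem_ofPred_eq, exists_prop]
      exact ⟨fun hx => ⟨x, hx, hbz x hx⟩, fun ⟨z, hz, hx⟩ => h' z hz x trivial hx⟩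
    rw [this]
    let := zariski M
    exact isOpen_biUnion fun z hz => TopologicalSpace.isOpen_generateFrom_of_mem ⟨b z, hb z hz, rfl⟩

theorem isIrreducible_zariski {Z : Set M} : @IsIrreducible M (zariski M) Z ↔ Irr Z := by
  let := zariski M
  constructor
  · rintro ⟨h0, h⟩
    refine ⟨h0, fun a ha b hb ⟨z, hz, h1⟩ ⟨w, hw, h2⟩ => ?_⟩
    obtain ⟨x, hx, h3, h4⟩ := h {x | a x ≠ 0} {x | b x ≠ 0}
      (TopologicalSpace.isOpen_generateFrom_of_mem ⟨a, ha, rfl⟩)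
      (TopologicalSpace.isOpen_generateFrom_of_mem ⟨b, hb, rfl⟩) ⟨z, hz, h1⟩ ⟨w, hw, h2⟩
    exact ⟨x, hx, h3, h4⟩
  · rintro h
    refine ⟨h.1, fun u v hu hv ⟨z, hz, h1⟩ ⟨w, hw, h2⟩ => ?_⟩
    obtain ⟨x, ⟨hx, h3⟩, -, h4⟩ := h.inter ((isOpen_zariski.1 hu).restrict (Set.subset_univ Z))
      ((isOpen_zariski.1 hv).restrict (Set.subset_univ Z)) ⟨z, hz, h1⟩ ⟨w, hw, h2⟩
    exact ⟨x, hx, h3, h4⟩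

theorem isIrreducible_induced {X Y : Type*} [TopologicalSpace Y] (f : X → Y) {C : Set X} :
    @IsIrreducible X (TopologicalSpace.induced f inferInstance) C ↔ IsIrreducible (f '' C) := by
  let : TopologicalSpace X := TopologicalSpace.induced f inferInstance
  constructor
  · exact fun h => h.image f continuous_induced_dom.continuousOn
  · rintro ⟨h0, h⟩
    refine ⟨h0.of_image, ?_⟩
    rintro _ _ ⟨u, hu, rfl⟩ ⟨v, hv, rfl⟩ ⟨z, hz, h1⟩ ⟨w, hw, h2⟩
    obtain ⟨_, ⟨x, hx, rfl⟩, h3⟩ := h u v hu hv ⟨f z, ⟨z, hz, rfl⟩, h1⟩ ⟨f w, ⟨w, hw, rfl⟩, h2⟩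
    exact ⟨x, hx, h3⟩

theorem isIrreducible_subTop {S : Set M} {C : Set S} :
    @IsIrreducible S (subTop S) C ↔ Irr (Subtype.val '' C) := by
  let := zariski M
  rw [← isIrreducible_zariski]
  exact isIrreducible_induced _

theorem zIrr_iff {S : Set M} {C : Set S} : C ∈ zIrr S ↔ Subtype.val '' C ∈ comps S := by
  simp only [zIrr, irreducibleComponents, comps, Set.mem_ofPred_eq, Maximal, isIrreducible_subTop]
  constructor
  · rintro ⟨h1, h2⟩
    refine ⟨⟨by simp, h1⟩, fun D ⟨hD, hD'⟩ hCD => ?_⟩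
    have hD2 : Subtype.val '' (Subtype.val ⁻¹' D : Set S) = D := by simpa using hD
    have := h2 (y := Subtype.val ⁻¹' D) (by rwa [hD2])
      (fun z hz => hCD ⟨z, hz, rfl⟩)
    rw [← hD2]
    exact Set.image_mono this
  · rintro ⟨⟨-, h1⟩, h2⟩
    refine ⟨h1, fun D hD hCD => ?_⟩
    have := h2 (y := Subtype.val '' D) ⟨by simp, hD⟩ (Set.image_mono hCD)
    exact (Set.image_subset_image_iff Subtype.val_injective).1 this

theorem image_zIrr (S : Set M) : Set.image Subtype.val '' zIrr S = comps S := by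
  ext C
  constructor
  · rintro ⟨D, hD, rfl⟩; exact zIrr_iff.1 hD
  · intro hC
    have h2 : Subtype.val '' (Subtype.val ⁻¹' C : Set S) = C := by simpa using comps_subset hC
    exact ⟨_, zIrr_iff.2 (by rwa [h2]), h2⟩

theorem ncard_zIrr (S : Set M) : (zIrr S).ncard = (comps S).ncard := by
  rw [← image_zIrr, Set.ncard_image_of_injective _ (Set.image_injective.2 Subtype.val_injective)]

theorem Irr.exists_comps {S Y : Set M} (hY : Irr Y) (h : Y ⊆ S) : ∃ C ∈ comps S, Y ⊆ C := by
  let := subTop S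
  have h2 : Subtype.val '' (Subtype.val ⁻¹' Y : Set S) = Y := by simpa using h
  obtain ⟨C, hC, hYC⟩ := exists_mem_irreducibleComponents_subset_of_isIrreducible
    (Subtype.val ⁻¹' Y : Set S) (isIrreducible_subTop.2 (by rwa [h2]))
  refine ⟨_, zIrr_iff.1 hC, ?_⟩
  rw [← h2]
  exact Set.image_mono hYC

theorem irr_singleton (z : M) : Irr ({z} : Set M) :=
  ⟨⟨z, rfl⟩, fun _ _ _ _ ⟨_, hw, h⟩ ⟨_, hv, h'⟩ => ⟨z, rfl, by cases hw; exact h, by cases hv; exact h'⟩⟩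

section Noetherian

variable [FiniteDimensional ℂ M]

theorem polyFuns_finiteType : Algebra.FiniteType ℂ (polyFuns M) := by
  let b := Module.finBasis ℂ M
  have h : polyFuns M = Algebra.adjoin ℂ (Set.range fun i => (b.coord i : M → ℂ)) := by
    apply le_antisymm
    · refine Algebra.adjoin_le ?_
      rintro _ ⟨l, rfl⟩
      have : (l : M → ℂ) = ∑ i, l (b i) • (b.coord i : M → ℂ) := by
        funext m
        conv_lhs => rw [← b.sum_repr m]
        simp only [map_sum, map_smul, smul_eq_mul, Finset.sum_apply, Pi.smul_apply,
          Module.Basis.coord_apply]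
        exact Finset.sum_congr rfl fun i _ => mul_comm _ _
      change (l : M → ℂ) ∈ _
      rw [this]
      exact sum_mem fun i _ => Subalgebra.smul_mem _ (Algebra.subset_adjoin (Set.mem_range_self i)) _
    · refine Algebra.adjoin_mono ?_
      rintro _ ⟨i, rfl⟩
      exact ⟨b.coord i, rfl⟩
  rw [h]
  exact (Subalgebra.fg_iff_finiteType _).1
    ⟨(Set.finite_range fun i => (b.coord i : M → ℂ)).toFinset, by simp⟩

theorem polyFuns_noetherian : IsNoetherianRing (polyFuns M) :=
  have := polyFuns_finiteType (M := M)
  Algebra.FiniteType.isNoetherianRing ℂ _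

/-- The ideal of polynomial functions vanishing on a set. -/
def vanIdeal (Z : Set M) : Ideal (polyFuns M) where
  carrier := {a | ∀ z ∈ Z, a.1 z = 0}
  add_mem' := fun {a b} ha hb z hz => by
    change a.1 z + b.1 z = 0
    rw [ha z hz, hb z hz, add_zero]
  zero_mem' := fun _ _ => rfl
  smul_mem' := fun c a ha z hz => by
    change c.1 z * a.1 z = 0
    rw [ha z hz, mul_zero]

theorem noetherian_zariski : @TopologicalSpace.NoetherianSpace M (zariski M) := by
  let := zariski M
  have := polyFuns_noetherian (M := M)
  refine StrictMono.wellFoundedGT (β := Ideal (polyFuns M))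
    (f := fun U : TopologicalSpace.Opens M => vanIdeal (U : Set M)ᶜ) ?_
  intro U V hUV
  refine lt_of_le_of_ne (fun a ha z hz => ha z fun h => hz (hUV.le h)) fun heq => ?_
  refine hUV.not_ge fun z hz => ?_
  by_contra hzU
  obtain ⟨b, hb, hbz, h⟩ := (isOpen_zariski.1 V.2).2 z hz
  have h1 : (⟨b, hb⟩ : polyFuns M) ∈ vanIdeal (V : Set M)ᶜ := by
    intro w hw
    by_contra hbw
    exact hw (h w trivial hbw)
  have h2 : (⟨b, hb⟩ : polyFuns M) ∈ vanIdeal (U : Set M)ᶜ := by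
    have h3 : vanIdeal (U : Set M)ᶜ = vanIdeal (V : Set M)ᶜ := heq
    rwa [h3]
  exact hbz (h2 z hzU)

theorem comps_finite (S : Set M) : (comps S).Finite := by
  let := zariski M
  let := subTop S
  have := noetherian_zariski (M := M)
  have hi : Topology.IsInducing (Subtype.val : S → M) := ⟨rfl⟩
  have := hi.noetherianSpace
  rw [← image_zIrr]
  exact (TopologicalSpace.NoetherianSpace.finite_irreducibleComponents (α := S)).image _

end Noetherian

theorem prod_subset_prod {α β : Type*} {A A' : Set α} {B B' : Set β} (h0 : (A ×ˢ B).Nonempty)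
    (h : A ×ˢ B ⊆ A' ×ˢ B') : A ⊆ A' ∧ B ⊆ B' := by
  obtain ⟨⟨a, b⟩, ha, hb⟩ := h0
  exact ⟨fun x hx => (h (show (x, b) ∈ A ×ˢ B from ⟨hx, hb⟩)).1,
    fun y hy => (h (show (a, y) ∈ A ×ˢ B from ⟨ha, hy⟩)).2⟩

theorem comps_prod (S : Set M) (T : Set N) :
    comps (S ×ˢ T) = Set.image2 (fun C D => C ×ˢ D) (comps S) (comps T) := by
  have h1 : ∀ K : Set (M × N), Irr K → K ⊆ S ×ˢ T → ∃ C ∈ comps S, ∃ D ∈ comps T, K ⊆ C ×ˢ D := by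
    intro K hK hKS
    obtain ⟨C, hC, hKC⟩ := (hK.image (regMap_linear K (LinearMap.fst ℂ M N))).exists_comps (S := S)
      (by rintro _ ⟨z, hz, rfl⟩; exact (hKS hz).1)
    obtain ⟨D, hD, hKD⟩ := (hK.image (regMap_linear K (LinearMap.snd ℂ M N))).exists_comps (S := T)
      (by rintro _ ⟨z, hz, rfl⟩; exact (hKS hz).2)
    exact ⟨C, hC, D, hD, fun z hz => ⟨hKC ⟨z, hz, rfl⟩, hKD ⟨z, hz, rfl⟩⟩⟩
  have h2 : ∀ C ∈ comps S, ∀ D ∈ comps T, C ×ˢ D ∈ comps (S ×ˢ T) := by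
    intro C hC D hD
    refine ⟨⟨Set.prod_mono (comps_subset hC) (comps_subset hD), (comps_irr hC).prod (comps_irr hD)⟩,
      fun K ⟨hKS, hK⟩ hCK => ?_⟩
    obtain ⟨C', hC', D', hD', hK'⟩ := h1 K hK hKS
    have h3 := prod_subset_prod ((comps_irr hC).1.prod (comps_irr hD).1) (hCK.trans hK')
    rw [comps_eq hC (comps_irr hC') (comps_subset hC') h3.1,
      comps_eq hD (comps_irr hD') (comps_subset hD') h3.2] at hK'
    exact hK'
  ext K
  constructor
  · intro hK
    obtain ⟨C, hC, D, hD, h⟩ := h1 K (comps_irr hK) (comps_subset hK)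
    refine ⟨C, hC, D, hD, ?_⟩
    have := h2 C hC D hD
    exact comps_eq hK (comps_irr this) (comps_subset this) h
  · rintro ⟨C, hC, D, hD, rfl⟩
    exact h2 C hC D hD

theorem ncard_image2_prod {α β : Type*} {A : Set (Set α)} {B : Set (Set β)}
    (hA : ∀ a ∈ A, a.Nonempty) (hB : ∀ b ∈ B, b.Nonempty) :
    (Set.image2 (fun C D => C ×ˢ D) A B).ncard = A.ncard * B.ncard := by
  rw [← Set.image_prod, ← Set.ncard_prod, Set.InjOn.ncard_image]
  rintro ⟨a, b⟩ h ⟨a', b'⟩ h' heq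
  have := (Set.prod_eq_prod_iff_of_nonempty ((hA a h.1).prod (hB b h.2))).1 heq
  exact Prod.ext this.1 this.2

theorem ncard_comps_prod (S : Set M) (T : Set N) :
    (comps (S ×ˢ T)).ncard = (comps S).ncard * (comps T).ncard := by
  rw [comps_prod, ncard_image2_prod (fun C hC => (comps_irr hC).1) fun C hC => (comps_irr hC).1]

theorem isIrreducible_prod {X Y : Type*} [TopologicalSpace X] [TopologicalSpace Y] {C : Set X}
    {D : Set Y} (hC : IsIrreducible C) (hD : IsIrreducible D) : IsIrreducible (C ×ˢ D) := by
  refine ⟨hC.1.prod hD.1, ?_⟩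
  rintro u v hu hv ⟨⟨a, b⟩, hab, habu⟩ ⟨⟨c, d⟩, hcd, hcdv⟩
  obtain ⟨U1, U2, h1, h2, ha, hb, hU⟩ := isOpen_prod_iff.1 hu a b habu
  obtain ⟨V1, V2, h3, h4, hc, hd, hV⟩ := isOpen_prod_iff.1 hv c d hcdv
  obtain ⟨x, hx, hx1, hx2⟩ := hC.2 U1 V1 h1 h3 ⟨a, hab.1, ha⟩ ⟨c, hcd.1, hc⟩
  obtain ⟨y, hy, hy1, hy2⟩ := hD.2 U2 V2 h2 h4 ⟨b, hab.2, hb⟩ ⟨d, hcd.2, hd⟩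
  exact ⟨(x, y), ⟨hx, hy⟩, hU ⟨hx1, hy1⟩, hV ⟨hx2, hy2⟩⟩

theorem irreducibleComponents_prod (X Y : Type*) [TopologicalSpace X] [TopologicalSpace Y] :
    irreducibleComponents (X × Y) =
      Set.image2 (fun C D => C ×ˢ D) (irreducibleComponents X) (irreducibleComponents Y) := by
  have h1 : ∀ K : Set (X × Y), IsIrreducible K →
      ∃ C ∈ irreducibleComponents X, ∃ D ∈ irreducibleComponents Y, K ⊆ C ×ˢ D := by
    intro K hK
    obtain ⟨C, hC, hKC⟩ := exists_mem_irreducibleComponents_subset_of_isIrreducible _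
      (hK.image Prod.fst continuous_fst.continuousOn)
    obtain ⟨D, hD, hKD⟩ := exists_mem_irreducibleComponents_subset_of_isIrreducible _
      (hK.image Prod.snd continuous_snd.continuousOn)
    exact ⟨C, hC, D, hD, fun z hz => ⟨hKC ⟨z, hz, rfl⟩, hKD ⟨z, hz, rfl⟩⟩⟩
  have h2 : ∀ C ∈ irreducibleComponents X, ∀ D ∈ irreducibleComponents Y,
      C ×ˢ D ∈ irreducibleComponents (X × Y) := by
    intro C hC D hD
    refine ⟨isIrreducible_prod hC.1 hD.1, fun K hK hCK => ?_⟩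
    obtain ⟨C', hC', D', hD', hK'⟩ := h1 K hK
    have h3 := prod_subset_prod (hC.1.1.prod hD.1.1) (hCK.trans hK')
    exact hK'.trans (Set.prod_mono (hC.2 hC'.1 h3.1) (hD.2 hD'.1 h3.2))
  ext K
  constructor
  · intro hK
    obtain ⟨C, hC, D, hD, h⟩ := h1 K hK.1
    exact ⟨C, hC, D, hD, (hK.2 (h2 C hC D hD).1 h).antisymm h⟩
  · rintro ⟨C, hC, D, hD, rfl⟩
    exact h2 C hC D hD

theorem zIrrProdCount_eq (S : Set M) (T : Set N) :
    zIrrProdCount S T = (comps S).ncard * (comps T).ncard := by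
  let := subTop S
  let := subTop T
  rw [zIrrProdCount, irreducibleComponents_prod, ncard_image2_prod (fun C hC => hC.1.1)
    (fun C hC => hC.1.1), ← ncard_zIrr, ← ncard_zIrr]
  rfl

theorem PureDim.prod {S : Set M} {T : Set N} {d e : ℕ} (hS : PureDim S d) (hT : PureDim T e) :
    PureDim (S ×ˢ T) (d + e) := by
  intro K hK
  rw [comps_prod] at hK
  obtain ⟨C, hC, D, hD, rfl⟩ := hK
  rw [(comps_irr hC).zd_prod (comps_irr hD), hS C hC, hT D hD, Nat.cast_add]

theorem comps_relOpen {S U : Set M} (hU : RelOpen S U) :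
    comps U = (fun C => C ∩ U) '' {C | C ∈ comps S ∧ (C ∩ U).Nonempty} := by
  have hI : ∀ C ∈ comps S, (C ∩ U).Nonempty → Irr (C ∩ U) := fun C hC h0 =>
    (comps_irr hC).relOpen (hU.restrict (comps_subset hC)) h0
  ext K
  constructor
  · intro hK
    obtain ⟨C, hC, hKC⟩ := (comps_irr hK).exists_comps ((comps_subset hK).trans hU.1)
    have h1 : K ⊆ C ∩ U := fun z hz => ⟨hKC hz, comps_subset hK hz⟩
    have h0 := (comps_irr hK).1.mono h1
    exact ⟨C, ⟨hC, h0⟩, comps_eq hK (hI C hC h0) Set.inter_subset_right h1⟩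
  · rintro ⟨C, ⟨hC, h0⟩, rfl⟩
    refine ⟨⟨Set.inter_subset_right, hI C hC h0⟩, fun D ⟨hD, hD'⟩ hCD => ?_⟩
    obtain ⟨C', hC', hDC⟩ := hD'.exists_comps (hD.trans hU.1)
    have h2 : C ⊆ C' := by
      intro z hz
      rw [← comps_closed hC']
      refine ⟨comps_subset hC hz, fun a ha h => ?_⟩
      exact (comps_irr hC).zDense (hU.restrict (comps_subset hC)) h0 a ha
        (fun y hy => h y (hDC (hCD hy))) z hz
    have h3 := comps_eq hC (comps_irr hC') (comps_subset hC') h2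
    exact fun z hz => ⟨h3 ▸ hDC hz, hD hz⟩

theorem comps_relOpen_injOn {S U : Set M} (hU : RelOpen S U) :
    Set.InjOn (fun C => C ∩ U) {C | C ∈ comps S ∧ (C ∩ U).Nonempty} := by
  have key : ∀ C ∈ comps S, (C ∩ U).Nonempty → S ∩ zcl (C ∩ U) = C := by
    intro C hC h0
    apply Set.Subset.antisymm
    · conv_rhs => rw [← comps_closed hC]
      exact Set.inter_subset_inter_right _ (zcl_mono Set.inter_subset_left)
    · exact fun z hz => ⟨comps_subset hC hz, fun a ha h =>
        (comps_irr hC).zDense (hU.restrict (comps_subset hC)) h0 a ha h z hz⟩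
  rintro C ⟨hC, h0⟩ D ⟨hD, h0'⟩ h
  rw [← key C hC h0, ← key D hD h0']
  exact congrArg (fun X => S ∩ zcl X) h

theorem PureDim.relOpen {S U : Set M} {d : ℕ} (hS : PureDim S d) (hU : RelOpen S U) : PureDim U d := by
  intro K hK
  rw [comps_relOpen hU] at hK
  obtain ⟨C, ⟨hC, h0⟩, rfl⟩ := hK
  change zd (C ∩ U) = _
  rw [(comps_irr hC).zd_relOpen (hU.restrict (comps_subset hC)) h0, hS C hC]

theorem comps_relOpen_meets {S U : Set M} (hU : RelOpen S U)
    (h : ∀ C ∈ comps S, (C ∩ U).Nonempty) :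
    (comps U).ncard = (comps S).ncard ∧ ∀ d, PureDim U d → PureDim S d := by
  have h1 : {C | C ∈ comps S ∧ (C ∩ U).Nonempty} = comps S := by
    ext C; exact ⟨fun h => h.1, fun hC => ⟨hC, h C hC⟩⟩
  constructor
  · rw [comps_relOpen hU, (comps_relOpen_injOn hU).ncard_image, h1]
  · intro d hd C hC
    rw [← hd (C ∩ U) (by rw [comps_relOpen hU]; exact ⟨C, ⟨hC, h C hC⟩, rfl⟩),
      (comps_irr hC).zd_relOpen (hU.restrict (comps_subset hC)) (h C hC)]

theorem RIso.image_mem_comps {S : Set M} {T : Set N} (e : RIso S T) {C : Set M}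
    (hC : C ∈ comps S) : e.f '' C ∈ comps T := by
  have hm : e.f '' C ⊆ T := by rintro _ ⟨z, hz, rfl⟩; exact e.mf z (comps_subset hC hz)
  refine ⟨⟨hm, (comps_irr hC).image (e.rf.mono (comps_subset hC))⟩, fun D ⟨hD, hD'⟩ hCD => ?_⟩
  have h1 : e.g '' D = C := by
    refine comps_eq hC (hD'.image (e.rg.mono hD)) ?_ ?_
    · rintro _ ⟨z, hz, rfl⟩; exact e.mg z (hD hz)
    · rw [← e.image_image (comps_subset hC)]
      exact Set.image_mono hCD
  rw [← h1]
  exact (e.symm.image_image hD).ge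

theorem RIso.comps_eq {S : Set M} {T : Set N} (e : RIso S T) :
    comps T = Set.image e.f '' comps S := by
  ext D
  constructor
  · intro hD
    exact ⟨_, e.symm.image_mem_comps hD, e.symm.image_image (comps_subset hD)⟩
  · rintro ⟨C, hC, rfl⟩
    exact e.image_mem_comps hC

theorem RIso.ncard_comps {S : Set M} {T : Set N} (e : RIso S T) :
    (comps T).ncard = (comps S).ncard := by
  rw [e.comps_eq, Set.InjOn.ncard_image]
  intro C hC D hD h
  rw [← e.image_image (comps_subset hC), ← e.image_image (comps_subset hD)]
  exact congrArg _ h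

theorem RIso.pure {S : Set M} {T : Set N} (e : RIso S T) {d : ℕ} (hS : PureDim S d) : PureDim T d := by
  intro D hD
  rw [e.comps_eq] at hD
  obtain ⟨C, hC, rfl⟩ := hD
  rw [e.zd_image (comps_subset hC) (comps_irr hC), hS C hC]

end Components

section Krull

theorem injective_of_trdeg_le {A B : Type} [CommRing A] [IsDomain A] [CommRing B] [IsDomain B]
    [Algebra ℂ A] [Algebra ℂ B] [FaithfulSMul ℂ B] (φ : A →ₐ[ℂ] B) (hφ : Function.Surjective φ)
    (hfin : Algebra.trdeg ℂ A < Cardinal.aleph0) (hle : Algebra.trdeg ℂ A ≤ Algebra.trdeg ℂ B) :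
    Function.Injective φ := by
  obtain ⟨ι, x, hx⟩ := exists_isTranscendenceBasis' ℂ B
  choose y hy using fun i => hφ (x i)
  have hxy : φ ∘ y = x := funext hy
  have hyi : AlgebraicIndependent ℂ y := .of_comp φ (by rw [hxy]; exact hx.1)
  have hyb := hyi.isTranscendenceBasis_of_trdeg_le hfin (by rwa [hx.cardinalMk_eq_trdeg])
  have halg := hyb.isAlgebraic
  rw [injective_iff_map_eq_zero]
  intro a ha
  by_contra ha0
  obtain ⟨r, hr, c, hc⟩ := (halg.isAlgebraic a).exists_nonzero_dvd (mem_nonZeroDivisors_of_ne_zero ha0)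
  apply hr
  have h1 : φ r.1 = 0 := by
    have : r.1 = a * c := hc
    rw [this, map_mul, ha, zero_mul]
  obtain ⟨p, hp⟩ : ∃ p : MvPolynomial ι ℂ, MvPolynomial.aeval y p = r.1 := by
    have h := Algebra.adjoin_range_eq_range_aeval ℂ y
    have h' : r.1 ∈ (MvPolynomial.aeval y : MvPolynomial ι ℂ →ₐ[ℂ] A).range := h ▸ r.2
    exact h'
  have h2 : MvPolynomial.aeval x p = 0 := by
    rw [← hxy]
    have : φ (MvPolynomial.aeval y p) = MvPolynomial.aeval (φ ∘ y) p := by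
      exact DFunLike.congr_fun (MvPolynomial.comp_aeval y φ) p
    rw [← this, hp, h1]
  have h3 := hx.1.eq_zero_of_aeval_eq_zero p h2
  apply Subtype.ext
  rw [← hp, h3, map_zero]
  rfl

variable {M : Type} [AddCommGroup M] [Module ℂ M] [FiniteDimensional ℂ M]

theorem Irr.subset_zcl_of_zd_le {Y Z : Set M} (hY : Irr Y) (hZ : Irr Z) (h : Y ⊆ Z)
    (hd : zd Z ≤ zd Y) : Z ⊆ zcl Y := by
  have := hY.isDomain_CR
  have := hZ.isDomain_CR
  have := faithful_CR hY.1
  have hm : ∀ z ∈ Y, (LinearMap.id : M →ₗ[ℂ] M) z ∈ Z := fun z hz => h hz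
  have hinj := injective_of_trdeg_le (CRpull (LinearMap.id : M →ₗ[ℂ] M) hm) (by
    rintro ⟨_, f, hf, rfl⟩
    exact ⟨⟨_, f, hf, rfl⟩, rfl⟩) (zd_lt_aleph0 Z) hd
  intro z hz a ha hay
  have h1 : CRpull (LinearMap.id : M →ₗ[ℂ] M) hm ⟨_, a, ha, rfl⟩ = 0 :=
    Subtype.ext (funext fun y => hay y.1 y.2)
  have h2 := hinj (h1.trans (map_zero _).symm)
  exact congrFun (congrArg Subtype.val h2) ⟨z, hz⟩

theorem CR_finiteType (Z : Set M) : Algebra.FiniteType ℂ (CR Z) := by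
  have := polyFuns_finiteType (M := M)
  exact Algebra.FiniteType.of_surjective (((resHom Z).comp (polyFuns M).val).codRestrict (CR Z)
    fun f => ⟨f.1, f.2, rfl⟩) (by rintro ⟨_, f, hf, rfl⟩; exact ⟨⟨f, hf⟩, rfl⟩)

theorem exists_eval_of_algHom (φ : polyFuns M →ₐ[ℂ] ℂ) : ∃ m : M, ∀ f : polyFuns M, φ f = f.1 m := by
  let ψ : Module.Dual ℂ (Module.Dual ℂ M) :=
    { toFun := fun l => φ ⟨l, polyFuns_dual l⟩
      map_add' := fun l l' => by rw [← map_add]; rfl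
      map_smul' := fun c l => by rw [RingHom.id_apply, ← map_smul]; rfl }
  obtain ⟨m, hm⟩ := (Module.evalEquiv ℂ M).surjective ψ
  refine ⟨m, fun f => ?_⟩
  obtain ⟨f, hf⟩ := f
  induction hf using Algebra.adjoin_induction with
  | mem x hx =>
    obtain ⟨l, rfl⟩ := hx
    have := LinearMap.congr_fun hm l
    exact this.symm
  | algebraMap r => exact φ.commutes r
  | add x y hx hy ihx ihy =>
    have : φ (⟨x, hx⟩ + ⟨y, hy⟩) = x m + y m := by rw [map_add, ihx, ihy]
    exact this
  | mul x y hx hy ihx ihy =>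
    have : φ (⟨x, hx⟩ * ⟨y, hy⟩) = x m * y m := by rw [map_mul, ihx, ihy]
    exact this

theorem CR_nullstellensatz {Z : Set M} (hZ : zcl Z ⊆ Z) (p : Ideal (CR Z)) (hp : p.IsPrime) {a : CR Z}
    (ha : a ∉ p) : ∃ z : Z, (∀ f ∈ p, f.1 z = 0) ∧ a.1 z ≠ 0 := by
  have := CR_finiteType Z
  have hJ : IsJacobsonRing (CR Z) := isJacobsonRing_of_finiteType (A := ℂ)
  have h1 : p.jacobson = p := hJ.out hp.isRadical
  have h2 : ∃ m : Ideal (CR Z), p ≤ m ∧ m.IsMaximal ∧ a ∉ m := by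
    by_contra! hc
    apply ha
    rw [← h1, Ideal.jacobson, Ideal.mem_sInf]
    exact fun {m} hm => hc m hm.1 hm.2
  obtain ⟨m, hpm, hm, ham⟩ := h2
  let := Ideal.Quotient.field m
  have hft : Algebra.FiniteType ℂ (CR Z ⧸ m) :=
    Algebra.FiniteType.of_surjective (Ideal.Quotient.mkₐ ℂ m) Ideal.Quotient.mk_surjective
  have hfin : Module.Finite ℂ (CR Z ⧸ m) := finite_of_finite_type_of_isJacobsonRing ℂ _
  have hbij : Function.Bijective (algebraMap ℂ (CR Z ⧸ m)) :=
    have : Algebra.IsIntegral ℂ (CR Z ⧸ m) := Algebra.IsIntegral.of_finite ℂ _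
    IsAlgClosed.algebraMap_bijective_of_isIntegral
  let e : ℂ ≃ₐ[ℂ] (CR Z ⧸ m) := AlgEquiv.ofBijective (Algebra.ofId ℂ _) hbij
  let φ : CR Z →ₐ[ℂ] ℂ := e.symm.toAlgHom.comp (Ideal.Quotient.mkₐ ℂ m)
  have hφ : ∀ f, φ f = 0 ↔ f ∈ m := by
    intro f
    have : φ f = e.symm (Ideal.Quotient.mk m f) := rfl
    rw [this, EmbeddingLike.map_eq_zero_iff, Ideal.Quotient.eq_zero_iff_mem]
  obtain ⟨z, hz⟩ := exists_eval_of_algHom (φ.comp (((resHom Z).comp (polyFuns M).val).codRestrict (CR Z)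
    fun f => ⟨f.1, f.2, rfl⟩))
  have hzZ : z ∈ Z := by
    refine hZ fun f hf h0 => ?_
    refine (hz ⟨f, hf⟩).symm.trans ?_
    have : (((resHom Z).comp (polyFuns M).val).codRestrict (CR Z)
      fun f => ⟨f.1, f.2, rfl⟩) ⟨f, hf⟩ = 0 := Subtype.ext (funext fun y => h0 y.1 y.2)
    rw [AlgHom.comp_apply, this, map_zero]
  have hz' : ∀ f : CR Z, φ f = f.1 ⟨z, hzZ⟩ := by
    rintro ⟨_, f, hf, rfl⟩
    exact hz ⟨f, hf⟩
  exact ⟨⟨z, hzZ⟩, fun f hf => by rw [← hz', hφ]; exact hpm hf, fun h0 => ham (by rw [← hφ, hz', h0])⟩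

theorem le_ringKrullDim_CR {Z : Set M} (hZ : Irr Z) {d : ℕ} (hd : zd Z = d) :
    (d : WithBot ℕ∞) ≤ ringKrullDim (CR Z) := by
  have := hZ.isDomain_CR
  have := CR_finiteType Z
  obtain ⟨n, g, hg, hgint⟩ := exists_integral_inj_algHom_of_fg ℂ (CR Z)
  algebraize [g.toRingHom]
  have : Algebra.IsIntegral (MvPolynomial (Fin n) ℂ) (CR Z) := ⟨hgint⟩
  have hinj : Function.Injective (algebraMap (MvPolynomial (Fin n) ℂ) (CR Z)) := hg
  have : FaithfulSMul (MvPolynomial (Fin n) ℂ) (CR Z) := (faithfulSMul_iff_algebraMap_injective _ _).2 hinj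
  have : IsScalarTower ℂ (MvPolynomial (Fin n) ℂ) (CR Z) := .of_algebraMap_eq fun c => (g.commutes c).symm
  have hdn : d = n := by
    have h1 := trdeg_add_eq (R := ℂ) (S := MvPolynomial (Fin n) ℂ) (A := CR Z)
    have h2 : Algebra.trdeg (MvPolynomial (Fin n) ℂ) (CR Z) = 0 := trdeg_eq_zero
    rw [h2, add_zero] at h1
    change _ = zd Z at h1
    rw [hd, MvPolynomial.trdeg_of_isDomain] at h1
    simpa using h1.symm
  have h3 : ringKrullDim (MvPolynomial (Fin n) ℂ) = n := by
    simp [MvPolynomial.ringKrullDim_of_isNoetherianRing]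
  rw [hdn, ← h3]
  refine iSup_le fun l => ?_
  obtain ⟨P, -, hP, hPl⟩ := Ideal.exists_ideal_over_prime_of_isIntegral
    (S := CR Z) l.head.asIdeal ⊥ (by
      intro a ha
      have : a = 0 := hinj (by simpa using ha)
      rw [this]; exact zero_mem _)
  have : P.LiesOver l.head.asIdeal := ⟨hPl.symm⟩
  obtain ⟨L, hL, -⟩ := Ideal.exists_ltSeries_of_hasGoingUp l P
  rw [← hL]
  exact Order.LTSeries.length_le_krullDim L

theorem topologicalKrullDim_eq {X : Type} [τ : TopologicalSpace X] {j : X → M}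
    (hj : τ = TopologicalSpace.induced j (zariski M))
    (hI : Irr (Set.range j)) (hc : zcl (Set.range j) ⊆ Set.range j) {d : ℕ}
    (hd : zd (Set.range j) = d) : topologicalKrullDim X = d := by
  have hirr : ∀ F : Set X, IsIrreducible F ↔ Irr (j '' F) := by
    intro F
    subst hj
    let := zariski M
    rw [isIrreducible_induced, isIrreducible_zariski]
  have hcl : ∀ F : Set X, IsClosed F → ∀ x, j x ∈ zcl (j '' F) → x ∈ F := by
    intro F hF x hx
    subst hj
    let := zariski M
    obtain ⟨K, hK, rfl⟩ := isClosed_induced_iff.1 hF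
    by_contra hxF
    obtain ⟨y, hy, z, hz, rfl⟩ := (isOpen_zariski.1 hK.isOpen_compl).meets (Set.subset_univ _) hxF hx
    exact hy hz
  apply le_antisymm
  · have hle : ∀ F : TopologicalSpace.IrreducibleCloseds X, zd (j '' F.1) ≤ d := fun F => by
      rw [← hd]; exact zd_mono (Set.image_subset_range _ _)
    have hlt : ∀ F, ∃ n : ℕ, n < d + 1 ∧ zd (j '' (F : TopologicalSpace.IrreducibleCloseds X).1) = n := by
      intro F
      obtain ⟨n, hn⟩ := Cardinal.lt_aleph0.1 ((hle F).trans_lt Cardinal.natCast_lt_aleph0)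
      have := hle F
      rw [hn] at this
      exact ⟨n, Nat.lt_succ_of_le (Nat.cast_le.1 this), hn⟩
    choose n hn hn' using hlt
    refine (Order.krullDim_le_of_strictMono (β := Fin (d + 1)) (fun F => ⟨n F, hn F⟩) ?_).trans ?_
    · intro F G hFG
      have h1 : j '' F.1 ⊆ j '' G.1 := Set.image_mono hFG.le
      have h2 : zd (j '' F.1) ≤ zd (j '' G.1) := zd_mono h1
      rw [Fin.mk_lt_mk, lt_iff_not_ge]
      intro hge
      have h3 : zd (j '' G.1) ≤ zd (j '' F.1) := by rw [hn', hn']; exact_mod_cast hge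
      have h4 := ((hirr _).1 F.2).subset_zcl_of_zd_le ((hirr _).1 G.2) h1 h3
      exact hFG.not_ge fun x hx => hcl F.1 F.3 x (h4 ⟨x, hx, rfl⟩)
    · refine iSup_le fun l => ?_
      have := l.length_lt_card
      rw [Fintype.card_fin] at this
      exact_mod_cast Nat.le_of_lt_succ this
  · refine (le_ringKrullDim_CR hI hd).trans ?_
    rw [ringKrullDim, ← Order.krullDim_orderDual]
    have hci : ∀ g ∈ polyFuns M, IsClosed {x | g (j x) = 0} := by
      intro g hg
      subst hj
      let := zariski M
      refine isClosed_induced_iff.2 ⟨{m | g m = 0}, ?_, rfl⟩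
      rw [← isOpen_compl_iff]
      exact TopologicalSpace.isOpen_generateFrom_of_mem ⟨g, hg, rfl⟩
    have hclosed : ∀ p : Ideal (CR (Set.range j)), IsClosed {x | ∀ f ∈ p, f.1 ⟨j x, x, rfl⟩ = 0} := by
      intro p
      have : {x | ∀ f ∈ p, f.1 ⟨j x, x, rfl⟩ = 0} =
          ⋂ f ∈ p, {x | f.1 ⟨j x, x, rfl⟩ = 0} := by
        ext x; simp
      rw [this]
      refine isClosed_biInter fun f hf => ?_
      obtain ⟨f, g, hg, rfl⟩ := f
      exact hci g hg
    have hirred : ∀ p : Ideal (CR (Set.range j)), p.IsPrime →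
        IsIrreducible {x | ∀ f ∈ p, f.1 ⟨j x, x, rfl⟩ = 0} := by
      intro p hp
      rw [hirr]
      have key : ∀ a ∈ polyFuns M, (∃ z ∈ j '' {x | ∀ f ∈ p, f.1 ⟨j x, x, rfl⟩ = 0}, a z ≠ 0) →
          ∀ ha : a ∈ polyFuns M, (⟨_, a, ha, rfl⟩ : CR (Set.range j)) ∉ p := by
        rintro a _ ⟨_, ⟨x, hx, rfl⟩, haz⟩ ha hap
        exact haz (hx _ hap)
      refine ⟨?_, fun a ha b hb h1 h2 => ?_⟩
      · obtain ⟨⟨_, x, rfl⟩, hx, -⟩ := CR_nullstellensatz hc p hp (a := 1)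
          (fun h => hp.ne_top ((Ideal.eq_top_iff_one _).2 h))
        exact ⟨_, x, hx, rfl⟩
      · obtain ⟨⟨_, x, rfl⟩, hx, hx'⟩ := CR_nullstellensatz hc p hp
          (fun h => (hp.mem_or_mem h).elim (key a ha h1 ha) (key b hb h2 hb))
        exact ⟨_, ⟨x, hx, rfl⟩, left_ne_zero_of_mul hx', right_ne_zero_of_mul hx'⟩
    refine Order.krullDim_le_of_strictMono (β := TopologicalSpace.IrreducibleCloseds X)
      (fun p => ⟨_, hirred (OrderDual.ofDual p).asIdeal (OrderDual.ofDual p).2, hclosed _⟩) ?_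
    intro p q hpq
    have hpq' : OrderDual.ofDual q < OrderDual.ofDual p := hpq
    rw [lt_iff_le_not_ge] at hpq' ⊢
    refine ⟨fun x hx f hf => hx f (hpq'.1 hf), fun hge => hpq'.2 fun f hf => ?_⟩
    by_contra hfq
    obtain ⟨⟨_, x, rfl⟩, hx, hx'⟩ := CR_nullstellensatz hc _ (OrderDual.ofDual q).2 hfq
    exact hx' (hge hx f hf)

theorem zDimC_eq {S : Set M} (hS : zcl S ⊆ S) {d : ℕ} (hd : PureDim S d) {C : Set S} (hC : C ∈ zIrr S) :
    zDimC C = d := by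
  have hC' := zIrr_iff.1 hC
  have hr : Set.range (fun c : C => c.1.1) = Subtype.val '' C := by
    ext x
    constructor
    · rintro ⟨c, rfl⟩; exact ⟨c.1, c.2, rfl⟩
    · rintro ⟨c, hc, rfl⟩; exact ⟨⟨c, hc⟩, rfl⟩
  refine topologicalKrullDim_eq (τ := TopologicalSpace.induced Subtype.val (subTop S))
    (j := fun c : C => c.1.1) ?_ ?_ ?_ ?_
  · exact induced_compose
  · rw [hr]; exact comps_irr hC'
  · rw [hr]
    exact fun z hz => comps_closed hC' ▸ ⟨hS (zcl_mono (comps_subset hC') hz), hz⟩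
  · rw [hr]; exact hd _ hC'

end Krull

section BundleComponents

variable {M N F : Type} [AddCommGroup M] [Module ℂ M] [AddCommGroup N] [Module ℂ N]
  [AddCommGroup F] [Module ℂ F] [FiniteDimensional ℂ M] [FiniteDimensional ℂ N]
  [FiniteDimensional ℂ F]

omit [FiniteDimensional ℂ M] in
theorem zd_bundle {C : Set M} (hC : Irr C) {A : M → N →ₗ[ℂ] F} (hA : RegMap C A)
    (hs : ∀ z ∈ C, Function.Surjective (A z)) :
    zd (bundle C A) + Module.finrank ℂ F = zd C + Module.finrank ℂ N := by
  obtain ⟨z0, hz0⟩ := hC.1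
  obtain ⟨U, hU, hzU, R, g, hg, hR, hAR⟩ := exists_local_rightInverse hA hz0 (hs _ hz0)
  have hAU := hA.mono hU.1
  have hUb : RelOpen (bundle C A) (bundle U A) := by
    have := RelOpen.preimage (S := bundle C A) (f := fun e : M × N => e.1) (regMap_linear _
      (LinearMap.fst ℂ M N)) (S' := C) (fun e he => he.1) hU
    convert this using 1
    ext e
    exact ⟨fun h => ⟨⟨hU.1 h.1, h.2⟩, h.1⟩, fun h => ⟨h.2, h.1.2⟩⟩
  let e : RIso (bundle U A) (U ×ˢ (LinearMap.ker (A z0) : Set N)) :=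
    { f := fun e => (e.1, e.2 - R (A z0 e.2))
      g := fun e => (e.1, e.2 - R (g e.1 (A e.1 e.2)))
      rf := regMap_linear _ ((LinearMap.fst ℂ M N).prod (LinearMap.snd ℂ M N -
        R ∘ₗ A z0 ∘ₗ LinearMap.snd ℂ M N))
      rg := by
        have h1 : RegMap (U ×ˢ (LinearMap.ker (A z0) : Set N)) (fun e : M × N => e.1) :=
          regMap_linear _ (LinearMap.fst ℂ M N)
        have h2 : RegMap (U ×ˢ (LinearMap.ker (A z0) : Set N)) (fun e : M × N => e.2) :=
          regMap_linear _ (LinearMap.snd ℂ M N)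
        have h3 := h1.comp (fun e he => he.1) hg
        have h4 := h1.comp (fun e he => he.1) hAU
        exact h1.prodMk (h2.sub ((h3.lapply (h4.lapply h2)).linear R))
      mf := fun e he => ⟨he.1, by
        have := LinearMap.congr_fun hR (A z0 e.2)
        simpa [sub_eq_zero] using this.symm⟩
      mg := fun e he => ⟨he.1, by
        change A e.1 (e.2 - R (g e.1 (A e.1 e.2))) = 0
        rw [map_sub, (hAR e.1 he.1).2, sub_self]⟩
      gf := fun e he => by
        refine Prod.ext rfl ?_
        change e.2 - R (A z0 e.2) - R (g e.1 (A e.1 (e.2 - R (A z0 e.2)))) = e.2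
        rw [map_sub, he.2, zero_sub, map_neg, (hAR e.1 he.1).1, map_neg]
        abel
      fg := fun e he => by
        have hk : A z0 e.2 = 0 := he.2
        refine Prod.ext rfl ?_
        change e.2 - R (g e.1 (A e.1 e.2)) - R (A z0 (e.2 - R (g e.1 (A e.1 e.2)))) = e.2
        have := LinearMap.congr_fun hR (g e.1 (A e.1 e.2))
        simp only [LinearMap.comp_apply, LinearMap.id_apply] at this
        rw [map_sub, hk, this, zero_sub, map_neg]
        abel }
  have hUI := hC.relOpen hU ⟨_, hzU⟩
  have hbU := hUI.bundle hAU fun z hz => hs z (hU.1 hz)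
  have hbC := hC.bundle hA hs
  rw [← hbC.zd_relOpen hUb hbU.1, ← e.zd_eq hbU, hUI.zd_prod (irr_submodule _),
    hC.zd_relOpen hU ⟨_, hzU⟩, zd_submodule, add_assoc]
  congr 1
  have := (A z0).finrank_range_add_finrank_ker
  rw [LinearMap.range_eq_top.2 (hs z0 hz0), finrank_top, add_comm] at this
  exact_mod_cast this

omit [FiniteDimensional ℂ M] in
theorem comps_bundle {B : Set M} {A : M → N →ₗ[ℂ] F} (hA : RegMap B A)
    (hs : ∀ z ∈ B, Function.Surjective (A z)) :
    comps (bundle B A) = (fun C => bundle C A) '' comps B := by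
  have hI : ∀ C ∈ comps B, Irr (bundle C A) := fun C hC =>
    (comps_irr hC).bundle (hA.mono (comps_subset hC)) fun z hz => hs z (comps_subset hC hz)
  have hm : ∀ C ∈ comps B, bundle C A ⊆ bundle B A := fun C hC e he => ⟨comps_subset hC he.1, he.2⟩
  have h1 : ∀ K, Irr K → K ⊆ bundle B A → ∃ C ∈ comps B, K ⊆ bundle C A := by
    intro K hK hKB
    obtain ⟨C, hC, hKC⟩ := (hK.image (regMap_linear K (LinearMap.fst ℂ M N))).exists_comps (S := B)
      (by rintro _ ⟨z, hz, rfl⟩; exact (hKB hz).1)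
    exact ⟨C, hC, fun e he => ⟨hKC ⟨e, he, rfl⟩, (hKB he).2⟩⟩
  ext K
  constructor
  · intro hK
    obtain ⟨C, hC, hKC⟩ := h1 K (comps_irr hK) (comps_subset hK)
    exact ⟨C, hC, comps_eq hK (hI C hC) (hm C hC) hKC⟩
  · rintro ⟨C, hC, rfl⟩
    refine ⟨⟨hm C hC, hI C hC⟩, fun D ⟨hD, hD'⟩ hCD => ?_⟩
    obtain ⟨C', hC', hD2⟩ := h1 D hD' hD
    have : C ⊆ C' := fun z hz => (hD2 (hCD (show (z, 0) ∈ bundle C A from ⟨hz, map_zero _⟩))).1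
    rw [comps_eq hC (comps_irr hC') (comps_subset hC') this] at hD2
    exact hD2

theorem ncard_comps_bundle {B : Set M} {A : M → N →ₗ[ℂ] F} (hA : RegMap B A)
    (hs : ∀ z ∈ B, Function.Surjective (A z)) :
    (comps (bundle B A)).ncard = (comps B).ncard := by
  rw [comps_bundle hA hs]
  refine Set.ncard_image_of_injective _ fun C D h => ?_
  ext z
  have := Set.ext_iff.1 h (z, 0)
  simpa [bundle] using this

theorem PureDim.bundle {B : Set M} {A : M → N →ₗ[ℂ] F} (hA : RegMap B A)
    (hs : ∀ z ∈ B, Function.Surjective (A z)) {d d' : ℕ} (hd : PureDim B d)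
    (hd' : d' + Module.finrank ℂ F = d + Module.finrank ℂ N) : PureDim (bundle B A) d' := by
  intro K hK
  rw [comps_bundle hA hs] at hK
  obtain ⟨C, hC, rfl⟩ := hK
  have := zd_bundle (comps_irr hC) (hA.mono (comps_subset hC)) fun z hz => hs z (comps_subset hC hz)
  rw [hd C hC] at this
  have h2 : zd (_root_.bundle C A) + Module.finrank ℂ F = (d' : Cardinal) + Module.finrank ℂ F := by
    rw [this]; exact_mod_cast hd'.symm
  exact Cardinal.eq_of_add_eq_add_right h2 Cardinal.natCast_lt_aleph0

end BundleComponents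

section Stratification

variable {M : Type} [AddCommGroup M] [Module ℂ M] [FiniteDimensional ℂ M]

omit [FiniteDimensional ℂ M] in
theorem pureDim_of_cover {ι : Type} {S : Set M} (T : Finset ι) {f : ι → Set M} {d : ℕ}
    (hcov : S = ⋃ k ∈ T, f k) (hf : ∀ k ∈ T, PureDim (f k) d) : PureDim S d := by
  intro C hC
  have hsub : ∀ k ∈ T, f k ⊆ S := fun k hk => hcov ▸ Set.subset_biUnion_of_mem (u := f) hk
  obtain ⟨_, ⟨k, hk, rfl⟩, hCk⟩ := (comps_irr hC).subset_zcl_of_cover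
    (𝒞 := f '' (T : Set ι)) (T.finite_toSet.image f) (by
      intro z hz
      have := comps_subset hC hz
      rw [hcov, Set.mem_iUnion₂] at this
      obtain ⟨k, hk, hz⟩ := this
      exact ⟨_, ⟨k, hk, rfl⟩, hz⟩)
  have hI := (comps_irr hC).dense_irr Set.inter_subset_left hCk
  obtain ⟨D, hD, hCD⟩ := hI.exists_comps Set.inter_subset_right
  rw [← hf k hk D hD]
  have h1 : S ∩ zcl D = C := by
    refine comps_eq hC ((comps_irr hD).closure_inter ((comps_subset hD).trans (hsub k hk)))
      Set.inter_subset_left fun z hz => ⟨comps_subset hC hz, zcl_mono hCD (hCk hz)⟩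
  have hDC : D ⊆ C := fun z hz => h1 ▸ ⟨hsub k hk (comps_subset hD hz), subset_zcl _ hz⟩
  exact zd_of_dense hDC (h1 ▸ Set.inter_subset_right)

theorem ncard_comps_strata {ι : Type} [PartialOrder ι] {S : Set M} (T : Finset ι) {c : M → ι}
    (hcT : ∀ z ∈ S, c z ∈ T) (hopen : ∀ m ∈ T, RelOpen S {z | z ∈ S ∧ c z ≤ m}) {d : ℕ}
    (hd : ∀ k ∈ T, PureDim {z | z ∈ S ∧ c z = k} d) :
    (comps S).ncard = ∑ k ∈ T, (comps {z | z ∈ S ∧ c z = k}).ncard := by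
  set f : ι → Set M := fun k => {z | z ∈ S ∧ c z = k} with hfdef
  have hsub : ∀ k, f k ⊆ S := fun k z hz => hz.1
  have hcov : S = ⋃ k ∈ T, f k := by
    ext z
    simp only [Set.mem_iUnion, exists_prop]
    exact ⟨fun hz => ⟨c z, hcT z hz, hz, rfl⟩, fun ⟨k, _, hz⟩ => hz.1⟩
  have hS := pureDim_of_cover T hcov hd
  have hcomp : ∀ k ∈ T, ∀ D ∈ comps (f k), S ∩ zcl D ∈ comps S := by
    intro k hk D hD
    have hDS := (comps_subset hD).trans (hsub k)
    have hI := (comps_irr hD).closure_inter hDS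
    refine ⟨⟨Set.inter_subset_left, hI⟩, fun K ⟨hKS, hK⟩ hDK => ?_⟩
    obtain ⟨C, hC, hKC⟩ := hK.exists_comps hKS
    have hDC : D ⊆ C := fun z hz => hKC (hDK ⟨hDS hz, subset_zcl _ hz⟩)
    have := (comps_irr hD).subset_zcl_of_zd_le (comps_irr hC) hDC (by rw [hS C hC, hd k hk D hD])
    exact fun z hz => ⟨hKS hz, this (hKC hz)⟩
  have hle : ∀ k ∈ T, ∀ l ∈ T, ∀ D ∈ comps (f k), ∀ E ∈ comps (f l), S ∩ zcl D = S ∩ zcl E → l ≤ k := by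
    intro k hk l hl D hD E hE h
    obtain ⟨z, hz⟩ := (comps_irr hD).1
    have hzk := comps_subset hD hz
    have h2 : z ∈ S ∩ zcl E := by rw [← h]; exact ⟨hzk.1, subset_zcl _ hz⟩
    have hzE := h2.2
    obtain ⟨y, hy, hyE⟩ := (hopen k hk).meets ((comps_subset hE).trans (hsub l))
      (show z ∈ {z | z ∈ S ∧ c z ≤ k} from ⟨hzk.1, hzk.2.le⟩) hzE
    rw [← (comps_subset hE hyE).2]
    exact hy.2
  have hback : ∀ k, ∀ D ∈ comps (f k), f k ∩ (S ∩ zcl D) = D := by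
    intro k D hD
    conv_rhs => rw [← comps_closed hD]
    rw [← Set.inter_assoc, Set.inter_eq_left.2 (hsub k)]
  have hunion : comps S = ⋃ k ∈ T, (fun D => S ∩ zcl D) '' comps (f k) := by
    ext C
    simp only [Set.mem_iUnion, exists_prop]
    constructor
    · intro hC
      obtain ⟨_, ⟨k, hk, rfl⟩, hCk⟩ := (comps_irr hC).subset_zcl_of_cover
        (𝒞 := f '' (T : Set ι)) (T.finite_toSet.image f) (by
          intro z hz
          have := comps_subset hC hz
          exact ⟨_, ⟨c z, hcT z this, rfl⟩, this, rfl⟩)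
      have hI := (comps_irr hC).dense_irr Set.inter_subset_left hCk
      obtain ⟨D, hD, hCD⟩ := hI.exists_comps Set.inter_subset_right
      refine ⟨k, hk, D, hD, comps_eq hC ((comps_irr hD).closure_inter
        ((comps_subset hD).trans (hsub k))) Set.inter_subset_left fun z hz =>
          ⟨comps_subset hC hz, zcl_mono hCD (hCk hz)⟩⟩
    · rintro ⟨k, hk, D, hD, rfl⟩
      exact hcomp k hk D hD
  rw [hunion]
  have hcard : ∀ k, ((fun D => S ∩ zcl D) '' comps (f k)).ncard = (comps (f k)).ncard := by
    intro k
    refine Set.InjOn.ncard_image fun D hD E hE h => ?_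
    rw [← hback k D hD, ← hback k E hE]
    exact congrArg _ h
  rw [← Finset.sum_congr rfl fun k _ => hcard k]
  have hdis : ∀ k ∈ T, ∀ l ∈ T, k ≠ l → Disjoint ((fun D => S ∩ zcl D) '' comps (f k))
      ((fun D => S ∩ zcl D) '' comps (f l)) := by
    intro k hk l hl hkl
    rw [Set.disjoint_left]
    rintro _ ⟨D, hD, rfl⟩ ⟨E, hE, h⟩
    exact hkl (le_antisymm (hle l hl k hk E hE D hD h) (hle k hk l hl D hD E hE h.symm))
  have hfin : ∀ k, ((fun D => S ∩ zcl D) '' comps (f k)).Finite := fun k => (comps_finite _).image _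
  clear_value f
  clear hcov hS hcomp hle hback hunion hcard hd hopen hcT
  induction T using Finset.induction_on with
  | empty => simp
  | insert a T ha ih =>
    have hfT : (⋃ k ∈ T, (fun D => S ∩ zcl D) '' comps (f k)).Finite :=
      T.finite_toSet.biUnion fun k _ => hfin k
    rw [Finset.set_biUnion_insert, Finset.sum_insert ha, Set.ncard_union_eq ?_ (hfin a) hfT, ih]
    · exact fun k hk l hl => hdis k (Finset.mem_insert_of_mem hk) l (Finset.mem_insert_of_mem hl)
    · rw [Set.disjoint_iUnion₂_right]
      exact fun k hk => hdis a (Finset.mem_insert_self _ _) k (Finset.mem_insert_of_mem hk)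
        (fun h => ha (h ▸ hk))

end Stratification

section Words

variable {V : Type} [AddCommGroup V] [Module ℂ V]

/-- All long enough products of the endomorphisms `x h` vanish. -/
def Nilp {H : Type} (x : H → Module.End ℂ V) : Prop :=
  ∃ n : ℕ, ∀ l : List H, l.length = n → (l.map x).prod = 0

/-- The vectors killed by all words of length `k`. -/
def wordKer {H : Type} (x : H → Module.End ℂ V) (k : ℕ) : Submodule ℂ V :=
  ⨅ l : {l : List H // l.length = k}, LinearMap.ker (l.1.map x).prod

theorem mem_wordKer {H : Type} {x : H → Module.End ℂ V} {k : ℕ} {v : V} :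
    v ∈ wordKer x k ↔ ∀ l : List H, l.length = k → (l.map x).prod v = 0 := by
  simp [wordKer, Submodule.mem_iInf]

theorem mem_wordKer_succ {H : Type} {x : H → Module.End ℂ V} {k : ℕ} {v : V} :
    v ∈ wordKer x (k + 1) ↔ ∀ h, x h v ∈ wordKer x k := by
  simp only [mem_wordKer]
  constructor
  · intro hv h l hl
    have := hv (l ++ [h]) (by simp [hl])
    simpa using this
  · intro hv l hl
    obtain ⟨l', h, rfl⟩ := List.eq_nil_or_concat l |>.resolve_left (by rintro rfl; simp at hl)
    have := hv h l' (by simpa using hl)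
    simpa using this

theorem wordKer_le_succ {H : Type} (x : H → Module.End ℂ V) (k : ℕ) :
    wordKer x k ≤ wordKer x (k + 1) := by
  intro v hv
  rw [mem_wordKer] at hv ⊢
  intro l hl
  cases l with
  | nil => simp at hl
  | cons h l =>
    simp only [List.length_cons, Nat.add_right_cancel_iff] at hl
    simp [hv l hl]

theorem Nilp.word_eq_zero [FiniteDimensional ℂ V] {H : Type} {x : H → Module.End ℂ V}
    (hx : Nilp x) {l : List H} (hl : Module.finrank ℂ V ≤ l.length) : (l.map x).prod = 0 := by
  obtain ⟨n, hn⟩ := hx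
  have hmono : Monotone (wordKer x) := monotone_nat_of_le_succ (wordKer_le_succ x)
  have htop : wordKer x n = ⊤ := by
    rw [eq_top_iff]
    intro v _
    rw [mem_wordKer]
    intro l hl
    rw [hn l hl, LinearMap.zero_apply]
  have key : ∀ k, wordKer x k = ⊤ ∨ k ≤ Module.finrank ℂ (wordKer x k) := by
    intro k
    induction k with
    | zero => exact Or.inr (Nat.zero_le _)
    | succ k ih =>
      rcases ih with ih | ih
      · left
        rw [eq_top_iff, ← ih]
        exact wordKer_le_succ x k
      · by_cases h : wordKer x k = wordKer x (k + 1)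
        · left
          have hst : ∀ m, wordKer x (k + m) = wordKer x k := by
            intro m
            induction m with
            | zero => rfl
            | succ m ihm =>
              rw [h]
              ext v
              rw [← add_assoc, mem_wordKer_succ, mem_wordKer_succ, ihm]
          rw [← h, eq_top_iff, ← hst n, ← htop]
          exact hmono (Nat.le_add_left _ _)
        · right
          have := Submodule.finrank_lt_finrank_of_lt (lt_of_le_of_ne (wordKer_le_succ x k) h)
          omega
  have h2 : wordKer x l.length = ⊤ := by
    rcases key l.length with h | h
    · exact h
    · exact Submodule.eq_top_of_finrank_eq (le_antisymm (Submodule.finrank_le _) (hl.trans h))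
  ext v
  exact mem_wordKer.1 (h2 ▸ Submodule.mem_top : v ∈ wordKer x l.length) l rfl

end Words

section GradedCore

variable {I H : Type}

/-- `π` is the family of projections of an `I`-grading. -/
structure IsGrading [Fintype I] {V : Type} [AddCommGroup V] [Module ℂ V]
    (π : I → Module.End ℂ V) : Prop where
  idem : ∀ i v, π i (π i v) = π i v
  orth : ∀ i j, i ≠ j → ∀ v, π i (π j v) = 0
  total : ∀ v, ∑ i, π i v = v

variable {V D : Type} [AddCommGroup V] [Module ℂ V] [AddCommGroup D] [Module ℂ D]

/-- The largest `x`-invariant subspace killed by `q` and by the projections `π i`, `i ∉ J`. -/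
def coreJ (J : Set I) (π : I → Module.End ℂ V) (x : H → Module.End ℂ V) (q : V →ₗ[ℂ] D) :
    Submodule ℂ V :=
  ⨅ l : List H, (LinearMap.ker (q ∘ₗ (l.map x).prod) ⊓
    ⨅ i : (Jᶜ : Set I), LinearMap.ker (π i * (l.map x).prod))

variable {J : Set I} {π : I → Module.End ℂ V} {x : H → Module.End ℂ V} {q : V →ₗ[ℂ] D}

theorem mem_coreJ {v : V} : v ∈ coreJ J π x q ↔
    ∀ l : List H, q ((l.map x).prod v) = 0 ∧ ∀ i ∉ J, π i ((l.map x).prod v) = 0 := by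
  simp [coreJ, Submodule.mem_iInf]

theorem coreJ_inv {v : V} (hv : v ∈ coreJ J π x q) (h : H) : x h v ∈ coreJ J π x q := by
  rw [mem_coreJ] at hv ⊢
  intro l
  simpa using hv (l ++ [h])

theorem coreJ_apply {v : V} (hv : v ∈ coreJ J π x q) : q v = 0 := by
  simpa using (mem_coreJ.1 hv []).1

theorem coreJ_proj {v : V} (hv : v ∈ coreJ J π x q) {i : I} (hi : i ∉ J) : π i v = 0 := by
  simpa using (mem_coreJ.1 hv []).2 i hi

theorem word_mem {U : Submodule ℂ V} (hU : ∀ h, ∀ v ∈ U, x h v ∈ U) (l : List H) {v : V}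
    (hv : v ∈ U) : (l.map x).prod v ∈ U := by
  induction l with
  | nil => simpa using hv
  | cons h l ih => simpa using hU h _ ih

theorem le_coreJ {U : Submodule ℂ V} (hU : ∀ h, ∀ v ∈ U, x h v ∈ U)
    (hq : ∀ v ∈ U, q v = 0) (hπ : ∀ i ∉ J, ∀ v ∈ U, π i v = 0) : U ≤ coreJ J π x q := by
  intro v hv
  rw [mem_coreJ]
  exact fun l => ⟨hq _ (word_mem hU l hv), fun i hi => hπ i hi _ (word_mem hU l hv)⟩

variable (s t : H → I)

theorem gr_comm [Fintype I] (hπ : IsGrading π) (hx : ∀ h, π (t h) ∘ₗ x h ∘ₗ π (s h) = x h)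
    (h : H) (i : I) (v : V) : x h (π i v) = if i = s h then x h v else 0 := by
  have e : ∀ w, x h w = π (t h) (x h (π (s h) w)) := fun w => (LinearMap.congr_fun (hx h) w).symm
  split_ifs with hi
  · subst hi
    rw [e (π (s h) v), hπ.idem, ← e]
  · rw [e, hπ.orth _ _ (Ne.symm hi), map_zero, map_zero]

theorem gr_comm' [Fintype I] (hπ : IsGrading π) (hx : ∀ h, π (t h) ∘ₗ x h ∘ₗ π (s h) = x h)
    (h : H) (i : I) (v : V) : π i (x h v) = if i = t h then x h v else 0 := by
  have e : ∀ w, x h w = π (t h) (x h (π (s h) w)) := fun w => (LinearMap.congr_fun (hx h) w).symm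
  split_ifs with hi
  · subst hi
    conv_lhs => rw [e, hπ.idem, ← e]
  · rw [e, hπ.orth _ _ hi]

theorem coreJ_graded [Fintype I] (hπ : IsGrading π)
    (hx : ∀ h, π (t h) ∘ₗ x h ∘ₗ π (s h) = x h) {πD : I → Module.End ℂ D}
    (hq : ∀ i, πD i ∘ₗ q = q ∘ₗ π i) {v : V} (hv : v ∈ coreJ J π x q) (i : I) :
    π i v ∈ coreJ J π x q := by
  rw [mem_coreJ]
  intro l
  rcases List.eq_nil_or_concat l with rfl | ⟨l, h, rfl⟩
  · have h1 : q (π i v) = πD i (q v) := (LinearMap.congr_fun (hq i) v).symm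
    refine ⟨by simp [h1, coreJ_apply hv], fun j hj => ?_⟩
    by_cases hij : j = i
    · subst hij; simp [coreJ_proj hv hj]
    · simp [hπ.orth j i hij]
  · have := mem_coreJ.1 hv (l ++ [h])
    simp only [List.concat_eq_append, List.map_append, List.map_cons, List.map_nil, List.prod_append,
      List.prod_singleton, Module.End.mul_apply] at this ⊢
    rw [gr_comm s t hπ hx]
    split_ifs
    · exact this
    · simp

end GradedCore

section Transport

/-- Triples `(x, p, q)` with `p` supported on `D1` and `q` split into its two components. -/
abbrev Quad (H V D2 D1 : Type) [AddCommGroup V] [Module ℂ V] [AddCommGroup D2] [Module ℂ D2]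
    [AddCommGroup D1] [Module ℂ D1] : Type :=
  (H → Module.End ℂ V) × (D1 →ₗ[ℂ] V) × (V →ₗ[ℂ] D2) × (V →ₗ[ℂ] D1)

variable {I H : Type} [Fintype H] (s t : H → I) (bar : H → H) (eps : H → ℤ)
  {V V' D2 D1 : Type} [AddCommGroup V] [Module ℂ V] [AddCommGroup V'] [Module ℂ V']
  [AddCommGroup D2] [Module ℂ D2] [AddCommGroup D1] [Module ℂ D1]

/-- The tensor product variety of an arbitrary graded space, with the core restricted to the
vertices in `J`. -/
def PiJ (J : Set I) (π : I → Module.End ℂ V) (δ2 : I → Module.End ℂ D2)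
    (δ1 : I → Module.End ℂ D1) : Set (Quad H V D2 D1) :=
  {X | (∀ h, π (t h) ∘ₗ X.1 h ∘ₗ π (s h) = X.1 h) ∧
    (∀ i, π i ∘ₗ X.2.1 = X.2.1 ∘ₗ δ1 i) ∧
    (∀ i, δ2 i ∘ₗ X.2.2.1 = X.2.2.1 ∘ₗ π i) ∧
    (∀ i, δ1 i ∘ₗ X.2.2.2 = X.2.2.2 ∘ₗ π i) ∧
    (∑ h : H, eps h • (X.1 h * X.1 (bar h))) = X.2.1 ∘ₗ X.2.2.2 ∧
    Nilp X.1 ∧ ∀ d, X.2.1 d ∈ coreJ J π X.1 X.2.2.2}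

/-- Transport of structure along a linear equivalence. -/
def trQ (θ : V ≃ₗ[ℂ] V') (X : Quad H V D2 D1) : Quad H V' D2 D1 :=
  (fun h => θ.toLinearMap ∘ₗ X.1 h ∘ₗ θ.symm.toLinearMap, θ.toLinearMap ∘ₗ X.2.1,
    X.2.2.1 ∘ₗ θ.symm.toLinearMap, X.2.2.2 ∘ₗ θ.symm.toLinearMap)

omit [Fintype H] in
theorem word_tr (θ : V ≃ₗ[ℂ] V') (x : H → Module.End ℂ V) (l : List H) :
    (l.map fun h => (θ.toLinearMap ∘ₗ x h ∘ₗ θ.symm.toLinearMap : Module.End ℂ V')).prod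
      = θ.toLinearMap ∘ₗ (l.map x).prod ∘ₗ θ.symm.toLinearMap := by
  induction l with
  | nil => ext v; simp
  | cons h l ih =>
    ext v
    simp [ih]

omit [Fintype H] in
theorem trQ_symm_trQ (θ : V ≃ₗ[ℂ] V') (X : Quad H V D2 D1) : trQ θ.symm (trQ θ X) = X := by
  refine Prod.ext (funext fun h => ?_) (Prod.ext ?_ (Prod.ext ?_ ?_)) <;> ext v <;> simp [trQ]

variable {J : Set I} {π : I → Module.End ℂ V} {π' : I → Module.End ℂ V'}
  {δ2 : I → Module.End ℂ D2} {δ1 : I → Module.End ℂ D1}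

omit [Fintype H] in
theorem mem_coreJ_trQ {θ : V ≃ₗ[ℂ] V'} (hθ : ∀ i v, θ (π i v) = π' i (θ v)) {X : Quad H V D2 D1}
    {v : V} : θ v ∈ coreJ J π' (trQ θ X).1 (trQ θ X).2.2.2 ↔ v ∈ coreJ J π X.1 X.2.2.2 := by
  rw [mem_coreJ, mem_coreJ]
  refine forall_congr' fun l => ?_
  simp only [trQ]
  rw [word_tr]
  simp [← hθ]

theorem trQ_mem {θ : V ≃ₗ[ℂ] V'} (hθ : ∀ i v, θ (π i v) = π' i (θ v)) {X : Quad H V D2 D1}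
    (hX : X ∈ PiJ s t bar eps J π δ2 δ1) : trQ θ X ∈ PiJ s t bar eps J π' δ2 δ1 := by
  have hθ' : ∀ i v, θ.symm (π' i v) = π i (θ.symm v) := fun i v => by
    rw [LinearEquiv.symm_apply_eq, hθ, LinearEquiv.apply_symm_apply]
  obtain ⟨h1, h2, h3, h4, h5, ⟨n, h6⟩, h7⟩ := hX
  refine ⟨fun h => ?_, fun i => ?_, fun i => ?_, fun i => ?_, ?_, ⟨n, fun l hl => ?_⟩, fun d => ?_⟩
  · ext v
    have := LinearMap.congr_fun (h1 h) (θ.symm v)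
    simp only [LinearMap.comp_apply] at this
    simp [trQ, hθ', ← hθ, this]
  · ext v
    have := LinearMap.congr_fun (h2 i) v
    simp only [LinearMap.comp_apply] at this
    simp [trQ, ← hθ, this]
  · ext v
    have := LinearMap.congr_fun (h3 i) (θ.symm v)
    simp only [LinearMap.comp_apply] at this
    simp [trQ, hθ', this]
  · ext v
    have := LinearMap.congr_fun (h4 i) (θ.symm v)
    simp only [LinearMap.comp_apply] at this
    simp [trQ, hθ', this]
  · ext v
    have := LinearMap.congr_fun h5 (θ.symm v)
    simp only [LinearMap.comp_apply, LinearMap.sum_apply, LinearMap.smul_apply,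
      Module.End.mul_apply] at this
    simp [trQ, ← this]
  · simp only [trQ]
    rw [word_tr, h6 l hl]
    simp
  · have := (mem_coreJ_trQ (J := J) hθ).2 (h7 d)
    simpa [trQ] using this

end Transport

section BlockForm

variable {I H : Type} [Fintype I] [Fintype H] (s t : H → I) (bar : H → H) (eps : H → ℤ)
  {V2 V1 D2 D1 : Type} [AddCommGroup V2] [Module ℂ V2] [AddCommGroup V1] [Module ℂ V1]
  [AddCommGroup D2] [Module ℂ D2] [AddCommGroup D1] [Module ℂ D1]

theorem IsGrading.prodMap {π2 : I → Module.End ℂ V2} {π1 : I → Module.End ℂ V1}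
    (h2 : IsGrading π2) (h1 : IsGrading π1) : IsGrading fun i => (π2 i).prodMap (π1 i) where
  idem i v := by simp [h2.idem, h1.idem]
  orth i j hij v := by simp [h2.orth i j hij, h1.orth i j hij]
  total v := by
    refine Prod.ext ?_ ?_
    · rw [Prod.fst_sum]; simpa using h2.total v.1
    · rw [Prod.snd_sum]; simpa using h1.total v.2

/-- Upper triangular endomorphisms of `V2 × V1`. -/
def upper (a : Module.End ℂ V2) (b : V1 →ₗ[ℂ] V2) (c : Module.End ℂ V1) :
    Module.End ℂ (V2 × V1) :=
  ((a ∘ₗ LinearMap.fst ℂ V2 V1) + (b ∘ₗ LinearMap.snd ℂ V2 V1)).prod (c ∘ₗ LinearMap.snd ℂ V2 V1)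

@[simp] theorem upper_apply (a : Module.End ℂ V2) (b : V1 →ₗ[ℂ] V2) (c : Module.End ℂ V1)
    (v : V2 × V1) : upper a b c v = (a v.1 + b v.2, c v.2) := rfl

variable {x2 : H → Module.End ℂ V2} {y : H → V1 →ₗ[ℂ] V2} {x1 : H → Module.End ℂ V1}

omit [Fintype H] in
theorem word_upper_snd (l : List H) (v : V2 × V1) :
    ((l.map fun h => upper (x2 h) (y h) (x1 h)).prod v).2 = (l.map x1).prod v.2 := by
  induction l with
  | nil => simp
  | cons h l ih => simp [ih]

omit [Fintype H] in
theorem word_upper_inl (l : List H) (v : V2) :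
    (l.map fun h => upper (x2 h) (y h) (x1 h)).prod (v, 0) = ((l.map x2).prod v, 0) := by
  induction l with
  | nil => simp
  | cons h l ih => simp [ih]

omit [Fintype H] in
theorem nilp_upper : Nilp (fun h => upper (x2 h) (y h) (x1 h)) ↔ Nilp x2 ∧ Nilp x1 := by
  constructor
  · rintro ⟨n, hn⟩
    refine ⟨⟨n, fun l hl => ?_⟩, ⟨n, fun l hl => ?_⟩⟩
    · ext v
      have := word_upper_inl (x2 := x2) (y := y) (x1 := x1) l v
      rw [hn l hl] at this
      simpa using (congrArg Prod.fst this).symm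
    · ext v
      have := word_upper_snd (x2 := x2) (y := y) (x1 := x1) l (0, v)
      rw [hn l hl] at this
      simpa using this.symm
  · rintro ⟨⟨n, hn⟩, ⟨m, hm⟩⟩
    refine ⟨n + m, fun l hl => ?_⟩
    rw [← List.take_append_drop n l, List.map_append, List.prod_append]
    refine LinearMap.ext fun v => ?_
    have h1 : (((l.drop n).map fun h => upper (x2 h) (y h) (x1 h)).prod v).2 = 0 := by
      rw [word_upper_snd, hm _ (by simp [hl])]; rfl
    obtain ⟨w, hw⟩ : ∃ w, (((l.drop n).map fun h => upper (x2 h) (y h) (x1 h)).prod v) = (w, 0) :=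
      ⟨_, Prod.ext rfl h1⟩
    rw [Module.End.mul_apply, hw, word_upper_inl, hn _ (by simp [hl])]
    rfl

omit [Fintype I] [Fintype H] in
theorem mem_coreJ_upper {J : Set I} {π2 : I → Module.End ℂ V2} {π1 : I → Module.End ℂ V1}
    (hJ : ∀ i ∉ J, π2 i = 0) {q : V1 →ₗ[ℂ] D1} {v : V2 × V1} :
    v ∈ coreJ J (fun i => (π2 i).prodMap (π1 i)) (fun h => upper (x2 h) (y h) (x1 h))
      (q ∘ₗ LinearMap.snd ℂ V2 V1) ↔ v.2 ∈ coreJ J π1 x1 q := by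
  rw [mem_coreJ, mem_coreJ]
  refine forall_congr' fun l => ?_
  rw [← word_upper_snd (x2 := x2) (y := y) (x1 := x1) l v]
  refine and_congr Iff.rfl (forall_congr' fun i => forall_congr' fun hi => ?_)
  simp [hJ i hi, Prod.ext_iff]

end BlockForm

section Blocks

variable {I H : Type} [Fintype I] [DecidableEq I] {ν μ κ : I → ℕ}

theorem isGrading_pr (ν : I → ℕ) : IsGrading (pr ν) where
  idem i v := by simp [pr]
  orth i j hij v := by simp [pr, hij]
  total v := by
    simp only [pr, LinearMap.comp_apply, LinearMap.proj_apply, LinearMap.single_apply]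
    exact Finset.univ_sum_single v

omit [Fintype I] in
theorem pr_apply_self (ν : I → ℕ) (i : I) (v : Vec ν) : pr ν i v i = v i := by simp [pr]

omit [Fintype I] in
theorem pr_apply_ne (ν : I → ℕ) {i j : I} (h : j ≠ i) (v : Vec ν) : pr ν i v j = 0 := by
  simp [pr, h]

/-- Graded homomorphisms as families of maps between the graded pieces. -/
abbrev HomG (ν μ : I → ℕ) : Type := (i : I) → (Fin (ν i) → ℂ) →ₗ[ℂ] (Fin (μ i) → ℂ)

/-- The inclusion of homomorphisms between graded pieces. -/
def blk (ν μ : I → ℕ) (a b : I) : ((Fin (ν a) → ℂ) →ₗ[ℂ] (Fin (μ b) → ℂ)) →ₗ[ℂ] (Vec ν →ₗ[ℂ] Vec μ) where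
  toFun f := LinearMap.single ℂ (fun j => Fin (μ j) → ℂ) b ∘ₗ f ∘ₗ LinearMap.proj a
  map_add' f g := by ext; simp [Pi.single_add]
  map_smul' c f := by ext; simp [Pi.single_smul]

/-- The projection to a block. -/
def unblk (ν μ : I → ℕ) (a b : I) : (Vec ν →ₗ[ℂ] Vec μ) →ₗ[ℂ] ((Fin (ν a) → ℂ) →ₗ[ℂ] (Fin (μ b) → ℂ)) where
  toFun f := LinearMap.proj b ∘ₗ f ∘ₗ LinearMap.single ℂ (fun j => Fin (ν j) → ℂ) a
  map_add' f g := by ext; simp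
  map_smul' c f := by ext; simp

theorem unblk_blk (a b : I) (f : (Fin (ν a) → ℂ) →ₗ[ℂ] (Fin (μ b) → ℂ)) :
    unblk ν μ a b (blk ν μ a b f) = f := by
  ext v; simp [unblk, blk]

theorem blk_unblk (a b : I) (f : Vec ν →ₗ[ℂ] Vec μ) :
    blk ν μ a b (unblk ν μ a b f) = pr μ b ∘ₗ f ∘ₗ pr ν a := rfl

theorem pr_blk_pr (a b : I) (f : (Fin (ν a) → ℂ) →ₗ[ℂ] (Fin (μ b) → ℂ)) :
    pr μ b ∘ₗ blk ν μ a b f ∘ₗ pr ν a = blk ν μ a b f := by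
  rw [← blk_unblk, unblk_blk]

/-- The graded homomorphism assembled from its pieces. -/
def asmG (ν μ : I → ℕ) : HomG ν μ →ₗ[ℂ] (Vec ν →ₗ[ℂ] Vec μ) where
  toFun f := LinearMap.pi fun i => f i ∘ₗ LinearMap.proj i
  map_add' f g := by ext; simp
  map_smul' c f := by ext; simp

/-- The diagonal blocks of a homomorphism. -/
def disG (ν μ : I → ℕ) : (Vec ν →ₗ[ℂ] Vec μ) →ₗ[ℂ] HomG ν μ :=
  LinearMap.pi fun i => unblk ν μ i i

theorem asmG_apply (f : HomG ν μ) (v : Vec ν) (i : I) : asmG ν μ f v i = f i (v i) := rfl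

omit [Fintype I] in
theorem disG_apply (f : Vec ν →ₗ[ℂ] Vec μ) (i : I) (v : Fin (ν i) → ℂ) :
    disG ν μ f i v = f (Pi.single i v) i := rfl

theorem disG_asmG (f : HomG ν μ) : disG ν μ (asmG ν μ f) = f := by
  funext i
  refine LinearMap.ext fun v => ?_
  rw [disG_apply, asmG_apply, Pi.single_eq_same]

theorem gradedHom_asmG (f : HomG ν μ) : gradedHom ν μ (asmG ν μ f) := by
  intro i
  refine LinearMap.ext fun v => funext fun j => ?_
  simp only [LinearMap.comp_apply]
  rw [asmG_apply]
  by_cases h : j = i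
  · subst h; rw [pr_apply_self, pr_apply_self, asmG_apply]
  · rw [pr_apply_ne _ h, pr_apply_ne _ h, map_zero]

theorem gradedHom_apply {f : Vec ν →ₗ[ℂ] Vec μ} (hf : gradedHom ν μ f) (v : Vec ν) (i : I) :
    f (Pi.single i (v i)) i = f v i := by
  have := congrFun (LinearMap.congr_fun (hf i) v) i
  simp only [LinearMap.comp_apply] at this
  rw [pr_apply_self] at this
  exact this.symm

theorem asmG_disG {f : Vec ν →ₗ[ℂ] Vec μ} (hf : gradedHom ν μ f) : asmG ν μ (disG ν μ f) = f := by
  refine LinearMap.ext fun v => funext fun i => ?_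
  rw [asmG_apply, disG_apply, gradedHom_apply hf]

theorem disG_congr {f g : Vec ν →ₗ[ℂ] Vec μ} (h : ∀ i v, pr μ i (f (pr ν i v)) = pr μ i (g (pr ν i v))) :
    disG ν μ f = disG ν μ g := by
  funext i
  refine LinearMap.ext fun v => ?_
  have h1 : pr ν i (Pi.single i v) = Pi.single i v := by simp [pr]
  have := congrFun (h i (Pi.single i v)) i
  rwa [h1, pr_apply_self, pr_apply_self] at this

end Blocks

section BlockBundle

variable {I H : Type} [Fintype I] [DecidableEq I] [Fintype H] (s t : H → I) (bar : H → H) (eps : H → ℤ)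

/-- The locus of `L_{V,D}` where the core supported on `J` is trivial. -/
def LJs (J : Set I) (ν μ : I → ℕ) : Set ((H → Module.End ℂ (Vec ν)) × (Vec ν →ₗ[ℂ] Vec μ)) :=
  {X | X ∈ LSet s t bar eps ν μ ∧ coreJ J (pr ν) X.1 X.2 = ⊥}

/-- Off-diagonal data: extension classes `y`, the map `p` and the off-diagonal part of `q`. -/
abbrev OffDiag (μ2 μ1 ν2 ν1 : I → ℕ) : Type :=
  ((h : H) → (Fin (ν1 (s h)) → ℂ) →ₗ[ℂ] (Fin (ν2 (t h)) → ℂ)) × HomG μ1 ν2 × HomG ν1 μ2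

/-- The linear equation cutting out the off-diagonal data. -/
def offEq (μ2 μ1 ν2 ν1 : I → ℕ)
    (z : ((H → Module.End ℂ (Vec ν1)) × (Vec ν1 →ₗ[ℂ] Vec μ1)) ×
      ((H → Module.End ℂ (Vec ν2)) × (Vec ν2 →ₗ[ℂ] Vec μ2))) :
    OffDiag s t μ2 μ1 ν2 ν1 →ₗ[ℂ] HomG ν1 ν2 :=
  disG ν1 ν2 ∘ₗ
    ((∑ h, eps h • (((LinearMap.llcomp ℂ (Vec ν1) (Vec ν1) (Vec ν2)).flip (z.1.1 (bar h)) -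
      LinearMap.llcomp ℂ (Vec ν1) (Vec ν2) (Vec ν2) (z.2.1 (bar h))) ∘ₗ
        blk ν1 ν2 (s h) (t h) ∘ₗ LinearMap.proj h)) ∘ₗ LinearMap.fst ℂ _ _ -
    (LinearMap.llcomp ℂ (Vec ν1) (Vec μ1) (Vec ν2)).flip z.1.2 ∘ₗ asmG μ1 ν2 ∘ₗ
      LinearMap.fst ℂ _ _ ∘ₗ LinearMap.snd ℂ _ _)

variable {μ2 μ1 ν2 ν1 : I → ℕ}

theorem offEq_apply (z) (n : OffDiag s t μ2 μ1 ν2 ν1) :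
    offEq s t bar eps μ2 μ1 ν2 ν1 z n = disG ν1 ν2 (∑ h, eps h •
      (blk ν1 ν2 (s h) (t h) (n.1 h) ∘ₗ z.1.1 (bar h) - z.2.1 (bar h) ∘ₗ blk ν1 ν2 (s h) (t h) (n.1 h))
        - asmG μ1 ν2 n.2.1 ∘ₗ z.1.2) := by
  simp [offEq]
  rfl

theorem regMap_offEq (B) : RegMap B (offEq s t bar eps μ2 μ1 ν2 ν1) := by
  refine RegMap.lcomp (regMap_const _ _) (RegMap.sub (RegMap.lcomp (RegMap.sum _ fun h _ =>
    RegMap.zsmul _ (RegMap.lcomp (RegMap.sub ?_ ?_) (regMap_const _ _))) (regMap_const _ _))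
      (RegMap.lcomp ?_ (regMap_const _ _)))
  · exact RegMap.linear (((regMap_id _).fst.fst).proj (bar h)) _
  · exact RegMap.linear (((regMap_id _).snd.fst).proj (bar h)) _
  · exact RegMap.linear ((regMap_id _).fst.snd) _

end BlockBundle

section OffEqSurjective

variable {I H : Type} [Fintype I] [DecidableEq I] [Fintype H] (s t : H → I) (bar : H → H) (eps : H → ℤ)
variable {J : Set I} {μ2 μ1 ν2 ν1 : I → ℕ}

theorem pr_of_eq_zero {ν : I → ℕ} {i : I} (h : ν i = 0) : pr ν i = 0 := by
  refine LinearMap.ext fun v => funext fun j => ?_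
  by_cases hj : j = i
  · subst hj
    funext k
    exact (Fin.cast h k).elim0
  · rw [pr_apply_ne _ hj]; rfl

theorem offEq_surjective (hsbar : ∀ h, s (bar h) = t h) (htbar : ∀ h, t (bar h) = s h)
    (hbb : ∀ h, bar (bar h) = h)
    (heps : ∀ h, eps h = 1 ∨ eps h = -1) (hJ : ∀ i ∉ J, ν2 i = 0) {z}
    (hz : z ∈ LJs s t bar eps J ν1 μ1 ×ˢ LSet s t bar eps ν2 μ2) :
    Function.Surjective (offEq s t bar eps μ2 μ1 ν2 ν1 z) := by
  obtain ⟨⟨⟨⟨hx1, -, -⟩, hq1⟩, hcore⟩, ⟨⟨hx2, -, -⟩, -⟩⟩ := hz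
  rw [← LinearMap.range_eq_top]
  by_contra hne
  obtain ⟨φ, hφ0, hφ⟩ := Submodule.exists_le_ker_of_lt_top _ (lt_top_iff_ne_top.2 hne)
  have hφz : ∀ n, φ (offEq s t bar eps μ2 μ1 ν2 ν1 z n) = 0 := fun n =>
    hφ (LinearMap.mem_range_self _ n)
  set Φ : (Vec ν1 →ₗ[ℂ] Vec ν2) →ₗ[ℂ] ℂ := φ ∘ₗ disG ν1 ν2 with hΦ
  have g1 := isGrading_pr ν1
  have g2 := isGrading_pr ν2
  -- vanishing on maps factoring through `q`
  have hp : ∀ p : Vec μ1 →ₗ[ℂ] Vec ν2, Φ (p ∘ₗ z.1.2) = 0 := by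
    intro p
    have h0 := hφz (0, disG μ1 ν2 p, 0)
    rw [offEq_apply] at h0
    simp only [Pi.zero_apply, map_zero, LinearMap.zero_comp, LinearMap.comp_zero, sub_zero, smul_zero,
      Finset.sum_const_zero, zero_sub, map_neg, neg_eq_zero] at h0
    rw [← h0, hΦ, LinearMap.comp_apply]
    congr 1
    funext i
    refine LinearMap.ext fun v => ?_
    rw [disG_apply, disG_apply, LinearMap.comp_apply, LinearMap.comp_apply, asmG_apply, disG_apply]
    have := LinearMap.congr_fun (hq1 i) (Pi.single i v)
    simp only [LinearMap.comp_apply] at this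
    rw [show pr ν1 i (Pi.single i v) = Pi.single i v by simp [pr]] at this
    rw [← this]
    simp [pr]
  have hy : ∀ h (y : Vec ν1 →ₗ[ℂ] Vec ν2), Φ (y ∘ₗ z.1.1 h) = Φ (z.2.1 h ∘ₗ y) := by
    intro h y
    have h0 := hφz (Pi.single (bar h) (unblk ν1 ν2 _ _ y), 0)
    rw [offEq_apply, Finset.sum_eq_single (bar h)] at h0
    · simp only [Pi.single_eq_same, blk_unblk, hsbar, htbar, hbb, Prod.fst_zero, map_zero,
        LinearMap.zero_comp, sub_zero] at h0
      rw [map_zsmul, map_zsmul, map_sub, map_sub] at h0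
      have h1 : disG ν1 ν2 ((pr ν2 (s h) ∘ₗ y ∘ₗ pr ν1 (t h)) ∘ₗ z.1.1 h) =
          disG ν1 ν2 (y ∘ₗ z.1.1 h) := by
        apply disG_congr
        intro i v
        simp only [LinearMap.comp_apply]
        rw [gr_comm s t g1 hx1]
        split_ifs with hi
        · subst hi
          rw [g2.idem, gr_comm' s t g1 hx1, if_pos rfl]
        · simp
      have h2 : disG ν1 ν2 (z.2.1 h ∘ₗ (pr ν2 (s h) ∘ₗ y ∘ₗ pr ν1 (t h))) =
          disG ν1 ν2 (z.2.1 h ∘ₗ y) := by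
        apply disG_congr
        intro i v
        simp only [LinearMap.comp_apply]
        rw [gr_comm' s t g2 hx2, gr_comm' s t g2 hx2]
        split_ifs with hi
        · subst hi
          rw [g1.idem, gr_comm s t g2 hx2, if_pos rfl]
        · simp
      rw [h1, h2] at h0
      have h3 : eps (bar h) ≠ 0 := by rcases heps (bar h) with h | h <;> simp [h]
      exact sub_eq_zero.1 ((smul_eq_zero.1 h0).resolve_left h3)
    · intro h' _ hh'
      dsimp only
      rw [Pi.single_eq_of_ne hh']
      simp
    · simp
  let P : Submodule ℂ (Module.Dual ℂ (Vec ν1)) :=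
    ⨅ v : Vec ν2, LinearMap.ker (Φ ∘ₗ (LinearMap.smulRightₗ (R := ℂ) (M₂ := Vec ν1)).flip v)
  have hP : ∀ α, α ∈ P ↔ ∀ v : Vec ν2, Φ (α.smulRight v) = 0 := fun α => by
    simp [P, Submodule.mem_iInf]
  have hU : P.dualCoannihilator ≤ coreJ J (pr ν1) z.1.1 z.1.2 := by
    refine le_coreJ (fun h v hv => ?_) (fun v hv => ?_) (fun i hi v hv => ?_)
    · rw [Submodule.mem_dualCoannihilator] at hv ⊢
      intro α hα
      refine hv (α ∘ₗ z.1.1 h) ((hP _).2 fun w => ?_)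
      have := hy h (α.smulRight w)
      have e1 : (α.smulRight w) ∘ₗ z.1.1 h = (α ∘ₗ z.1.1 h).smulRight w := by ext; simp
      have e2 : z.2.1 h ∘ₗ (α.smulRight w) = α.smulRight (z.2.1 h w) := by ext; simp
      rw [← e1, this, e2]
      exact (hP α).1 hα _
    · rw [Submodule.mem_dualCoannihilator] at hv
      rw [← Module.forall_dual_apply_eq_zero_iff ℂ]
      intro δ
      refine hv (δ ∘ₗ z.1.2) ((hP _).2 fun w => ?_)
      exact hp (δ.smulRight w)
    · rw [Submodule.mem_dualCoannihilator] at hv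
      rw [← Module.forall_dual_apply_eq_zero_iff ℂ]
      intro δ
      refine hv (δ ∘ₗ pr ν1 i) ((hP _).2 fun w => ?_)
      have : disG ν1 ν2 ((δ ∘ₗ pr ν1 i).smulRight w) = disG ν1 ν2 0 := by
        apply disG_congr
        intro j u
        by_cases hj : j = i
        · subst hj
          rw [pr_of_eq_zero (hJ j hi)]
          simp
        · simp [g1.orth i j (Ne.symm hj)]
      rw [hΦ, LinearMap.comp_apply, this, map_zero, map_zero]
  rw [hcore, le_bot_iff] at hU
  have hPt : P = ⊤ := by
    rw [← Subspace.dualCoannihilator_dualAnnihilator_eq (W := P), hU, Submodule.dualAnnihilator_bot]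
  have hΦ0 : Φ = 0 := by
    refine LinearMap.ext fun f => ?_
    have hf : f = ∑ k, ((Module.finBasis ℂ (Vec ν1)).coord k).smulRight
        (f (Module.finBasis ℂ (Vec ν1) k)) := by
      refine LinearMap.ext fun v => ?_
      conv_lhs => rw [← (Module.finBasis ℂ (Vec ν1)).sum_repr v, map_sum]
      rw [LinearMap.sum_apply]
      exact Finset.sum_congr rfl fun k _ => map_smul _ _ _
    rw [hf, map_sum, LinearMap.zero_apply]
    refine Finset.sum_eq_zero fun k _ => ?_
    exact (hP _).1 (hPt ▸ Submodule.mem_top) _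
  refine hφ0 (LinearMap.ext fun f => ?_)
  have := LinearMap.congr_fun hΦ0 (asmG ν1 ν2 f)
  rw [hΦ, LinearMap.comp_apply, disG_asmG] at this
  exact this

end OffEqSurjective

section AdaptedStratum

variable {I H : Type} [Fintype I] [DecidableEq I] [Fintype H] (s t : H → I) (bar : H → H) (eps : H → ℤ)

/-- The grading of `Vec ν2 × Vec ν1`. -/
def prProd (ν2 ν1 : I → ℕ) (i : I) : Module.End ℂ (Vec ν2 × Vec ν1) :=
  (pr ν2 i).prodMap (pr ν1 i)

/-- The quadruples whose core is exactly the first factor. -/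
def adapted (J : Set I) (μ2 μ1 ν2 ν1 : I → ℕ) :
    Set (Quad H (Vec ν2 × Vec ν1) (Vec μ2) (Vec μ1)) :=
  {X | X ∈ PiJ s t bar eps J (prProd ν2 ν1) (pr μ2) (pr μ1) ∧
    ∀ v, v ∈ coreJ J (prProd ν2 ν1) X.1 X.2.2.2 ↔ v.2 = 0}

/-- The coordinate space of the bundle. -/
abbrev OffTotal (μ2 μ1 ν2 ν1 : I → ℕ) : Type :=
  (((H → Module.End ℂ (Vec ν1)) × (Vec ν1 →ₗ[ℂ] Vec μ1)) ×
    ((H → Module.End ℂ (Vec ν2)) × (Vec ν2 →ₗ[ℂ] Vec μ2))) × OffDiag s t μ2 μ1 ν2 ν1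

variable {J : Set I} {μ2 μ1 ν2 ν1 : I → ℕ}

/-- Block coordinates of a quadruple. -/
def toOff (X : Quad H (Vec ν2 × Vec ν1) (Vec μ2) (Vec μ1)) : OffTotal s t μ2 μ1 ν2 ν1 :=
  (((fun h => LinearMap.snd ℂ _ _ ∘ₗ X.1 h ∘ₗ LinearMap.inr ℂ _ _, X.2.2.2 ∘ₗ LinearMap.inr ℂ _ _),
    (fun h => LinearMap.fst ℂ _ _ ∘ₗ X.1 h ∘ₗ LinearMap.inl ℂ _ _, X.2.2.1 ∘ₗ LinearMap.inl ℂ _ _)),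
    (fun h => unblk ν1 ν2 (s h) (t h) (LinearMap.fst ℂ _ _ ∘ₗ X.1 h ∘ₗ LinearMap.inr ℂ _ _),
      disG μ1 ν2 (LinearMap.fst ℂ _ _ ∘ₗ X.2.1), disG ν1 μ2 (X.2.2.1 ∘ₗ LinearMap.inr ℂ _ _)))

/-- The block upper triangular quadruple with given coordinates. -/
def ofOff (e : OffTotal s t μ2 μ1 ν2 ν1) : Quad H (Vec ν2 × Vec ν1) (Vec μ2) (Vec μ1) :=
  (fun h => upper (e.1.2.1 h) (blk ν1 ν2 (s h) (t h) (e.2.1 h)) (e.1.1.1 h),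
    LinearMap.inl ℂ _ _ ∘ₗ asmG μ1 ν2 e.2.2.1,
    (e.1.2.2 ∘ₗ LinearMap.fst ℂ _ _ + asmG ν1 μ2 e.2.2.2 ∘ₗ LinearMap.snd ℂ _ _,
      e.1.1.2 ∘ₗ LinearMap.snd ℂ _ _))

theorem regMap_toOff (Z) : RegMap Z (toOff s t (μ2 := μ2) (μ1 := μ1) (ν2 := ν2) (ν1 := ν1)) := by
  have h := regMap_id Z
  refine RegMap.prodMk (RegMap.prodMk (RegMap.prodMk (regMap_pi fun i => ?_) ?_)
    (RegMap.prodMk (regMap_pi fun i => ?_) ?_)) (RegMap.prodMk (regMap_pi fun i => ?_)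
      (RegMap.prodMk ?_ ?_))
  · exact (regMap_const _ _).lcomp ((h.fst.proj i).lcomp (regMap_const _ _))
  · exact h.snd.snd.snd.lcomp (regMap_const _ _)
  · exact (regMap_const _ _).lcomp ((h.fst.proj i).lcomp (regMap_const _ _))
  · exact h.snd.snd.fst.lcomp (regMap_const _ _)
  · exact ((regMap_const _ _).lcomp ((h.fst.proj i).lcomp (regMap_const _ _))).linear _
  · exact ((regMap_const _ _).lcomp h.snd.fst).linear _
  · exact (h.snd.snd.fst.lcomp (regMap_const _ _)).linear _

omit [Fintype I] [DecidableEq I] in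
theorem upper_eq (a : Module.End ℂ (Vec ν2)) (b : Vec ν1 →ₗ[ℂ] Vec ν2) (c : Module.End ℂ (Vec ν1)) :
    upper a b c = LinearMap.inl ℂ _ _ ∘ₗ a ∘ₗ LinearMap.fst ℂ _ _ +
      LinearMap.inl ℂ _ _ ∘ₗ b ∘ₗ LinearMap.snd ℂ _ _ +
        LinearMap.inr ℂ _ _ ∘ₗ c ∘ₗ LinearMap.snd ℂ _ _ := by
  refine LinearMap.ext fun v => ?_
  simp

theorem regMap_ofOff (Z) : RegMap Z (ofOff s t (μ2 := μ2) (μ1 := μ1) (ν2 := ν2) (ν1 := ν1)) := by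
  have h := regMap_id Z
  refine RegMap.prodMk (regMap_pi fun i => ?_) (RegMap.prodMk ?_ (RegMap.prodMk ?_ ?_))
  · simp only [upper_eq]
    exact (((regMap_const _ _).lcomp ((h.fst.snd.fst.proj i).lcomp (regMap_const _ _))).add
      ((regMap_const _ _).lcomp (((h.snd.fst.proj i).linear _).lcomp (regMap_const _ _)))).add
        ((regMap_const _ _).lcomp ((h.fst.fst.fst.proj i).lcomp (regMap_const _ _)))
  · exact (regMap_const _ _).lcomp (h.snd.snd.fst.linear _)
  · exact (h.fst.snd.snd.lcomp (regMap_const _ _)).add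
      ((h.snd.snd.snd.linear _).lcomp (regMap_const _ _))
  · exact h.fst.fst.snd.lcomp (regMap_const _ _)

omit [Fintype H] in
theorem toOff_ofOff (e : OffTotal s t μ2 μ1 ν2 ν1) : toOff s t (ofOff s t e) = e := by
  obtain ⟨⟨⟨x1, q1⟩, ⟨x2, q2⟩⟩, ⟨y, p, q'⟩⟩ := e
  have h1 : ∀ h, LinearMap.fst ℂ (Vec ν2) (Vec ν1) ∘ₗ upper (x2 h) (blk ν1 ν2 (s h) (t h) (y h)) (x1 h) ∘ₗ
      LinearMap.inr ℂ _ _ = blk ν1 ν2 (s h) (t h) (y h) := fun h => LinearMap.ext fun v => by simp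
  have h2 : LinearMap.fst ℂ (Vec ν2) (Vec ν1) ∘ₗ LinearMap.inl ℂ _ _ ∘ₗ asmG μ1 ν2 p = asmG μ1 ν2 p :=
    rfl
  have h3 : (q2 ∘ₗ LinearMap.fst ℂ _ _ + asmG ν1 μ2 q' ∘ₗ LinearMap.snd ℂ _ _) ∘ₗ LinearMap.inr ℂ _ _
      = asmG ν1 μ2 q' := LinearMap.ext fun v => by simp
  refine Prod.ext (Prod.ext (Prod.ext (funext fun h => ?_) ?_) (Prod.ext (funext fun h => ?_) ?_))
    (Prod.ext (funext fun h => ?_) (Prod.ext ?_ ?_))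
  · refine LinearMap.ext fun v => ?_
    simp [toOff, ofOff]
  · refine LinearMap.ext fun v => ?_
    simp [toOff, ofOff]
  · refine LinearMap.ext fun v => ?_
    simp [toOff, ofOff]
  · refine LinearMap.ext fun v => ?_
    simp [toOff, ofOff]
  · simp only [toOff, ofOff]
    rw [h1, unblk_blk]
  · simp only [toOff, ofOff]
    rw [h2, disG_asmG]
  · simp only [toOff, ofOff]
    rw [h3, disG_asmG]

theorem ofOff_toOff {X : Quad H (Vec ν2 × Vec ν1) (Vec μ2) (Vec μ1)}
    (hX : X ∈ adapted s t bar eps J μ2 μ1 ν2 ν1) : ofOff s t (toOff s t X) = X := by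
  obtain ⟨⟨hx, hp, hq2, hq1, hm, hn, hpc⟩, hc⟩ := hX
  have k1 : ∀ h v, (X.1 h (v, 0)).2 = 0 := fun h v => (hc _).1 (coreJ_inv ((hc (v, 0)).2 rfl) h)
  have k2 : ∀ v, X.2.2.2 (v, 0) = 0 := fun v => coreJ_apply ((hc (v, 0)).2 rfl)
  have k3 : ∀ d, (X.2.1 d).2 = 0 := fun d => (hc _).1 (hpc d)
  have sp : ∀ v : Vec ν2 × Vec ν1, v = (v.1, 0) + (0, v.2) := fun v => by simp
  refine Prod.ext (funext fun h => ?_) (Prod.ext ?_ (Prod.ext ?_ ?_))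
  · refine LinearMap.ext fun v => ?_
    simp only [ofOff, toOff, blk_unblk]
    rw [upper_apply]
    conv_rhs => rw [sp v, map_add]
    have := LinearMap.congr_fun (hx h) (0, v.2)
    simp only [LinearMap.comp_apply, prProd, LinearMap.prodMap_apply, map_zero] at this
    refine Prod.ext ?_ ?_
    · have := congrArg Prod.fst this
      simp only at this
      simp [← this]
    · simp [k1]
  · simp only [ofOff, toOff]
    rw [asmG_disG]
    · refine LinearMap.ext fun d => Prod.ext rfl (k3 d).symm
    · intro i
      refine LinearMap.ext fun d => ?_
      exact congrArg Prod.fst (LinearMap.congr_fun (hp i) d)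
  · simp only [ofOff, toOff]
    rw [asmG_disG]
    · refine LinearMap.ext fun v => ?_
      conv_rhs => rw [sp v, map_add]
      simp
    · intro i
      refine LinearMap.ext fun v => ?_
      have := LinearMap.congr_fun (hq2 i) (0, v)
      simpa [prProd] using this
  · refine LinearMap.ext fun v => ?_
    simp only [ofOff, toOff]
    conv_rhs => rw [sp v, map_add, k2, zero_add]
    simp

end AdaptedStratum

section AdaptedIso

variable {I H : Type} [Fintype I] [DecidableEq I] [Fintype H] (s t : H → I) (bar : H → H) (eps : H → ℤ)

theorem gradedHom_iff {ν μ : I → ℕ} {f : Vec ν →ₗ[ℂ] Vec μ} :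
    gradedHom ν μ f ↔ f ∈ LinearMap.range (asmG ν μ) :=
  ⟨fun h => ⟨_, asmG_disG h⟩, by rintro ⟨f, rfl⟩; exact gradedHom_asmG f⟩

theorem upper_inj {V2 V1 : Type} [AddCommGroup V2] [Module ℂ V2] [AddCommGroup V1] [Module ℂ V1]
    {a a' : Module.End ℂ V2} {b b' : V1 →ₗ[ℂ] V2} {c c' : Module.End ℂ V1} :
    upper a b c = upper a' b' c' ↔ a = a' ∧ b = b' ∧ c = c' := by
  constructor
  · intro h
    refine ⟨LinearMap.ext fun v => ?_, LinearMap.ext fun v => ?_, LinearMap.ext fun v => ?_⟩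
    · simpa using congrArg Prod.fst (LinearMap.congr_fun h (v, 0))
    · simpa using congrArg Prod.fst (LinearMap.congr_fun h (0, v))
    · simpa using congrArg Prod.snd (LinearMap.congr_fun h (0, v))
  · rintro ⟨rfl, rfl, rfl⟩; rfl

variable {J : Set I} {μ2 μ1 ν2 ν1 : I → ℕ}

omit [Fintype H] in
theorem upper_graded {x2 : H → Module.End ℂ (Vec ν2)} {x1 : H → Module.End ℂ (Vec ν1)} {h : H}
    {y : (Fin (ν1 (s h)) → ℂ) →ₗ[ℂ] (Fin (ν2 (t h)) → ℂ)} :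
    prProd ν2 ν1 (t h) ∘ₗ upper (x2 h) (blk ν1 ν2 (s h) (t h) y) (x1 h) ∘ₗ prProd ν2 ν1 (s h) =
      upper (x2 h) (blk ν1 ν2 (s h) (t h) y) (x1 h) ↔
    pr ν2 (t h) ∘ₗ x2 h ∘ₗ pr ν2 (s h) = x2 h ∧ pr ν1 (t h) ∘ₗ x1 h ∘ₗ pr ν1 (s h) = x1 h := by
  have : prProd ν2 ν1 (t h) ∘ₗ upper (x2 h) (blk ν1 ν2 (s h) (t h) y) (x1 h) ∘ₗ prProd ν2 ν1 (s h) =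
      upper (pr ν2 (t h) ∘ₗ x2 h ∘ₗ pr ν2 (s h))
        (pr ν2 (t h) ∘ₗ blk ν1 ν2 (s h) (t h) y ∘ₗ pr ν1 (s h))
        (pr ν1 (t h) ∘ₗ x1 h ∘ₗ pr ν1 (s h)) := by
    refine LinearMap.ext fun v => ?_
    simp [prProd]
  rw [this, upper_inj, pr_blk_pr]
  simp

theorem offEq_graded (hsbar : ∀ h, s (bar h) = t h) (htbar : ∀ h, t (bar h) = s h)
    {e : OffTotal s t μ2 μ1 ν2 ν1} (h2 : gradedX s t ν2 e.1.2.1) (h1 : gradedX s t ν1 e.1.1.1)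
    (hq : gradedHom ν1 μ1 e.1.1.2) :
    gradedHom ν1 ν2 (∑ h, eps h • (blk ν1 ν2 (s h) (t h) (e.2.1 h) ∘ₗ e.1.1.1 (bar h) -
      e.1.2.1 (bar h) ∘ₗ blk ν1 ν2 (s h) (t h) (e.2.1 h)) - asmG μ1 ν2 e.2.2.1 ∘ₗ e.1.1.2) := by
  have g1 := isGrading_pr ν1
  have g2 := isGrading_pr ν2
  have hy : ∀ h v, blk ν1 ν2 (s h) (t h) (e.2.1 h) v =
      pr ν2 (t h) (blk ν1 ν2 (s h) (t h) (e.2.1 h) (pr ν1 (s h) v)) := fun h v =>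
    (LinearMap.congr_fun (pr_blk_pr (s h) (t h) (e.2.1 h)) v).symm
  rw [gradedHom_iff]
  refine Submodule.sub_mem _ (Submodule.sum_mem _ fun h _ => zsmul_mem (Submodule.sub_mem _ ?_ ?_) _) ?_
  · rw [← gradedHom_iff]
    intro i
    refine LinearMap.ext fun v => ?_
    simp only [LinearMap.comp_apply]
    rw [gr_comm s t g1 h1, hsbar]
    split_ifs with hi
    · subst hi
      rw [hy, g2.idem]
    · rw [hy, g2.orth _ _ hi, map_zero]
  · rw [← gradedHom_iff]
    intro i
    refine LinearMap.ext fun v => ?_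
    simp only [LinearMap.comp_apply]
    rw [gr_comm' s t g2 h2, htbar]
    split_ifs with hi
    · subst hi
      rw [hy h (pr ν1 (s h) v), g1.idem, ← hy]
    · rw [hy h (pr ν1 i v), g1.orth _ _ (Ne.symm hi), map_zero, map_zero, map_zero]
  · rw [← gradedHom_iff]
    intro i
    rw [← LinearMap.comp_assoc, gradedHom_asmG e.2.2.1 i, LinearMap.comp_assoc, hq i,
      LinearMap.comp_assoc]

theorem ofOff_mem (hsbar : ∀ h, s (bar h) = t h) (htbar : ∀ h, t (bar h) = s h)
    (hbb : ∀ h, bar (bar h) = h) (hepsbar : ∀ h, eps h + eps (bar h) = 0)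
    (hJ : ∀ i ∉ J, ν2 i = 0) {e : OffTotal s t μ2 μ1 ν2 ν1} :
    ofOff s t e ∈ adapted s t bar eps J μ2 μ1 ν2 ν1 ↔
      e ∈ bundle (LJs s t bar eps J ν1 μ1 ×ˢ LSet s t bar eps ν2 μ2)
        (offEq s t bar eps μ2 μ1 ν2 ν1) := by
  have hcore : ∀ v, v ∈ coreJ J (prProd ν2 ν1) (ofOff s t e).1 (ofOff s t e).2.2.2 ↔
      v.2 ∈ coreJ J (pr ν1) e.1.1.1 e.1.1.2 := fun v =>
    mem_coreJ_upper (fun i hi => pr_of_eq_zero (hJ i hi))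
  have hmom : (∑ h : H, eps h • ((ofOff s t e).1 h * (ofOff s t e).1 (bar h))) =
      upper (∑ h, eps h • (e.1.2.1 h * e.1.2.1 (bar h)))
        (∑ h, eps h • (blk ν1 ν2 (s h) (t h) (e.2.1 h) ∘ₗ e.1.1.1 (bar h) -
          e.1.2.1 (bar h) ∘ₗ blk ν1 ν2 (s h) (t h) (e.2.1 h)))
        (∑ h, eps h • (e.1.1.1 h * e.1.1.1 (bar h))) := by
    have hre : (∑ h, eps h • (e.1.2.1 h ∘ₗ blk ν1 ν2 _ _ (e.2.1 (bar h)))) =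
        ∑ h, -(eps h • (e.1.2.1 (bar h) ∘ₗ blk ν1 ν2 (s h) (t h) (e.2.1 h))) := by
      refine Fintype.sum_equiv (Function.Involutive.toPerm bar hbb) _ _ fun h => ?_
      have : eps (bar h) = - eps h := by linarith [hepsbar h]
      change _ = -(eps (bar h) • (e.1.2.1 (bar (bar h)) ∘ₗ
        blk ν1 ν2 (s (bar h)) (t (bar h)) (e.2.1 (bar h))))
      rw [this, hbb, neg_smul, neg_neg]
    have hsum : (∑ h, eps h • (blk ν1 ν2 (s h) (t h) (e.2.1 h) ∘ₗ e.1.1.1 (bar h) -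
          e.1.2.1 (bar h) ∘ₗ blk ν1 ν2 (s h) (t h) (e.2.1 h))) =
        ∑ h, eps h • (blk ν1 ν2 (s h) (t h) (e.2.1 h) ∘ₗ e.1.1.1 (bar h)) +
        ∑ h, eps h • (e.1.2.1 h ∘ₗ blk ν1 ν2 _ _ (e.2.1 (bar h))) := by
      rw [hre, ← Finset.sum_add_distrib]
      exact Finset.sum_congr rfl fun h _ => by rw [smul_sub, sub_eq_add_neg]
    rw [hsum]
    refine LinearMap.ext fun v => Prod.ext ?_ ?_
    · simp only [LinearMap.sum_apply, Prod.fst_sum, LinearMap.smul_apply, Prod.smul_fst,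
        Module.End.mul_apply, upper_apply, LinearMap.add_apply, LinearMap.comp_apply, ofOff, map_add,
        smul_add, Finset.sum_add_distrib]
      abel
    · simp only [LinearMap.sum_apply, Prod.snd_sum, LinearMap.smul_apply, Prod.smul_snd,
        Module.End.mul_apply, upper_apply, ofOff]
  have hpq : (ofOff s t e).2.1 ∘ₗ (ofOff s t e).2.2.2 =
      upper 0 (asmG μ1 ν2 e.2.2.1 ∘ₗ e.1.1.2) 0 :=
    LinearMap.ext fun v => Prod.ext (by simp [ofOff]) (by simp [ofOff])
  have hq2 : (∀ i, pr μ2 i ∘ₗ (ofOff s t e).2.2.1 = (ofOff s t e).2.2.1 ∘ₗ prProd ν2 ν1 i) ↔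
      gradedHom ν2 μ2 e.1.2.2 := by
    refine forall_congr' fun i => ⟨fun h => LinearMap.ext fun v => ?_, fun h => LinearMap.ext fun v => ?_⟩
    · simpa [ofOff, prProd] using LinearMap.congr_fun h (v, 0)
    · have h1 := LinearMap.congr_fun h v.1
      have h2 := LinearMap.congr_fun (gradedHom_asmG e.2.2.2 i) v.2
      simp only [LinearMap.comp_apply] at h1 h2
      simp [ofOff, prProd, h1, h2]
  have hq1 : (∀ i, pr μ1 i ∘ₗ (ofOff s t e).2.2.2 = (ofOff s t e).2.2.2 ∘ₗ prProd ν2 ν1 i) ↔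
      gradedHom ν1 μ1 e.1.1.2 := by
    refine forall_congr' fun i => ⟨fun h => LinearMap.ext fun v => ?_, fun h => LinearMap.ext fun v => ?_⟩
    · simpa [ofOff, prProd] using LinearMap.congr_fun h (0, v)
    · simpa [ofOff, prProd] using LinearMap.congr_fun h v.2
  have hgr : (∀ h, prProd ν2 ν1 (t h) ∘ₗ (ofOff s t e).1 h ∘ₗ prProd ν2 ν1 (s h) = (ofOff s t e).1 h) ↔
      gradedX s t ν2 e.1.2.1 ∧ gradedX s t ν1 e.1.1.1 := by
    simp only [ofOff, upper_graded, gradedX, forall_and]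
  have hp : ∀ i, prProd ν2 ν1 i ∘ₗ (ofOff s t e).2.1 = (ofOff s t e).2.1 ∘ₗ pr μ1 i := fun i => by
    refine LinearMap.ext fun v => ?_
    have h2 := LinearMap.congr_fun (gradedHom_asmG e.2.2.1 i) v
    simp only [LinearMap.comp_apply] at h2
    simp [ofOff, prProd, h2]
  have hnil : Nilp (ofOff s t e).1 ↔ Nilp e.1.2.1 ∧ Nilp e.1.1.1 := nilp_upper
  constructor
  · rintro ⟨⟨k1, -, k3, k4, k5, k6, -⟩, k8⟩
    rw [hgr] at k1
    rw [hq2] at k3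
    rw [hq1] at k4
    rw [hmom, hpq, upper_inj] at k5
    rw [hnil] at k6
    refine ⟨⟨⟨⟨⟨k1.2, k5.2.2, k6.2⟩, k4⟩, ?_⟩, ⟨⟨k1.1, k5.1, k6.1⟩, k3⟩⟩, ?_⟩
    · rw [eq_bot_iff]
      intro v hv
      exact (k8 (0, v)).1 ((hcore _).2 hv)
    · rw [offEq_apply, k5.2.1, sub_self, map_zero]
  · rintro ⟨⟨⟨⟨⟨k1, k2, k3⟩, k4⟩, k5⟩, ⟨⟨k6, k7, k8⟩, k9⟩⟩, k10⟩
    rw [offEq_apply] at k10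
    have hc' : ∀ v, v ∈ coreJ J (prProd ν2 ν1) (ofOff s t e).1 (ofOff s t e).2.2.2 ↔ v.2 = 0 := fun v => by
      rw [hcore, k5, Submodule.mem_bot]
    refine ⟨⟨hgr.2 ⟨k6, k1⟩, hp, hq2.2 k9, hq1.2 k4, ?_, hnil.2 ⟨k8, k3⟩, fun d => (hc' _).2 rfl⟩, hc'⟩
    rw [hmom, hpq, upper_inj]
    refine ⟨k7, ?_, k2⟩
    have := asmG_disG (offEq_graded s t bar eps hsbar htbar k6 k1 k4)
    rw [k10, map_zero] at this
    exact sub_eq_zero.1 this.symm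

/-- The adapted stratum is a bundle over the product of the two smaller varieties. -/
def adaptedIso (hsbar : ∀ h, s (bar h) = t h) (htbar : ∀ h, t (bar h) = s h)
    (hbb : ∀ h, bar (bar h) = h) (hepsbar : ∀ h, eps h + eps (bar h) = 0)
    (hJ : ∀ i ∉ J, ν2 i = 0) :
    RIso (bundle (LJs s t bar eps J ν1 μ1 ×ˢ LSet s t bar eps ν2 μ2)
        (offEq s t bar eps μ2 μ1 ν2 ν1)) (adapted s t bar eps J μ2 μ1 ν2 ν1) where
  f := ofOff s t
  g := toOff s t
  rf := regMap_ofOff s t _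
  rg := regMap_toOff s t _
  mf _ he := (ofOff_mem s t bar eps hsbar htbar hbb hepsbar hJ).2 he
  mg _ hX := (ofOff_mem s t bar eps hsbar htbar hbb hepsbar hJ).1
    ((ofOff_toOff s t bar eps hX).symm ▸ hX)
  gf e _ := toOff_ofOff s t e
  fg _ hX := ofOff_toOff s t bar eps hX

end AdaptedIso

section TestMap

variable {I H : Type} [Fintype I] [Fintype H]
  {V D2 D1 : Type} [AddCommGroup V] [Module ℂ V] [FiniteDimensional ℂ V]
  [AddCommGroup D2] [Module ℂ D2] [FiniteDimensional ℂ D2]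
  [AddCommGroup D1] [Module ℂ D1] [FiniteDimensional ℂ D1]

/-- Words shorter than `N`. -/
abbrev ShortWord (H : Type) (N : ℕ) : Type := {l : List H // l.length < N}

instance (N : ℕ) : Finite (ShortWord H N) := (List.finite_length_lt H N).to_subtype

/-- The linear map whose kernel is the core. -/
def testMap (J : Set I) (π : I → Module.End ℂ V) (x : H → Module.End ℂ V) (q : V →ₗ[ℂ] D1) :
    V →ₗ[ℂ] (ShortWord H (Module.finrank ℂ V) → D1 × V) :=
  LinearMap.pi fun l => (LinearMap.inl ℂ D1 V ∘ₗ q + LinearMap.inr ℂ D1 V ∘ₗ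
    ∑ i with i ∉ J, π i) ∘ₗ (l.1.map x).prod

omit [Fintype H] [FiniteDimensional ℂ D1] in
theorem testMap_eq_zero {J : Set I} {π : I → Module.End ℂ V} (hπ : IsGrading π)
    {x : H → Module.End ℂ V} (hx : Nilp x) {q : V →ₗ[ℂ] D1} {v : V} :
    testMap J π x q v = 0 ↔ v ∈ coreJ J π x q := by
  have hJ : ∀ w, (∑ i with i ∉ J, π i) w = 0 ↔ ∀ i ∉ J, π i w = 0 := by
    intro w
    rw [LinearMap.sum_apply]
    constructor
    · intro h i hi
      have := congrArg (π i) h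
      rw [map_sum, map_zero, Finset.sum_eq_single i] at this
      · rwa [hπ.idem] at this
      · exact fun j _ hj => hπ.orth _ _ (Ne.symm hj) _
      · intro h; simp [hi] at h
    · intro h
      exact Finset.sum_eq_zero fun i hi => h i (by simpa using hi)
  rw [mem_coreJ, funext_iff]
  constructor
  · intro h l
    by_cases hl : l.length < Module.finrank ℂ V
    · have := h ⟨l, hl⟩
      rw [← hJ]
      simpa [testMap] using this
    · rw [hx.word_eq_zero (not_lt.1 hl)]
      simp
  · intro h l
    have := h l.1
    rw [← hJ] at this
    simpa [testMap] using this

theorem regMap_lpi {M N : Type} [AddCommGroup M] [Module ℂ M] [AddCommGroup N] [Module ℂ N]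
    [FiniteDimensional ℂ N] {P : Type} [AddCommGroup P] [Module ℂ P] [FiniteDimensional ℂ P]
    {ι : Type} [Finite ι] {Z : Set M} {f : M → ι → N →ₗ[ℂ] P}
    (hf : ∀ i, RegMap Z (fun m => f m i)) : RegMap Z (fun m => LinearMap.pi (f m)) := by
  have := Fintype.ofFinite ι
  have : RegMap Z (fun m => ∑ i, (LinearMap.single ℂ (fun _ : ι => P) i) ∘ₗ f m i) :=
    RegMap.sum _ fun i _ => (regMap_const _ _).lcomp (hf i)
  refine this.congr fun m _ => LinearMap.ext fun v => funext fun j => ?_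
  simp [LinearMap.sum_apply, Finset.sum_apply, Pi.single_apply]

omit [Fintype H] in
theorem RegMap.word {M : Type} [AddCommGroup M] [Module ℂ M] {Z : Set M}
    {x : M → H → Module.End ℂ V} (hx : RegMap Z x) (l : List H) :
    RegMap Z (fun m => (l.map (x m)).prod) := by
  induction l with
  | nil => simpa using regMap_const Z (1 : Module.End ℂ V)
  | cons h l ih => simpa using (hx.proj h).lmul ih

theorem RegMap.testMap {M : Type} [AddCommGroup M] [Module ℂ M] {Z : Set M} (J : Set I)
    (π : I → Module.End ℂ V)
    {x : M → H → Module.End ℂ V} (hx : RegMap Z x) {q : M → V →ₗ[ℂ] D1} (hq : RegMap Z q) :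
    RegMap Z (fun m => testMap J π (x m) (q m)) :=
  regMap_lpi fun l => RegMap.lcomp (RegMap.add (RegMap.lcomp (regMap_const _ _) hq) (regMap_const _ _))
    (hx.word l.1)

end TestMap

section GraphChart

variable {I H : Type} [Fintype I] [DecidableEq I] [Fintype H] (s t : H → I) (bar : H → H) (eps : H → ℤ)

/-- The unipotent automorphism of `V2 × V1` given by `u : V2 → V1`. -/
def shear {V2 V1 : Type} [AddCommGroup V2] [Module ℂ V2] [AddCommGroup V1] [Module ℂ V1]
    (u : V2 →ₗ[ℂ] V1) : (V2 × V1) ≃ₗ[ℂ] (V2 × V1) :=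
  LinearEquiv.ofLinearMap (LinearMap.id + LinearMap.inr ℂ _ _ ∘ₗ u ∘ₗ LinearMap.fst ℂ _ _)
    (LinearMap.id - LinearMap.inr ℂ _ _ ∘ₗ u ∘ₗ LinearMap.fst ℂ _ _)
    (by ext <;> simp) (by ext <;> simp)

theorem shear_apply {V2 V1 : Type} [AddCommGroup V2] [Module ℂ V2] [AddCommGroup V1] [Module ℂ V1]
    (u : V2 →ₗ[ℂ] V1) (v : V2 × V1) : shear u v = (v.1, v.2 + u v.1) := by
  simp [shear]
  ext <;> simp

theorem RegMap.trQ {M V V' D2 D1 : Type} [AddCommGroup M] [Module ℂ M] [AddCommGroup V] [Module ℂ V]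
    [AddCommGroup V'] [Module ℂ V'] [AddCommGroup D2] [Module ℂ D2] [AddCommGroup D1] [Module ℂ D1]
    [FiniteDimensional ℂ V] [FiniteDimensional ℂ V'] [FiniteDimensional ℂ D2] [FiniteDimensional ℂ D1]
    {Z : Set M} {θ : M → V ≃ₗ[ℂ] V'} (h1 : RegMap Z fun m => (θ m).toLinearMap)
    (h2 : RegMap Z fun m => (θ m).symm.toLinearMap) {Y : M → Quad H V D2 D1} (hY : RegMap Z Y) :
    RegMap Z (fun m => trQ (θ m) (Y m)) := by
  refine RegMap.prodMk (regMap_pi fun h => ?_) (RegMap.prodMk ?_ (RegMap.prodMk ?_ ?_))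
  · exact h1.lcomp ((hY.fst.proj h).lcomp h2)
  · exact h1.lcomp hY.snd.fst
  · exact hY.snd.snd.fst.lcomp h2
  · exact hY.snd.snd.snd.lcomp h2

variable {J : Set I} {μ2 μ1 ν2 ν1 : I → ℕ}

theorem isGrading_prProd : IsGrading (prProd ν2 ν1) := (isGrading_pr ν2).prodMap (isGrading_pr ν1)

variable (J μ2 μ1 ν2 ν1) in
/-- The quadruples whose core is the graph of a linear map. -/
def graphSet : Set (Quad H (Vec ν2 × Vec ν1) (Vec μ2) (Vec μ1)) :=
  {X | X ∈ PiJ s t bar eps J (prProd ν2 ν1) (pr μ2) (pr μ1) ∧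
    ∃ u : Vec ν2 →ₗ[ℂ] Vec ν1, ∀ v, v ∈ coreJ J (prProd ν2 ν1) X.1 X.2.2.2 ↔ v.2 = u v.1}

variable (J) in
/-- The linear map whose graph is the core. -/
def graphMap (X : Quad H (Vec ν2 × Vec ν1) (Vec μ2) (Vec μ1)) : Vec ν2 →ₗ[ℂ] Vec ν1 :=
  if h : ∃ u : Vec ν2 →ₗ[ℂ] Vec ν1, ∀ v, v ∈ coreJ J (prProd ν2 ν1) X.1 X.2.2.2 ↔ v.2 = u v.1
    then h.choose else 0

omit [Fintype H] in
omit [Fintype I] in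
theorem graphMap_spec {X : Quad H (Vec ν2 × Vec ν1) (Vec μ2) (Vec μ1)}
    (h : ∃ u : Vec ν2 →ₗ[ℂ] Vec ν1, ∀ v, v ∈ coreJ J (prProd ν2 ν1) X.1 X.2.2.2 ↔ v.2 = u v.1)
    (v : Vec ν2 × Vec ν1) :
    v ∈ coreJ J (prProd ν2 ν1) X.1 X.2.2.2 ↔ v.2 = graphMap J X v.1 := by
  rw [graphMap, dif_pos h]
  exact h.choose_spec v

omit [Fintype H] in
theorem graphMap_eq {X : Quad H (Vec ν2 × Vec ν1) (Vec μ2) (Vec μ1)} {u : Vec ν2 →ₗ[ℂ] Vec ν1}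
    (h : ∀ v, v ∈ coreJ J (prProd ν2 ν1) X.1 X.2.2.2 ↔ v.2 = u v.1) : graphMap J X = u := by
  refine LinearMap.ext fun w => ?_
  have h1 := (h (w, u w)).2 rfl
  exact ((graphMap_spec ⟨u, h⟩ _).1 h1).symm

theorem graphMap_graded {X : Quad H (Vec ν2 × Vec ν1) (Vec μ2) (Vec μ1)}
    (hX : X ∈ graphSet s t bar eps J μ2 μ1 ν2 ν1) : gradedHom ν2 ν1 (graphMap J X) := by
  intro i
  refine LinearMap.ext fun w => ?_
  have h1 := (graphMap_spec hX.2 (w, graphMap J X w)).2 rfl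
  have h2 := coreJ_graded s t isGrading_prProd hX.1.1 hX.1.2.2.2.1 h1 i
  exact (graphMap_spec hX.2 _).1 h2

theorem regMap_graphMap : RegMap (graphSet s t bar eps J μ2 μ1 ν2 ν1) (graphMap J) := by
  refine regMap_of_local fun X0 hX0 => ?_
  set S := graphSet s t bar eps J μ2 μ1 ν2 ν1
  have hT : RegMap S (fun X => testMap J (prProd ν2 ν1) X.1 X.2.2.2) :=
    RegMap.testMap J _ (regMap_id S).fst (regMap_id S).snd.snd.snd
  have hinj : LinearMap.ker (testMap J (prProd ν2 ν1) X0.1 X0.2.2.2 ∘ₗ LinearMap.inr ℂ _ _) = ⊥ := by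
    rw [LinearMap.ker_eq_bot']
    intro v hv
    rw [LinearMap.comp_apply, testMap_eq_zero isGrading_prProd hX0.1.2.2.2.2.2.1,
      graphMap_spec hX0.2] at hv
    simpa using hv
  obtain ⟨C, hC⟩ := LinearMap.exists_leftInverse_of_injective _ hinj
  have hB : RegMap S (fun X => (C ∘ₗ testMap J (prProd ν2 ν1) X.1 X.2.2.2 ∘ₗ LinearMap.inr ℂ _ _ :
      Module.End ℂ (Vec ν1))) := (regMap_const _ _).lcomp (hT.lcomp (regMap_const _ _))
  have hU := relOpen_ne_zero hB.det
  obtain ⟨g, hg, hg1⟩ := (hB.mono hU.1).inverse fun z hz => hz.2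
  refine ⟨_, hU, ⟨hX0, ?_⟩, ?_⟩
  · rw [hC, LinearMap.det_id]
    exact one_ne_zero
  · refine ((hg.lcomp ((regMap_const _ C).lcomp ((hT.mono hU.1).lcomp
      (regMap_const _ (LinearMap.inl ℂ _ _)))))).neg.congr fun X hX => LinearMap.ext fun w => ?_
    have h1 := (graphMap_spec hX.1.2 (w, graphMap J X w)).2 rfl
    rw [← testMap_eq_zero isGrading_prProd hX.1.1.2.2.2.2.2.1] at h1
    have h2 : (w, graphMap J X w) = LinearMap.inl ℂ (Vec ν2) (Vec ν1) w +
        LinearMap.inr ℂ (Vec ν2) (Vec ν1) (graphMap J X w) := by simp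
    rw [h2, map_add] at h1
    have h3 := congrArg (fun y => g X (C y)) h1
    simp only [map_add, map_zero] at h3
    have h4 := LinearMap.congr_fun (hg1 X hX).1 (graphMap J X w)
    simp only [Module.End.mul_apply, LinearMap.comp_apply, Module.End.one_apply] at h4
    rw [h4] at h3
    simpa using (neg_eq_of_add_eq_zero_right h3).symm

omit [Fintype I] in
theorem shear_graded {u : Vec ν2 →ₗ[ℂ] Vec ν1} (hu : gradedHom ν2 ν1 u) (i : I)
    (v : Vec ν2 × Vec ν1) : shear u (prProd ν2 ν1 i v) = prProd ν2 ν1 i (shear u v) := by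
  rw [shear_apply, shear_apply]
  have := LinearMap.congr_fun (hu i) v.1
  simp only [LinearMap.comp_apply] at this
  simp [prProd, this]

theorem shear_symm_graded {u : Vec ν2 →ₗ[ℂ] Vec ν1} (hu : gradedHom ν2 ν1 u) (i : I)
    (v : Vec ν2 × Vec ν1) :
    (shear u).symm (prProd ν2 ν1 i v) = prProd ν2 ν1 i ((shear u).symm v) := by
  rw [LinearEquiv.symm_apply_eq, shear_graded hu, LinearEquiv.apply_symm_apply]

theorem adapted_of_graph {X : Quad H (Vec ν2 × Vec ν1) (Vec μ2) (Vec μ1)}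
    (hX : X ∈ graphSet s t bar eps J μ2 μ1 ν2 ν1) :
    trQ (shear (graphMap J X)).symm X ∈ adapted s t bar eps J μ2 μ1 ν2 ν1 := by
  have hg := shear_symm_graded (graphMap_graded s t bar eps hX)
  refine ⟨trQ_mem s t bar eps hg hX.1, fun v => ?_⟩
  obtain ⟨w, rfl⟩ := (shear (graphMap J X)).symm.surjective v
  rw [mem_coreJ_trQ hg, graphMap_spec hX.2]
  obtain ⟨v, rfl⟩ := (shear (graphMap J X)).surjective w
  rw [LinearEquiv.symm_apply_apply, shear_apply]
  simp

theorem core_of_shear {X : Quad H (Vec ν2 × Vec ν1) (Vec μ2) (Vec μ1)} {u : Vec ν2 →ₗ[ℂ] Vec ν1}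
    (hX : X ∈ adapted s t bar eps J μ2 μ1 ν2 ν1) (hu : gradedHom ν2 ν1 u) (v : Vec ν2 × Vec ν1) :
    v ∈ coreJ J (prProd ν2 ν1) (trQ (shear u) X).1 (trQ (shear u) X).2.2.2 ↔ v.2 = u v.1 := by
  obtain ⟨w, rfl⟩ := (shear u).surjective v
  rw [mem_coreJ_trQ (shear_graded hu), hX.2, shear_apply]
  simp

/-- The graph locus is a product of the adapted locus and the graded homomorphisms. -/
def graphIso : RIso (adapted s t bar eps J μ2 μ1 ν2 ν1 ×ˢ ((⊤ : Submodule ℂ (HomG ν2 ν1)) : Set (HomG ν2 ν1)))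
    (graphSet s t bar eps J μ2 μ1 ν2 ν1) where
  f e := trQ (shear (asmG ν2 ν1 e.2)) e.1
  g X := (trQ (shear (graphMap J X)).symm X, disG ν2 ν1 (graphMap J X))
  rf := by
    refine RegMap.trQ ?_ ?_ (regMap_id _).fst
    · exact (regMap_const _ _).add ((regMap_const _ _).lcomp
        (((regMap_id _).snd.linear _).lcomp (regMap_const _ _)))
    · exact (regMap_const _ _).sub ((regMap_const _ _).lcomp
        (((regMap_id _).snd.linear _).lcomp (regMap_const _ _)))
  rg := by
    have h := regMap_graphMap s t bar eps (J := J) (μ2 := μ2) (μ1 := μ1) (ν2 := ν2) (ν1 := ν1)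
    refine RegMap.prodMk (RegMap.trQ ?_ ?_ (regMap_id _)) (h.linear _)
    · exact (regMap_const _ _).sub ((regMap_const _ _).lcomp (h.lcomp (regMap_const _ _)))
    · exact (regMap_const _ _).add ((regMap_const _ _).lcomp (h.lcomp (regMap_const _ _)))
  mf e he := ⟨trQ_mem s t bar eps (shear_graded (gradedHom_asmG _)) he.1.1,
    _, core_of_shear s t bar eps he.1 (gradedHom_asmG _)⟩
  mg X hX := ⟨adapted_of_graph s t bar eps hX, trivial⟩
  gf e he := by
    have h := graphMap_eq (core_of_shear s t bar eps he.1 (gradedHom_asmG e.2))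
    simp only [h]
    rw [trQ_symm_trQ, disG_asmG]
  fg X hX := by
    simp only
    rw [asmG_disG (graphMap_graded s t bar eps hX)]
    exact trQ_symm_trQ (shear (graphMap J X)).symm X

end GraphChart

section CommonComplement

variable {V : Type} [AddCommGroup V] [Module ℂ V] [FiniteDimensional ℂ V]

theorem exists_common_isCompl (k : ℕ) : ∀ (𝒦 : Finset (Submodule ℂ V)),
    (∀ K ∈ 𝒦, Module.finrank ℂ K + k = Module.finrank ℂ V) →
    ∃ W : Submodule ℂ V, ∀ K ∈ 𝒦, IsCompl K W := by
  induction k with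
  | zero =>
    refine fun 𝒦 h => ⟨⊥, fun K hK => ?_⟩
    rw [Submodule.eq_top_of_finrank_eq (h K hK)]
    exact isCompl_top_bot
  | succ k ih =>
    intro 𝒦 h
    have hn : (⊤ : Submodule ℂ V) ∉ 𝒦 := fun hT => by
      have := h _ hT
      rw [finrank_top] at this
      omega
    obtain ⟨w, hw⟩ := (Set.ne_univ_iff_exists_notMem _).1 (Subspace.biUnion_ne_univ_of_top_notMem hn)
    simp only [Set.mem_iUnion, not_exists, SetLike.mem_coe] at hw
    have h0 : ∀ K ∈ 𝒦, w ≠ 0 := by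
      rintro K hK rfl
      exact hw K hK K.zero_mem
    have hd : ∀ K ∈ 𝒦, Disjoint K (Submodule.span ℂ {w}) := fun K hK =>
      (Submodule.disjoint_span_singleton' (h0 K hK)).2 (hw K hK)
    obtain ⟨W, hW⟩ := ih (𝒦.image fun K => K ⊔ Submodule.span ℂ {w}) (by
      intro K hK
      obtain ⟨K, hK', rfl⟩ := Finset.mem_image.1 hK
      have h2 := Submodule.finrank_sup_add_finrank_inf_eq K (Submodule.span ℂ {w})
      rw [disjoint_iff.1 (hd K hK'), finrank_bot, finrank_span_singleton (h0 K hK')] at h2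
      have := h K hK'
      omega)
    refine ⟨Submodule.span ℂ {w} ⊔ W, fun K hK => ?_⟩
    have h1 := hW _ (Finset.mem_image_of_mem _ hK)
    refine ⟨(hd K hK).disjoint_sup_right_of_disjoint_sup_left h1.disjoint, ?_⟩
    rw [codisjoint_iff, ← sup_assoc]
    exact h1.sup_eq_top

theorem exists_generic_equiv {a b : ℕ} (hV : Module.finrank ℂ V = a + b)
    (𝒦 : Finset (Submodule ℂ V)) (h𝒦 : ∀ K ∈ 𝒦, Module.finrank ℂ K = a) :
    ∃ Φ : V ≃ₗ[ℂ] (Fin a → ℂ) × (Fin b → ℂ), ∀ K ∈ 𝒦, ∀ v ∈ K, (Φ v).1 = 0 → v = 0 := by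
  obtain ⟨e⟩ : Nonempty (V ≃ₗ[ℂ] (Fin a → ℂ) × (Fin b → ℂ)) :=
    FiniteDimensional.nonempty_linearEquiv_of_finrank_eq (by simp [hV])
  let K0 : Submodule ℂ V := LinearMap.range (e.symm.toLinearMap ∘ₗ LinearMap.inl ℂ _ _)
  have hK0 : Module.finrank ℂ K0 = a := by
    rw [LinearMap.finrank_range_of_inj]
    · simp
    · exact e.symm.injective.comp LinearMap.inl_injective
  obtain ⟨W, hW⟩ := exists_common_isCompl b (insert K0 𝒦) (by
    intro K hK
    rcases Finset.mem_insert.1 hK with rfl | hK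
    · rw [hK0, hV]
    · rw [h𝒦 K hK, hV])
  have hc := hW K0 (Finset.mem_insert_self _ _)
  have hWd : Module.finrank ℂ W = b := by
    have := Submodule.finrank_add_eq_of_isCompl hc
    omega
  obtain ⟨e1⟩ : Nonempty (K0 ≃ₗ[ℂ] (Fin a → ℂ)) :=
    FiniteDimensional.nonempty_linearEquiv_of_finrank_eq (by simp [hK0])
  obtain ⟨e2⟩ : Nonempty (W ≃ₗ[ℂ] (Fin b → ℂ)) :=
    FiniteDimensional.nonempty_linearEquiv_of_finrank_eq (by simp [hWd])
  refine ⟨(Submodule.prodEquivOfIsCompl K0 W hc).symm.trans (e1.prodCongr e2), fun K hK v hv h0 => ?_⟩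
  have h1 : ((Submodule.prodEquivOfIsCompl K0 W hc).symm v).1 = 0 := by
    simpa using h0
  have h2 : v ∈ W := (Submodule.prodEquivOfIsCompl_symm_apply_fst_eq_zero _ _ hc).1 h1
  exact Submodule.disjoint_def.1 (hW K (Finset.mem_insert_of_mem hK)).disjoint v hv h2

end CommonComplement

section Chart

variable {I H : Type} [Fintype I] [DecidableEq I] [Fintype H] (s t : H → I) (bar : H → H) (eps : H → ℤ)

variable {J : Set I} {μ2 μ1 ν ν2 ν1 : I → ℕ}

variable (J) in
/-- The graded pieces of the core. -/
def coreAt (X : Quad H (Vec ν) (Vec μ2) (Vec μ1)) (i : I) : Submodule ℂ (Fin (ν i) → ℂ) :=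
  (coreJ J (pr ν) X.1 X.2.2.2).comap (LinearMap.single ℂ (fun i => Fin (ν i) → ℂ) i)

variable (J) in
/-- The graded dimension of the core. -/
def cdim (X : Quad H (Vec ν) (Vec μ2) (Vec μ1)) (i : I) : ℕ := Module.finrank ℂ (coreAt J X i)

variable (J μ2 μ1 ν) in
/-- The quadruples with core of given dimension. -/
def stratum (k : I → ℕ) : Set (Quad H (Vec ν) (Vec μ2) (Vec μ1)) :=
  {X | X ∈ PiJ s t bar eps J (pr ν) (pr μ2) (pr μ1) ∧ cdim J X = k}

theorem mem_core_iff {X : Quad H (Vec ν) (Vec μ2) (Vec μ1)}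
    (hX : X ∈ PiJ s t bar eps J (pr ν) (pr μ2) (pr μ1)) (v : Vec ν) :
    v ∈ coreJ J (pr ν) X.1 X.2.2.2 ↔ ∀ i, v i ∈ coreAt J X i := by
  constructor
  · intro hv i
    exact coreJ_graded s t (isGrading_pr ν) hX.1 hX.2.2.2.1 hv i
  · intro h
    rw [← (isGrading_pr ν).total v]
    exact Submodule.sum_mem _ fun i _ => h i

theorem relOpen_cdim_le (m : I → ℕ) :
    RelOpen (PiJ s t bar eps J (pr ν) (pr μ2) (pr μ1))
      {X | X ∈ PiJ s t bar eps J (pr ν) (pr μ2) (pr μ1) ∧ cdim J X ≤ m} := by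
  set S := PiJ s t bar eps J (pr ν) (pr μ2) (pr μ1)
  have key : ∀ i, RelOpen S {X | X ∈ S ∧ cdim J X i ≤ m i} := by
    intro i
    refine relOpen_of_local (fun X hX => hX.1) fun X0 hX0 => ?_
    obtain ⟨f, hf⟩ : ∃ f : coreAt J X0 i →ₗ[ℂ] (Fin (m i) → ℂ), Function.Injective f := by
      refine finrank_le_iff_exists_linearMap.1 ?_
      rw [Module.finrank_fin_fun]
      exact hX0.2
    obtain ⟨C, hC⟩ := LinearMap.exists_extend f
    have hT : RegMap S (fun X => (LinearMap.inl ℂ _ (Fin (m i) → ℂ) ∘ₗ testMap J (pr ν) X.1 X.2.2.2 ∘ₗ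
        LinearMap.single ℂ (fun i => Fin (ν i) → ℂ) i + LinearMap.inr ℂ _ (Fin (m i) → ℂ) ∘ₗ C)) :=
      ((regMap_const _ _).lcomp ((RegMap.testMap J _ (regMap_id S).fst (regMap_id S).snd.snd.snd).lcomp
        (regMap_const _ _))).add (regMap_const _ _)
    have hk : ∀ X ∈ S, ∀ w, (testMap J (pr ν) X.1 X.2.2.2 (Pi.single i w) = 0 ↔ w ∈ coreAt J X i) :=
      fun X hX w => testMap_eq_zero (isGrading_pr ν) hX.2.2.2.2.2.1
    refine ⟨_, relOpen_injective hT, ⟨hX0.1, ?_⟩, ?_⟩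
    · rw [← LinearMap.ker_eq_bot, LinearMap.ker_eq_bot']
      intro w hw
      have h1 := (Prod.ext_iff.1 hw).1
      have h2 := (Prod.ext_iff.1 hw).2
      simp at h1 h2
      rw [hk X0 hX0.1] at h1
      have h3 : f ⟨w, h1⟩ = 0 := by rw [← hC]; exact h2
      exact congrArg Subtype.val ((map_eq_zero_iff f hf).1 h3)
    · intro X hX
      refine ⟨hX.1, ?_⟩
      have h1 : Function.Injective (C ∘ₗ (coreAt J X i).subtype) := by
        rw [← LinearMap.ker_eq_bot, LinearMap.ker_eq_bot']
        intro w hw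
        refine Subtype.ext (hX.2 ?_)
        have := (hk X hX.1 w).2 w.2
        refine Prod.ext ?_ ?_
        · simpa using this
        · simpa using hw
      have h2 := LinearMap.finrank_le_finrank_of_injective h1
      rwa [Module.finrank_fin_fun] at h2
  have : ∀ T : Finset I, RelOpen S {X | X ∈ S ∧ ∀ i ∈ T, cdim J X i ≤ m i} := by
    intro T
    induction T using Finset.induction_on with
    | empty => simpa using RelOpen.refl S
    | insert i T hi ih =>
      convert (key i).inter ih using 1
      ext X
      simp only [Finset.mem_insert, forall_eq_or_imp, Set.mem_ofPred_eq, Set.mem_inter_iff]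
      tauto
  convert this Finset.univ using 1
  ext X
  simp [Pi.le_def]

/-- Assembling degreewise splittings. -/
def asmE (Φ : (i : I) → (Fin (ν i) → ℂ) ≃ₗ[ℂ] (Fin (ν2 i) → ℂ) × (Fin (ν1 i) → ℂ)) :
    Vec ν ≃ₗ[ℂ] Vec ν2 × Vec ν1 where
  toFun v := (fun i => (Φ i (v i)).1, fun i => (Φ i (v i)).2)
  invFun w := fun i => (Φ i).symm (w.1 i, w.2 i)
  map_add' v w := by ext <;> simp
  map_smul' c v := by ext <;> simp
  left_inv v := by ext; simp
  right_inv w := by ext <;> simp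

variable (Φ : (i : I) → (Fin (ν i) → ℂ) ≃ₗ[ℂ] (Fin (ν2 i) → ℂ) × (Fin (ν1 i) → ℂ))

theorem asmE_graded (i : I) (v : Vec ν) : asmE Φ (pr ν i v) = prProd ν2 ν1 i (asmE Φ v) := by
  have h : ∀ j, pr ν i v j = if j = i then v j else 0 := by
    intro j
    split_ifs with h
    · subst h; exact pr_apply_self ν j v
    · exact pr_apply_ne ν h v
  refine Prod.ext (funext fun j => ?_) (funext fun j => ?_)
  · change (Φ j (pr ν i v j)).1 = pr ν2 i (asmE Φ v).1 j
    by_cases hj : j = i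
    · subst hj; rw [pr_apply_self, pr_apply_self]; rfl
    · rw [pr_apply_ne _ hj, pr_apply_ne _ hj]; simp
  · change (Φ j (pr ν i v j)).2 = pr ν1 i (asmE Φ v).2 j
    by_cases hj : j = i
    · subst hj; rw [pr_apply_self, pr_apply_self]; rfl
    · rw [pr_apply_ne _ hj, pr_apply_ne _ hj]; simp

theorem asmE_symm_graded (i : I) (v : Vec ν2 × Vec ν1) :
    (asmE Φ).symm (prProd ν2 ν1 i v) = pr ν i ((asmE Φ).symm v) := by
  rw [LinearEquiv.symm_apply_eq, asmE_graded, LinearEquiv.apply_symm_apply]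

variable (J μ2 μ1) in
/-- The part of a stratum where the core is transverse to a fixed complement. -/
def chart : Set (Quad H (Vec ν) (Vec μ2) (Vec μ1)) :=
  {X | X ∈ stratum s t bar eps J μ2 μ1 ν ν2 ∧
    ∀ v ∈ coreJ J (pr ν) X.1 X.2.2.2, (asmE Φ v).1 = 0 → v = 0}

theorem relOpen_chart : RelOpen (stratum s t bar eps J μ2 μ1 ν ν2) (chart s t bar eps J μ2 μ1 Φ) := by
  set S := stratum s t bar eps J μ2 μ1 ν ν2
  have hT : RegMap S (fun X => (LinearMap.inl ℂ _ (Vec ν2) ∘ₗ testMap J (pr ν) X.1 X.2.2.2 +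
      LinearMap.inr ℂ _ (Vec ν2) ∘ₗ LinearMap.fst ℂ _ _ ∘ₗ (asmE Φ).toLinearMap)) :=
    ((regMap_const _ _).lcomp (RegMap.testMap J _ (regMap_id S).fst (regMap_id S).snd.snd.snd)).add
      (regMap_const _ _)
  convert relOpen_injective hT using 1
  ext X
  simp only [chart, Set.mem_ofPred_eq]
  refine and_congr_right fun hX => ?_
  rw [← LinearMap.ker_eq_bot, LinearMap.ker_eq_bot']
  refine forall_congr' fun v => ?_
  rw [← testMap_eq_zero (isGrading_pr ν) hX.1.2.2.2.2.2.1]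
  simp

theorem trQ_mem_graphSet {X : Quad H (Vec ν) (Vec μ2) (Vec μ1)}
    (hX : X ∈ chart s t bar eps J μ2 μ1 Φ) :
    trQ (asmE Φ) X ∈ graphSet s t bar eps J μ2 μ1 ν2 ν1 := by
  obtain ⟨⟨hX, hd⟩, hinj⟩ := hX
  refine ⟨trQ_mem s t bar eps (asmE_graded Φ) hX, ?_⟩
  set K := coreJ J (pr ν) X.1 X.2.2.2
  let A : K →ₗ[ℂ] Vec ν2 := LinearMap.fst ℂ _ _ ∘ₗ (asmE Φ).toLinearMap ∘ₗ K.subtype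
  have hA : Function.Injective A := by
    rw [← LinearMap.ker_eq_bot, LinearMap.ker_eq_bot']
    intro v hv
    exact Subtype.ext (hinj v v.2 hv)
  have hA' : Function.Surjective A := by
    intro w
    have h1 : ∀ i, ∃ v ∈ coreAt J X i, (Φ i v).1 = w i := by
      intro i
      let B : coreAt J X i →ₗ[ℂ] (Fin (ν2 i) → ℂ) :=
        LinearMap.fst ℂ _ _ ∘ₗ (Φ i).toLinearMap ∘ₗ (coreAt J X i).subtype
      have hB : Function.Injective B := by
        rw [← LinearMap.ker_eq_bot, LinearMap.ker_eq_bot']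
        intro v hv
        have h2 := hinj _ v.2 (by
          funext j
          change (Φ j ((Pi.single i v.1 : Vec ν) j)).1 = 0
          by_cases hj : j = i
          · subst hj; rw [Pi.single_eq_same]; exact hv
          · rw [Pi.single_eq_of_ne hj]; simp)
        have h3 := congrFun h2 i
        rw [LinearMap.single_apply, Pi.single_eq_same] at h3
        exact Subtype.ext h3
      have hB' := (LinearMap.injective_iff_surjective_of_finrank_eq_finrank (f := B)
        (by rw [Module.finrank_fin_fun]; exact congrFun hd i)).1 hB
      obtain ⟨v, hv⟩ := hB' (w i)
      exact ⟨v, v.2, hv⟩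
    choose v hv hv' using h1
    exact ⟨⟨v, (mem_core_iff s t bar eps hX v).2 hv⟩, funext hv'⟩
  let e := LinearEquiv.ofBijective A ⟨hA, hA'⟩
  refine ⟨LinearMap.snd ℂ _ _ ∘ₗ (asmE Φ).toLinearMap ∘ₗ K.subtype ∘ₗ e.symm.toLinearMap, fun v => ?_⟩
  obtain ⟨v, rfl⟩ := (asmE Φ).surjective v
  rw [mem_coreJ_trQ (asmE_graded Φ)]
  have he : ∀ w : K, e.symm ((asmE Φ w.1).1) = w := fun w => by
    rw [LinearEquiv.symm_apply_eq]; rfl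
  constructor
  · intro hv
    simp [he ⟨v, hv⟩]
  · intro hv
    obtain ⟨w, hw⟩ := hA' (asmE Φ v).1
    have h1 : e.symm (asmE Φ v).1 = w := by rw [LinearEquiv.symm_apply_eq]; exact hw.symm
    have : v = w := by
      apply (asmE Φ).injective
      refine Prod.ext hw.symm (hv.trans ?_)
      simp [h1]
    rw [this]
    exact w.2

theorem trQ_mem_chart {Y : Quad H (Vec ν2 × Vec ν1) (Vec μ2) (Vec μ1)}
    (hY : Y ∈ graphSet s t bar eps J μ2 μ1 ν2 ν1) :
    trQ (asmE Φ).symm Y ∈ chart s t bar eps J μ2 μ1 Φ := by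
  obtain ⟨hY, u, hu⟩ := hY
  have hX := trQ_mem s t bar eps (asmE_symm_graded Φ) hY
  have hc : ∀ v, v ∈ coreJ J (pr ν) (trQ (asmE Φ).symm Y).1 (trQ (asmE Φ).symm Y).2.2.2 ↔
      (asmE Φ v).2 = u (asmE Φ v).1 := by
    intro v
    obtain ⟨w, rfl⟩ := (asmE Φ).symm.surjective v
    rw [mem_coreJ_trQ (asmE_symm_graded Φ), hu, LinearEquiv.apply_symm_apply]
  have hinj : ∀ v ∈ coreJ J (pr ν) (trQ (asmE Φ).symm Y).1 (trQ (asmE Φ).symm Y).2.2.2,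
      (asmE Φ v).1 = 0 → v = 0 := by
    intro v hv h0
    rw [hc, h0, map_zero] at hv
    exact (map_eq_zero_iff _ (asmE Φ).injective).1 (Prod.ext h0 hv)
  refine ⟨⟨hX, funext fun i => ?_⟩, hinj⟩
  let B : coreAt J (trQ (asmE Φ).symm Y) i →ₗ[ℂ] (Fin (ν2 i) → ℂ) :=
    LinearMap.fst ℂ _ _ ∘ₗ (Φ i).toLinearMap ∘ₗ (coreAt J (trQ (asmE Φ).symm Y) i).subtype
  have hB : Function.Injective B := by
    rw [← LinearMap.ker_eq_bot, LinearMap.ker_eq_bot']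
    intro v hv
    have h2 := hinj _ v.2 (by
      funext j
      change (Φ j ((Pi.single i v.1 : Vec ν) j)).1 = 0
      by_cases hj : j = i
      · subst hj; rw [Pi.single_eq_same]; exact hv
      · rw [Pi.single_eq_of_ne hj]; simp)
    have h3 := congrFun h2 i
    rw [LinearMap.single_apply, Pi.single_eq_same] at h3
    exact Subtype.ext h3
  have hB' : Function.Surjective B := by
    intro w
    let v := (asmE Φ).symm (Pi.single i w, u (Pi.single i w))
    have hv : v ∈ coreJ J (pr ν) (trQ (asmE Φ).symm Y).1 (trQ (asmE Φ).symm Y).2.2.2 := by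
      rw [hc, LinearEquiv.apply_symm_apply]
    refine ⟨⟨v i, (mem_core_iff s t bar eps hX v).1 hv i⟩, ?_⟩
    change (asmE Φ v).1 i = w
    rw [LinearEquiv.apply_symm_apply]
    simp
  exact (LinearEquiv.ofBijective B ⟨hB, hB'⟩).finrank_eq.trans (Module.finrank_fin_fun ℂ)

/-- A chart is isomorphic to the graph locus. -/
def chartIso : RIso (chart s t bar eps J μ2 μ1 Φ) (graphSet s t bar eps J μ2 μ1 ν2 ν1) where
  f := trQ (asmE Φ)
  g := trQ (asmE Φ).symm
  rf := RegMap.trQ (regMap_const _ _) (regMap_const _ _) (regMap_id _)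
  rg := RegMap.trQ (regMap_const _ _) (regMap_const _ _) (regMap_id _)
  mf _ hX := trQ_mem_graphSet s t bar eps Φ hX
  mg _ hX := trQ_mem_chart s t bar eps Φ hX
  gf _ _ := trQ_symm_trQ _ _
  fg _ _ := trQ_symm_trQ (asmE Φ).symm _

end Chart

section Affine

variable {M : Type} [AddCommGroup M] [Module ℂ M]

theorem Irr.comps_eq_singleton {S : Set M} (h : Irr S) : comps S = {S} := by
  ext C
  rw [Set.mem_singleton_iff]
  constructor
  · intro hC
    exact (comps_eq hC h subset_rfl (comps_subset hC)).symm
  · rintro rfl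
    exact ⟨⟨subset_rfl, h⟩, fun D hD _ => hD.1⟩

theorem ncard_comps_submodule [FiniteDimensional ℂ M] (W : Submodule ℂ M) :
    (comps (W : Set M)).ncard = 1 := by
  rw [(irr_submodule W).comps_eq_singleton, Set.ncard_singleton]

theorem pureDim_submodule [FiniteDimensional ℂ M] (W : Submodule ℂ M) :
    PureDim (W : Set M) (Module.finrank ℂ W) := by
  intro C hC
  rw [(irr_submodule W).comps_eq_singleton, Set.mem_singleton_iff] at hC
  rw [hC, zd_submodule]

end Affine

section Strata

variable {I H : Type} [Fintype I] [DecidableEq I] [Fintype H] (s t : H → I) (bar : H → H) (eps : H → ℤ)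

variable {J : Set I} {μ2 μ1 ν ν2 ν1 : I → ℕ}

theorem exists_generic_chart (hν : ∀ i, ν i = ν2 i + ν1 i) :
    ∃ Φ : (i : I) → (Fin (ν i) → ℂ) ≃ₗ[ℂ] (Fin (ν2 i) → ℂ) × (Fin (ν1 i) → ℂ),
      ∀ C ∈ comps (stratum s t bar eps J μ2 μ1 ν ν2), (C ∩ chart s t bar eps J μ2 μ1 Φ).Nonempty := by
  set S := stratum s t bar eps J μ2 μ1 ν ν2
  have h0 : ∀ C : Set (Quad H (Vec ν) (Vec μ2) (Vec μ1)), ∃ X, C ∈ comps S → X ∈ C := by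
    intro C
    by_cases hC : C ∈ comps S
    · obtain ⟨X, hX⟩ := (comps_irr hC).1
      exact ⟨X, fun _ => hX⟩
    · exact ⟨0, fun h => absurd h hC⟩
  choose P hP using h0
  have h1 : ∀ i, ∃ Φ : (Fin (ν i) → ℂ) ≃ₗ[ℂ] (Fin (ν2 i) → ℂ) × (Fin (ν1 i) → ℂ),
      ∀ C ∈ comps S, ∀ v ∈ coreAt J (P C) i, (Φ v).1 = 0 → v = 0 := by
    intro i
    obtain ⟨Φ, hΦ⟩ := exists_generic_equiv (V := Fin (ν i) → ℂ) (a := ν2 i) (b := ν1 i)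
      (by rw [Module.finrank_fin_fun, hν])
      ((comps_finite S).toFinset.image fun C => coreAt J (P C) i) (by
        intro K hK
        obtain ⟨C, hC, rfl⟩ := Finset.mem_image.1 hK
        rw [Set.Finite.mem_toFinset] at hC
        exact congrFun (comps_subset hC (hP C hC)).2 i)
    exact ⟨Φ, fun C hC => hΦ _ (Finset.mem_image_of_mem _ ((comps_finite S).mem_toFinset.2 hC))⟩
  choose Φ hΦ using h1
  refine ⟨Φ, fun C hC => ⟨P C, hP C hC, comps_subset hC (hP C hC), fun v hv h => funext fun i => ?_⟩⟩
  have hS := (comps_subset hC (hP C hC)).1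
  exact hΦ i C hC (v i) ((mem_core_iff s t bar eps hS v).1 hv i) (congrFun h i)

variable (hsbar : ∀ h, s (bar h) = t h) (htbar : ∀ h, t (bar h) = s h) (hbb : ∀ h, bar (bar h) = h)
  (heps : ∀ h, eps h = 1 ∨ eps h = -1) (hepsbar : ∀ h, eps h + eps (bar h) = 0)

include hsbar htbar hbb heps hepsbar

theorem ncard_comps_stratum (hν : ∀ i, ν i = ν2 i + ν1 i) (hJ : ∀ i ∉ J, ν2 i = 0) :
    (comps (stratum s t bar eps J μ2 μ1 ν ν2)).ncard =
      (comps (LJs s t bar eps J ν1 μ1)).ncard * (comps (LSet s t bar eps ν2 μ2)).ncard := by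
  obtain ⟨Φ, hΦ⟩ := exists_generic_chart s t bar eps (J := J) (μ2 := μ2) (μ1 := μ1) hν
  rw [← (comps_relOpen_meets (relOpen_chart s t bar eps Φ) hΦ).1,
    ← (chartIso s t bar eps Φ).ncard_comps, (graphIso s t bar eps).ncard_comps,
    ncard_comps_prod, ncard_comps_submodule, mul_one,
    (adaptedIso s t bar eps hsbar htbar hbb hepsbar hJ).ncard_comps,
    ncard_comps_bundle (regMap_offEq s t bar eps _) fun z hz =>
      offEq_surjective s t bar eps hsbar htbar hbb heps hJ hz, ncard_comps_prod]

theorem pureDim_stratum (hν : ∀ i, ν i = ν2 i + ν1 i) (hJ : ∀ i ∉ J, ν2 i = 0) {d1 d2 : ℕ}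
    (h1 : PureDim (LJs s t bar eps J ν1 μ1) d1) (h2 : PureDim (LSet s t bar eps ν2 μ2) d2) :
    PureDim (stratum s t bar eps J μ2 μ1 ν ν2)
      (d1 + d2 + ∑ h, ν1 (s h) * ν2 (t h) + ∑ i, ν2 i * μ1 i + ∑ i, ν1 i * μ2 i) := by
  obtain ⟨Φ, hΦ⟩ := exists_generic_chart s t bar eps (J := J) (μ2 := μ2) (μ1 := μ1) hν
  intro K hK
  obtain ⟨X, -, hX⟩ := hΦ K hK
  have hB := ((adaptedIso s t bar eps hsbar htbar hbb hepsbar hJ).mg _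
    ((graphIso s t bar eps).mg _ ((chartIso s t bar eps Φ).mf X hX)).1).1
  have hs := fun z hz => offEq_surjective s t bar eps (μ2 := μ2) (μ1 := μ1) (ν1 := ν1) hsbar htbar
    hbb heps hJ (z := z) hz
  have hle := LinearMap.finrank_le_finrank_of_surjective (hs _ hB)
  have hF : ∀ a b : I → ℕ, Module.finrank ℂ (HomG a b) = ∑ i, a i * b i := by
    intro a b
    simp [HomG, Module.finrank_pi_fintype, Module.finrank_linearMap]
  have hN : Module.finrank ℂ (OffDiag s t μ2 μ1 ν2 ν1) = ∑ h, ν1 (s h) * ν2 (t h) +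
      (∑ i, ν2 i * μ1 i + ∑ i, ν1 i * μ2 i) := by
    simp only [OffDiag, Module.finrank_prod, hF]
    congr 1
    · simp [Module.finrank_pi_fintype, Module.finrank_linearMap]
    · simp only [mul_comm]
  rw [hF, hN] at hle
  have hb := (h1.prod h2).bundle (regMap_offEq s t bar eps _) hs
    (d' := d1 + d2 + (∑ h, ν1 (s h) * ν2 (t h) + (∑ i, ν2 i * μ1 i + ∑ i, ν1 i * μ2 i)) -
      ∑ i, ν1 i * ν2 i) (by rw [hF, hN]; omega)
  have hg := (graphIso s t bar eps).pure
    (((adaptedIso s t bar eps hsbar htbar hbb hepsbar hJ).pure hb).prod (pureDim_submodule ⊤))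
  have hc := (chartIso s t bar eps Φ).symm.pure hg
  have := (comps_relOpen_meets (relOpen_chart s t bar eps Φ) hΦ).2 _ hc K hK
  rw [this, finrank_top, hF]
  have hm : ∑ i, ν2 i * ν1 i = ∑ i, ν1 i * ν2 i := Finset.sum_congr rfl fun i _ => mul_comm _ _
  rw [hm]
  congr 1
  omega

end Strata

theorem Nilp.exists_killed {H V : Type} [AddCommGroup V] [Module ℂ V] {x : H → Module.End ℂ V}
    (hx : Nilp x) {U : Submodule ℂ V} (hU : ∀ h, ∀ v ∈ U, x h v ∈ U) (hne : U ≠ ⊥) :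
    ∃ v ∈ U, v ≠ 0 ∧ ∀ h, x h v = 0 := by
  obtain ⟨n, hn⟩ := hx
  by_contra! hc
  apply hne
  rw [Submodule.eq_bot_iff]
  have key : ∀ m, ∀ v ∈ U, (∀ l : List H, l.length = m → (l.map x).prod v = 0) → v = 0 := by
    intro m
    induction m with
    | zero => intro v _ h; simpa using h [] rfl
    | succ m ih =>
      intro v hv h
      by_contra h0
      obtain ⟨a, ha⟩ := hc v hv h0
      refine ha (ih _ (hU a v hv) fun l hl => ?_)
      simpa using h (l ++ [a]) (by simp [hl])
  exact fun v hv => key n v hv fun l hl => by rw [hn l hl, LinearMap.zero_apply]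

section Lagrangian

variable {I H : Type} [Fintype I] [DecidableEq I] [Fintype H] (s t : H → I) (bar : H → H) (eps : H → ℤ)

theorem LsSet_eq (ν μ : I → ℕ) : LsSet s t bar eps ν μ = LJs s t bar eps Set.univ ν μ := by
  ext X
  refine and_congr_right fun hX => ?_
  have hgr := gr_comm s t (isGrading_pr ν) hX.1.1
  constructor
  · intro h
    by_contra hne
    obtain ⟨v, hv, hv0, hvx⟩ := Nilp.exists_killed hX.1.2.2 (fun h v hv => coreJ_inv hv h) hne
    refine hv0 ?_
    rw [← (isGrading_pr ν).total v]
    refine Finset.sum_eq_zero fun i _ => ?_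
    refine h i _ ((isGrading_pr ν).idem i v) ?_ fun a _ => ?_
    · exact coreJ_apply (coreJ_graded s t (isGrading_pr ν) hX.1.1 hX.2 hv i)
    · rw [hgr, hvx, ite_self]
  · intro h i u hu hq hxu
    have hle : Submodule.span ℂ {u} ≤ coreJ Set.univ (pr ν) X.1 X.2 := by
      refine le_coreJ (fun a v hv => ?_) (fun v hv => ?_) fun j hj => absurd (Set.mem_univ j) hj
      · obtain ⟨c, rfl⟩ := Submodule.mem_span_singleton.1 hv
        have : X.1 a u = 0 := by
          by_cases hi : s a = i
          · exact hxu a hi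
          · rw [← hu, hgr, if_neg (Ne.symm hi)]
        rw [map_smul, this, smul_zero]
        exact Submodule.zero_mem _
      · obtain ⟨c, rfl⟩ := Submodule.mem_span_singleton.1 hv
        rw [map_smul, hq, smul_zero]
    rw [h, le_bot_iff, Submodule.span_singleton_eq_bot] at hle
    exact hle

theorem relOpen_LJs (J : Set I) (ν μ : I → ℕ) :
    RelOpen (LSet s t bar eps ν μ) (LJs s t bar eps J ν μ) := by
  have hT : RegMap (LSet s t bar eps ν μ) (fun X => testMap J (pr ν) X.1 X.2) :=
    RegMap.testMap J _ (regMap_id _).fst (regMap_id _).snd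
  convert relOpen_injective hT using 1
  ext X
  refine and_congr_right fun hX => ?_
  rw [← LinearMap.ker_eq_bot, LinearMap.ker_eq_bot', Submodule.eq_bot_iff]
  exact forall_congr' fun v => by rw [← testMap_eq_zero (isGrading_pr ν) hX.1.2.2]

theorem LSet_eq_prod (ν μ : I → ℕ) :
    LSet s t bar eps ν μ = ΛV s t bar eps ν ×ˢ (LinearMap.range (asmG ν μ) : Set (Vec ν →ₗ[ℂ] Vec μ)) := by
  ext X
  refine and_congr_right fun _ => ?_
  constructor
  · exact fun h => ⟨_, asmG_disG h⟩
  · rintro ⟨f, hf⟩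
    rw [← hf]
    exact gradedHom_asmG f

/-- Half the dimension of the space of representations of the double quiver. -/
def halfDim (ν : I → ℕ) : ℕ := ∑ h with eps h = 1, ν (s h) * ν (t h)

theorem pureDim_LSet {ν : I → ℕ} (h : PureDim (ΛV s t bar eps ν) (halfDim s t eps ν)) (μ : I → ℕ) :
    PureDim (LSet s t bar eps ν μ) (halfDim s t eps ν + ∑ i, ν i * μ i) := by
  have h1 := pureDim_submodule (LinearMap.range (asmG ν μ))
  rw [LinearMap.finrank_range_of_inj (Function.LeftInverse.injective disG_asmG)] at h1
  have h2 : Module.finrank ℂ (HomG ν μ) = ∑ i, ν i * μ i := by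
    simp [HomG, Module.finrank_pi_fintype, Module.finrank_linearMap]
  rw [LSet_eq_prod]
  rw [h2] at h1
  exact h.prod h1

variable {s t bar eps}
variable (hsbar : ∀ h, s (bar h) = t h) (htbar : ∀ h, t (bar h) = s h) (hbb : ∀ h, bar (bar h) = h)
  (heps : ∀ h, eps h = 1 ∨ eps h = -1) (hepsbar : ∀ h, eps h + eps (bar h) = 0)
  (hloop : ∀ h, s h ≠ t h)

include hsbar htbar hbb heps hepsbar

omit [Fintype I] [DecidableEq I] in
theorem sum_split (a b : I → ℕ) : ∑ h, a (s h) * b (t h) =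
    (∑ h with eps h = 1, a (s h) * b (t h)) + ∑ h with eps h = 1, b (s h) * a (t h) := by
  rw [← Finset.sum_filter_add_sum_filter_not Finset.univ (fun h => eps h = 1)]
  congr 1
  refine Finset.sum_nbij' bar bar ?_ ?_ (fun h _ => hbb h) (fun h _ => hbb h) ?_
  · intro h hh
    have := heps h
    have := hepsbar h
    simp only [Finset.mem_filter, Finset.mem_univ, true_and] at hh ⊢
    omega
  · intro h hh
    have := hepsbar h
    simp only [Finset.mem_filter, Finset.mem_univ, true_and] at hh ⊢
    omega
  · intro h _
    rw [hsbar, htbar, mul_comm]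

omit [Fintype I] [DecidableEq I] in
theorem two_mul_halfDim (ν : I → ℕ) : 2 * halfDim s t eps ν = ∑ h, ν (s h) * ν (t h) := by
  rw [sum_split hsbar htbar hbb heps hepsbar, halfDim, two_mul]

omit [Fintype I] [DecidableEq I] in
theorem halfDim_add {ν ν1 ν2 : I → ℕ} (hν : ∀ i, ν i = ν2 i + ν1 i) :
    halfDim s t eps ν = halfDim s t eps ν1 + halfDim s t eps ν2 + ∑ h, ν1 (s h) * ν2 (t h) := by
  rw [sum_split hsbar htbar hbb heps hepsbar, halfDim, halfDim, halfDim, ← Finset.sum_add_distrib,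
    ← Finset.sum_add_distrib, ← Finset.sum_add_distrib]
  refine Finset.sum_congr rfl fun h _ => ?_
  rw [hν, hν]
  ring

theorem pureDim_stratum' {J : Set I} {μ2 μ1 ν ν2 ν1 : I → ℕ} (hν : ∀ i, ν i = ν2 i + ν1 i)
    (hJ : ∀ i ∉ J, ν2 i = 0)
    (h1 : PureDim (ΛV s t bar eps ν1) (halfDim s t eps ν1))
    (h2 : PureDim (ΛV s t bar eps ν2) (halfDim s t eps ν2)) :
    PureDim (stratum s t bar eps J μ2 μ1 ν ν2)
      (halfDim s t eps ν + ∑ i, ν i * (μ2 i + μ1 i)) := by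
  have := pureDim_stratum s t bar eps (J := J) (μ2 := μ2) (μ1 := μ1) hsbar htbar hbb heps hepsbar hν hJ
    ((pureDim_LSet s t bar eps h1 μ1).relOpen (relOpen_LJs s t bar eps J ν1 μ1))
    (pureDim_LSet s t bar eps h2 μ2)
  convert this using 1
  have h3 : ∑ i, ν i * (μ2 i + μ1 i) = ∑ i, ν1 i * μ1 i + ∑ i, ν2 i * μ2 i + ∑ i, ν2 i * μ1 i +
      ∑ i, ν1 i * μ2 i := by
    simp only [← Finset.sum_add_distrib]
    refine Finset.sum_congr rfl fun i _ => ?_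
    rw [hν]
    ring
  rw [halfDim_add hsbar htbar hbb heps hepsbar hν, h3]
  ring

omit hsbar htbar hbb heps hepsbar in
theorem exists_cdim_single {ν : I → ℕ} {μ2 μ1 : I → ℕ} {i0 : I} (hi0 : ν i0 ≠ 0)
    {X : Quad H (Vec ν) (Vec μ2) (Vec μ1)} (hX : X.1 ∈ ΛV s t bar eps ν) (hq : X.2.2.2 = 0) :
    ∃ i, 1 ≤ cdim {i} X i ∧ cdim {i} X = Pi.single i (cdim {i} X i) := by
  have hne : (⊤ : Submodule ℂ (Vec ν)) ≠ ⊥ := by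
    intro h
    have h1 : (Pi.single i0 (fun _ => 1) : Vec ν) = 0 := by
      rw [← Submodule.mem_bot ℂ, ← h]; trivial
    have h2 := congrFun (congrFun h1 i0) ⟨0, Nat.pos_of_ne_zero hi0⟩
    rw [Pi.single_eq_same] at h2
    exact one_ne_zero h2
  obtain ⟨v, -, hv0, hvx⟩ := Nilp.exists_killed hX.2.2 (U := ⊤) (fun _ _ _ => trivial) hne
  obtain ⟨i, hi⟩ : ∃ i, v i ≠ 0 := Function.ne_iff.1 hv0
  have hu : pr ν i v ∈ coreJ {i} (pr ν) X.1 X.2.2.2 := by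
    refine le_coreJ (U := Submodule.span ℂ {pr ν i v}) ?_ ?_ ?_ (Submodule.mem_span_singleton_self _)
    · intro a w hw
      obtain ⟨c, rfl⟩ := Submodule.mem_span_singleton.1 hw
      rw [map_smul, gr_comm s t (isGrading_pr ν) hX.1, hvx, ite_self, smul_zero]
      exact Submodule.zero_mem _
    · intro w _; rw [hq, LinearMap.zero_apply]
    · intro j hj w hw
      obtain ⟨c, rfl⟩ := Submodule.mem_span_singleton.1 hw
      rw [map_smul, (isGrading_pr ν).orth j i hj, smul_zero]
  refine ⟨i, ?_, ?_⟩
  · rw [Nat.one_le_iff_ne_zero, cdim, Ne, Submodule.finrank_eq_zero, Submodule.eq_bot_iff]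
    exact fun h => hi (h (v i) hu)
  · funext j
    by_cases hj : j = i
    · subst hj; rw [Pi.single_eq_same]
    · rw [Pi.single_eq_of_ne hj, cdim, Submodule.finrank_eq_zero, Submodule.eq_bot_iff]
      intro w hw
      have h1 := congrFun (coreJ_proj (i := j) hw hj) j
      rw [pr_apply_self, LinearMap.single_apply, Pi.single_eq_same] at h1
      exact h1

include hloop in
theorem pureDim_ΛV (n : ℕ) : ∀ ν : I → ℕ, ∑ i, ν i = n →
    PureDim (ΛV s t bar eps ν) (halfDim s t eps ν) := by
  induction n using Nat.strong_induction_on with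
  | _ n ih =>
  intro ν hn
  by_cases hsup : ∀ h, ν (s h) * ν (t h) = 0
  · have h1 : ΛV s t bar eps ν = ((⊥ : Submodule ℂ (H → Module.End ℂ (Vec ν))) : Set _) := by
      ext x
      rw [SetLike.mem_coe, Submodule.mem_bot]
      constructor
      · intro hx
        funext h
        have := hx.1 h
        rcases Nat.mul_eq_zero.1 (hsup h) with h0 | h0
        · rw [pr_of_eq_zero h0] at this
          simpa using this.symm
        · rw [pr_of_eq_zero h0] at this
          simpa using this.symm
      · rintro rfl
        refine ⟨fun h => by simp, by simp, 1, fun l hl => ?_⟩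
        obtain ⟨a, rfl⟩ := List.length_eq_one_iff.1 hl
        simp
    have h2 : halfDim s t eps ν = 0 := Finset.sum_eq_zero fun h _ => hsup h
    have := pureDim_submodule (⊥ : Submodule ℂ (H → Module.End ℂ (Vec ν)))
    rwa [finrank_bot, ← h1, ← h2] at this
  · push Not at hsup
    obtain ⟨h0, hh0⟩ := hsup
    have hs0 : ν (s h0) ≠ 0 := left_ne_zero_of_mul hh0
    have ht0 : ν (t h0) ≠ 0 := right_ne_zero_of_mul hh0
    set z : I → ℕ := fun _ => 0
    let S : Set (Quad H (Vec ν) (Vec z) (Vec z)) := {X | X.1 ∈ ΛV s t bar eps ν}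
    have hsub : ∀ X : Quad H (Vec ν) (Vec z) (Vec z), X.2 = 0 := fun X => Subsingleton.elim _ _
    have hS : ∀ i : I, S = PiJ s t bar eps {i} (pr ν) (pr z) (pr z) := by
      intro i
      ext X
      have h1 : X.2.1 = 0 := by rw [hsub]; rfl
      constructor
      · intro hX
        refine ⟨hX.1, fun _ => ?_, fun _ => Subsingleton.elim _ _, fun _ => Subsingleton.elim _ _,
          ?_, hX.2.2, fun d => ?_⟩
        · rw [h1]; simp
        · rw [h1, hX.2.1]; simp
        · rw [h1]; simp
      · intro hX
        refine ⟨hX.1, ?_, hX.2.2.2.2.2.1⟩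
        rw [hX.2.2.2.2.1, h1, LinearMap.zero_comp]
    have key : PureDim S (halfDim s t eps ν) := by
      refine pureDim_of_cover (Finset.univ.sigma fun i => Finset.Icc 1 (ν i))
        (f := fun k => stratum s t bar eps {k.1} z z ν (Pi.single k.1 k.2)) ?_ ?_
      · ext X
        simp only [Set.mem_iUnion, Finset.mem_sigma, Finset.mem_univ, true_and, Finset.mem_Icc]
        constructor
        · intro hX
          obtain ⟨i, h1, h2⟩ := exists_cdim_single hs0 hX (by rw [hsub]; rfl)
          refine ⟨⟨i, cdim {i} X i⟩, ⟨h1, ?_⟩, (hS i) ▸ hX, h2⟩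
          exact (Submodule.finrank_le _).trans_eq (Module.finrank_fin_fun ℂ)
        · rintro ⟨k, -, hX, -⟩
          rw [hS k.1]
          exact hX
      · rintro ⟨i, p⟩ hk
        simp only [Finset.mem_sigma, Finset.mem_univ, true_and, Finset.mem_Icc] at hk
        have hle : ∀ j, (Pi.single i p : I → ℕ) j ≤ ν j := by
          intro j
          by_cases hj : j = i
          · subst hj; rw [Pi.single_eq_same]; exact hk.2
          · rw [Pi.single_eq_of_ne hj]; exact Nat.zero_le _
        have hν : ∀ j, ν j = (Pi.single i p : I → ℕ) j + (ν j - (Pi.single i p : I → ℕ) j) :=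
          fun j => (Nat.add_sub_cancel' (hle j)).symm
        have hsum : n = p + ∑ j, (ν j - (Pi.single i p : I → ℕ) j) := by
          rw [← hn]
          conv_lhs => rw [Finset.sum_congr rfl fun j _ => hν j]
          rw [Finset.sum_add_distrib, Finset.sum_pi_single']
          simp
        have hpn : p < n := by
          obtain ⟨j, hj, hj0⟩ : ∃ j, j ≠ i ∧ ν j ≠ 0 := by
            by_cases hsi : s h0 = i
            · exact ⟨t h0, fun h => hloop h0 (hsi.trans h.symm), ht0⟩
            · exact ⟨s h0, hsi, hs0⟩
          have := Finset.single_le_sum (f := fun j => ν j - (Pi.single i p : I → ℕ) j)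
            (fun _ _ => Nat.zero_le _) (Finset.mem_univ j)
          simp only [Pi.single_eq_of_ne hj] at this
          omega
        have := pureDim_stratum' (J := {i}) (μ2 := z) (μ1 := z) hsbar htbar hbb heps hepsbar hν
          (fun j hj => Pi.single_eq_of_ne hj _)
          (ih _ (by omega) (fun j => ν j - (Pi.single i p : I → ℕ) j) rfl)
          (ih p hpn _ (by simp))
        simpa [z] using this
    have e : RIso S (ΛV s t bar eps ν) :=
      { f := fun X => X.1
        g := fun x => (x, 0)
        rf := (regMap_id _).fst
        rg := (regMap_id _).prodMk (regMap_const _ _)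
        mf := fun X hX => hX
        mg := fun x hx => hx
        gf := fun X _ => Prod.ext rfl (hsub X).symm
        fg := fun x _ => rfl }
    exact e.pure key

end Lagrangian

section ZeroLoci

variable {M N : Type} [AddCommGroup M] [Module ℂ M] [AddCommGroup N] [Module ℂ N]

theorem Rg.eq_zero_of_mem_zcl {S : Set M} {f : M → ℂ} (hf : f ∈ Rg (Set.univ : Set M))
    (h : ∀ y ∈ S, f y = 0) {z : M} (hz : z ∈ zcl S) : f z = 0 := by
  obtain ⟨a, ha, b, hb, hbz, h1⟩ := hf z trivial
  have h2 : (a * b) z = 0 := hz _ (mul_mem ha hb) fun y hy => by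
    by_cases hby : b y = 0
    · simp [hby]
    · have := h1 y trivial hby
      rw [h y hy] at this
      simp [← this]
  have h3 := h1 z trivial hbz
  simp only [Pi.mul_apply, mul_eq_zero, hbz, or_false] at h2
  simpa [h2, hbz] using h3

theorem RegMap.eq_zero_of_mem_zcl {S : Set M} {f : M → N} (hf : RegMap Set.univ f)
    (h : ∀ y ∈ S, f y = 0) {z : M} (hz : z ∈ zcl S) : f z = 0 := by
  rw [← Module.forall_dual_apply_eq_zero_iff ℂ]
  exact fun l => Rg.eq_zero_of_mem_zcl (hf l) (fun y hy => by simp [h y hy]) hz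

theorem RegMap.map_zcl {S : Set M} {T : Set N} {f : M → N} (hf : RegMap Set.univ f)
    (h : ∀ y ∈ S, f y ∈ T) {z : M} (hz : z ∈ zcl S) : f z ∈ zcl T := fun _ ha hT =>
  Rg.eq_zero_of_mem_zcl (hf.comp_poly ha) (fun y hy => hT _ (h y hy)) hz

end ZeroLoci

section Kills

variable {A W : Type} [AddCommGroup W] [Module ℂ W] {f : A → Module.End ℂ W}

/-- All words of length at least `k` annihilate `z`. -/
def Kills (f : A → Module.End ℂ W) (k : ℕ) (z : W) : Prop :=
  ∀ l : List A, k ≤ l.length → (l.map f).prod z = 0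

theorem Kills.mono {k m : ℕ} {z : W} (h : Kills f k z) (hkm : k ≤ m) : Kills f m z :=
  fun l hl => h l (hkm.trans hl)

theorem kills_zero (k : ℕ) : Kills f k 0 := fun _ _ => map_zero _

theorem Kills.add {k : ℕ} {z w : W} (hz : Kills f k z) (hw : Kills f k w) : Kills f k (z + w) :=
  fun l hl => by rw [map_add, hz l hl, hw l hl, add_zero]

theorem kills_succ {k : ℕ} {z : W} (h : ∀ a, Kills f k (f a z)) : Kills f (k + 1) z := by
  intro l hl
  rcases List.eq_nil_or_concat l with rfl | ⟨l, a, rfl⟩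
  · simp at hl
  · have := h a l (by simpa using hl)
    simpa using this

end Kills

section Comparison

variable {I H : Type} [Fintype I] [DecidableEq I] [Fintype H] (s t : H → I) (bar : H → H) (eps : H → ℤ)
  {ν μ2 μ1 : I → ℕ}

omit [Fintype H] [Fintype I] [DecidableEq I] in
theorem mem_D2sub {d : Dsp μ2 μ1} : d ∈ D2sub μ2 μ1 ↔ d.2 = 0 := by
  constructor
  · rintro ⟨w, rfl⟩; rfl
  · exact fun h => ⟨d.1, Prod.ext rfl h.symm⟩

omit [Fintype H] in
omit [Fintype I] in
theorem eD_mem {d : Dsp μ2 μ1} (hd : d ∈ D2sub μ2 μ1) (i : I) : eD μ2 μ1 i d ∈ D2sub μ2 μ1 := by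
  rw [mem_D2sub] at hd ⊢
  simp [eD, hd]

omit [Fintype H] in
omit [Fintype I] in
theorem invCore_eq (x : H → Module.End ℂ (Vec ν)) (q : Vec ν →ₗ[ℂ] Dsp μ2 μ1) :
    invCore x (Submodule.comap q (D2sub μ2 μ1)) =
      coreJ Set.univ (pr ν) x (LinearMap.snd ℂ _ _ ∘ₗ q) := by
  apply le_antisymm
  · refine sSup_le fun U hU => le_coreJ hU.2 (fun v hv => ?_) fun i hi => absurd (Set.mem_univ i) hi
    exact mem_D2sub.1 (hU.1 hv)
  · refine le_sSup ⟨fun v hv => mem_D2sub.2 (coreJ_apply hv), fun h v hv => coreJ_inv hv h⟩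

omit [Fintype H] in
omit [Fintype I] in
theorem invClosure_le_iff (x : H → Module.End ℂ (Vec ν)) (S : Submodule ℂ (Vec ν))
    (q : Vec ν →ₗ[ℂ] Vec μ1) :
    invClosure x S ≤ coreJ Set.univ (pr ν) x q ↔ S ≤ coreJ Set.univ (pr ν) x q := by
  constructor
  · exact fun h => le_trans (le_sInf fun U hU => hU.1) h
  · exact fun h => sInf_le ⟨h, fun a v hv => coreJ_inv hv a⟩

omit [Fintype H] [Fintype I] in
theorem nilp_of_nilpFramed {X : Msp (H := H) ν μ2 μ1} (h : NilpFramed X) : Nilp X.1 := by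
  obtain ⟨n, hn⟩ := h
  refine ⟨n, fun l hl => LinearMap.ext fun v => ?_⟩
  have key : ∀ l : List H, ((l.map Sum.inl).map (edgeMap X)).prod (v, 0) = ((l.map X.1).prod v, 0) := by
    intro l
    induction l with
    | nil => rfl
    | cons a l ih =>
      simp only [List.map_cons, List.prod_cons, Module.End.mul_apply, ih]
      simp [edgeMap]
  have h1 := key l
  rw [hn _ (by simpa using hl)] at h1
  exact (congrArg Prod.fst h1).symm

omit [Fintype H] in
theorem nilpFramed_of_nilp {X : Msp (H := H) ν μ2 μ1} (h : Nilp X.1)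
    (hp : ∀ d, X.2.1 d ∈ coreJ Set.univ (pr ν) X.1 (LinearMap.snd ℂ _ _ ∘ₗ X.2.2))
    (hp2 : ∀ d ∈ D2sub μ2 μ1, X.2.1 d = 0) : NilpFramed X := by
  obtain ⟨N, hN⟩ := h
  have ha : ∀ d ∈ D2sub μ2 μ1, Kills (edgeMap X) 1 (0, d) := by
    refine fun d hd => kills_succ ?_
    rintro (a | i | i)
    · convert kills_zero (f := edgeMap X) 0 using 1
      simp [edgeMap]
    · convert kills_zero (f := edgeMap X) 0 using 1
      simp [edgeMap, hp2 _ (eD_mem hd i)]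
    · convert kills_zero (f := edgeMap X) 0 using 1
      simp [edgeMap]
  have hb : ∀ m, ∀ v ∈ coreJ Set.univ (pr ν) X.1 (LinearMap.snd ℂ _ _ ∘ₗ X.2.2),
      v ∈ wordKer X.1 m → Kills (edgeMap X) (m + 1) (v, 0) := by
    intro m
    induction m with
    | zero =>
      intro v _ hv
      have : v = 0 := by simpa using mem_wordKer.1 hv [] rfl
      subst this
      exact kills_zero _
    | succ m ih =>
      intro v hv hvm
      refine kills_succ ?_
      rintro (a | i | i)
      · convert ih _ (coreJ_inv hv a) (mem_wordKer_succ.1 hvm a) using 1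
        simp [edgeMap]
      · convert kills_zero (f := edgeMap X) (m + 1) using 1
        simp [edgeMap]
      · convert (ha _ (eD_mem (mem_D2sub.2 (coreJ_apply hv)) i)).mono (Nat.le_add_left 1 m) using 1
        simp [edgeMap]
  have hker : ∀ v, v ∈ wordKer X.1 N := fun v => mem_wordKer.2 fun l hl => by
    rw [hN l hl, LinearMap.zero_apply]
  have hc : ∀ d, Kills (edgeMap X) (N + 2) (0, d) := by
    refine fun d => kills_succ ?_
    rintro (a | i | i)
    · convert kills_zero (f := edgeMap X) (N + 1) using 1
      simp [edgeMap]
    · convert hb N _ (hp (eD μ2 μ1 i d)) (hker _) using 1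
      simp [edgeMap]
    · convert kills_zero (f := edgeMap X) (N + 1) using 1
      simp [edgeMap]
  have hd : ∀ m, ∀ v ∈ wordKer X.1 m, Kills (edgeMap X) (N + 2 + m) (v, 0) := by
    intro m
    induction m with
    | zero =>
      intro v hv
      have : v = 0 := by simpa using mem_wordKer.1 hv [] rfl
      subst this
      exact kills_zero _
    | succ m ih =>
      intro v hvm
      refine kills_succ (k := N + 2 + m) ?_
      rintro (a | i | i)
      · convert ih _ (mem_wordKer_succ.1 hvm a) using 1
        simp [edgeMap]
      · convert kills_zero (f := edgeMap X) (N + 2 + m) using 1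
        simp [edgeMap]
      · convert (hc (eD μ2 μ1 i (X.2.2 v))).mono (Nat.le_add_right _ m) using 1
        simp [edgeMap]
  refine ⟨N + 2 + N, fun l hl => LinearMap.ext fun z => ?_⟩
  have hz : z = (z.1, 0) + (0, z.2) := by simp
  rw [hz]
  exact ((hd N z.1 (hker _)).add ((hc z.2).mono (Nat.le_add_right _ _))) l hl.ge

/-- Splitting the framing. -/
def toQuad (X : Msp (H := H) ν μ2 μ1) : Quad H (Vec ν) (Vec μ2) (Vec μ1) :=
  (X.1, X.2.1 ∘ₗ LinearMap.inr ℂ _ _, LinearMap.fst ℂ _ _ ∘ₗ X.2.2, LinearMap.snd ℂ _ _ ∘ₗ X.2.2)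

/-- Reassembling the framing. -/
def ofQuad (X : Quad H (Vec ν) (Vec μ2) (Vec μ1)) : Msp (H := H) ν μ2 μ1 :=
  (X.1, X.2.1 ∘ₗ LinearMap.snd ℂ _ _, LinearMap.inl ℂ _ _ ∘ₗ X.2.2.1 + LinearMap.inr ℂ _ _ ∘ₗ X.2.2.2)

theorem mem_PiSet_iff {X : Msp (H := H) ν μ2 μ1} : X ∈ PiSet s t bar eps ν μ2 μ1 ↔
    toQuad X ∈ PiJ s t bar eps Set.univ (pr ν) (pr μ2) (pr μ1) ∧ X.2.1 ∘ₗ LinearMap.inl ℂ _ _ = 0 := by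
  have hpd : X.2.1 ∘ₗ LinearMap.inl ℂ _ _ = 0 → ∀ d, X.2.1 d = X.2.1 (0, d.2) := by
    intro h d
    have h1 := LinearMap.congr_fun h d.1
    have h2 : d = (d.1, 0) + (0, d.2) := by simp
    conv_lhs => rw [h2, map_add]
    simpa using h1
  constructor
  · rintro ⟨h1, h2, h3, h4, h5, h6, h7⟩
    have h8 : X.2.1 ∘ₗ LinearMap.inl ℂ _ _ = 0 :=
      LinearMap.ext fun w => h7 _ (mem_D2sub.2 rfl)
    rw [invCore_eq, invClosure_le_iff] at h6
    refine ⟨⟨h1, fun i => LinearMap.ext fun d => ?_, fun i => LinearMap.ext fun v => ?_,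
      fun i => LinearMap.ext fun v => ?_, ?_, nilp_of_nilpFramed h5, fun d => h6 ⟨_, rfl⟩⟩, h8⟩
    · have := LinearMap.congr_fun (h2 i) (0, d)
      simpa [toQuad, eD] using this
    · exact congrArg Prod.fst (LinearMap.congr_fun (h3 i) v)
    · exact congrArg Prod.snd (LinearMap.congr_fun (h3 i) v)
    · refine h4.trans (LinearMap.ext fun v => ?_)
      exact hpd h8 _
  · rintro ⟨⟨h1, h2, h3, h4, h5, h6, h7⟩, h8⟩
    have h9 : ∀ d, X.2.1 d ∈ coreJ Set.univ (pr ν) X.1 (LinearMap.snd ℂ _ _ ∘ₗ X.2.2) := by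
      intro d
      rw [hpd h8]
      exact h7 d.2
    have h10 : ∀ d ∈ D2sub μ2 μ1, X.2.1 d = 0 := by
      intro d hd
      rw [hpd h8, mem_D2sub.1 hd]
      exact map_zero _
    refine ⟨h1, fun i => LinearMap.ext fun d => ?_, fun i => LinearMap.ext fun v => ?_, ?_,
      nilpFramed_of_nilp h6 h9 h10, ?_, h10⟩
    · have := LinearMap.congr_fun (h2 i) d.2
      simp only [LinearMap.comp_apply] at this ⊢
      rw [hpd h8 d, hpd h8 (eD μ2 μ1 i d)]
      exact this
    · exact Prod.ext (LinearMap.congr_fun (h3 i) v) (LinearMap.congr_fun (h4 i) v)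
    · refine h5.trans (LinearMap.ext fun v => ?_)
      exact (hpd h8 _).symm
    · rw [invCore_eq, invClosure_le_iff]
      rintro _ ⟨d, rfl⟩
      exact h9 d

omit [Fintype H] [DecidableEq I] [Fintype I] in
theorem toQuad_ofQuad (X : Quad H (Vec ν) (Vec μ2) (Vec μ1)) : toQuad (ofQuad X) = X := by
  refine Prod.ext rfl (Prod.ext ?_ (Prod.ext ?_ ?_)) <;> ext v <;> simp [toQuad, ofQuad]

/-- The tensor product variety in terms of quadruples. -/
def piSetIso : RIso (PiJ s t bar eps Set.univ (pr ν) (pr μ2) (pr μ1)) (PiSet s t bar eps ν μ2 μ1) where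
  f := ofQuad
  g := toQuad
  rf := (regMap_id _).fst.prodMk (((regMap_id _).snd.fst.lcomp (regMap_const _ _)).prodMk
    (((regMap_const _ _).lcomp (regMap_id _).snd.snd.fst).add
      ((regMap_const _ _).lcomp (regMap_id _).snd.snd.snd)))
  rg := (regMap_id _).fst.prodMk (((regMap_id _).snd.fst.lcomp (regMap_const _ _)).prodMk
    (((regMap_const _ _).lcomp (regMap_id _).snd.snd).prodMk
      ((regMap_const _ _).lcomp (regMap_id _).snd.snd)))
  mf X hX := by
    rw [mem_PiSet_iff, toQuad_ofQuad]
    exact ⟨hX, by ext v; simp [ofQuad]⟩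
  mg X hX := ((mem_PiSet_iff s t bar eps).1 hX).1
  gf X _ := toQuad_ofQuad X
  fg X hX := by
    have h := ((mem_PiSet_iff s t bar eps).1 hX).2
    refine Prod.ext rfl (Prod.ext (LinearMap.ext fun d => ?_) (LinearMap.ext fun v => ?_))
    · have h1 := LinearMap.congr_fun h d.1
      have h2 : d = (d.1, 0) + (0, d.2) := by simp
      conv_rhs => rw [h2, map_add]
      simp only [LinearMap.comp_apply, LinearMap.inl_apply, LinearMap.zero_apply] at h1
      rw [h1, zero_add]
      rfl
    · simp [ofQuad, toQuad]

theorem zcl_PiJ : zcl (PiJ s t bar eps Set.univ (pr ν) (pr μ2) (pr μ1)) ⊆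
    PiJ s t bar eps Set.univ (pr ν) (pr μ2) (pr μ1) := by
  intro z hz
  have hx : ∀ h, RegMap (Set.univ : Set (Quad H (Vec ν) (Vec μ2) (Vec μ1))) (fun X => X.1 h) :=
    fun h => (regMap_id _).fst.proj h
  have hp : RegMap (Set.univ : Set (Quad H (Vec ν) (Vec μ2) (Vec μ1))) (fun X => X.2.1) :=
    (regMap_id _).snd.fst
  have hq2 : RegMap (Set.univ : Set (Quad H (Vec ν) (Vec μ2) (Vec μ1))) (fun X => X.2.2.1) :=
    (regMap_id _).snd.snd.fst
  have hq1 : RegMap (Set.univ : Set (Quad H (Vec ν) (Vec μ2) (Vec μ1))) (fun X => X.2.2.2) :=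
    (regMap_id _).snd.snd.snd
  have hw := fun l : List H => RegMap.word (regMap_id
    (Set.univ : Set (Quad H (Vec ν) (Vec μ2) (Vec μ1)))).fst l
  refine ⟨fun h => ?_, fun i => ?_, fun i => ?_, fun i => ?_, ?_,
    ⟨Module.finrank ℂ (Vec ν), fun l hl => ?_⟩, fun d => ?_⟩
  · refine sub_eq_zero.1 (RegMap.eq_zero_of_mem_zcl (((regMap_const _ (pr ν (t h))).lcomp
      ((hx h).lcomp (regMap_const _ (pr ν (s h))))).sub (hx h)) (fun X hX => ?_) hz)
    exact sub_eq_zero.2 (hX.1 h)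
  · refine sub_eq_zero.1 (RegMap.eq_zero_of_mem_zcl (((regMap_const _ (pr ν i)).lcomp hp).sub
      (hp.lcomp (regMap_const _ (pr μ1 i)))) (fun X hX => ?_) hz)
    exact sub_eq_zero.2 (hX.2.1 i)
  · refine sub_eq_zero.1 (RegMap.eq_zero_of_mem_zcl (((regMap_const _ (pr μ2 i)).lcomp hq2).sub
      (hq2.lcomp (regMap_const _ (pr ν i)))) (fun X hX => ?_) hz)
    exact sub_eq_zero.2 (hX.2.2.1 i)
  · refine sub_eq_zero.1 (RegMap.eq_zero_of_mem_zcl (((regMap_const _ (pr μ1 i)).lcomp hq1).sub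
      (hq1.lcomp (regMap_const _ (pr ν i)))) (fun X hX => ?_) hz)
    exact sub_eq_zero.2 (hX.2.2.2.1 i)
  · refine sub_eq_zero.1 (RegMap.eq_zero_of_mem_zcl ((RegMap.sum Finset.univ fun h _ =>
      RegMap.zsmul (eps h) ((hx h).lmul (hx (bar h)))).sub (hp.lcomp hq1)) (fun X hX => ?_) hz)
    exact sub_eq_zero.2 hX.2.2.2.2.1
  · refine RegMap.eq_zero_of_mem_zcl (hw l) (fun X hX => ?_) hz
    exact Nilp.word_eq_zero hX.2.2.2.2.2.1 hl.ge
  · rw [mem_coreJ]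
    refine fun l => ⟨?_, fun i hi => absurd (Set.mem_univ i) hi⟩
    have h1 := RegMap.eq_zero_of_mem_zcl (hq1.lcomp ((hw l).lcomp hp)) (fun X hX => ?_) hz
    · exact LinearMap.congr_fun h1 d
    · exact LinearMap.ext fun d => ((mem_coreJ.1 (hX.2.2.2.2.2.2 d)) l).1

theorem zcl_PiSet : zcl (PiSet s t bar eps ν μ2 μ1) ⊆ PiSet s t bar eps ν μ2 μ1 := by
  intro z hz
  rw [mem_PiSet_iff]
  constructor
  · refine zcl_PiJ s t bar eps (RegMap.map_zcl (f := toQuad) ?_ (fun X hX =>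
      ((mem_PiSet_iff s t bar eps).1 hX).1) hz)
    exact (regMap_id _).fst.prodMk (((regMap_id _).snd.fst.lcomp (regMap_const _ _)).prodMk
      (((regMap_const _ _).lcomp (regMap_id _).snd.snd).prodMk
        ((regMap_const _ _).lcomp (regMap_id _).snd.snd)))
  · refine RegMap.eq_zero_of_mem_zcl ((regMap_id _).snd.fst.lcomp (regMap_const _ _)) (fun X hX => ?_) hz
    exact ((mem_PiSet_iff s t bar eps).1 hX).2

end Comparison

end

noncomputable section
open scoped Classical

variable {I H : Type} [Fintype I] [DecidableEq I] [Fintype H]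
variable (s t : H → I) (bar : H → H) (eps : H → ℤ)

/-- The tensor product variety `Π_{V,D•}` is pure-dimensional of dimension
`(1/2)·dim E(V,D)`, and the number of its irreducible components equals
`Σ # Irr(L^s_{V¹,D¹} × L_{V²,D²})`, summed over pairs `(ν¹,ν²)` of dimension
vectors with `ν¹ + ν² = dim V`. -/
theorem piSet_pure_dimensional_and_card_irr
    (hbarbar : ∀ h, bar (bar h) = h)
    (hsbar : ∀ h, s (bar h) = t h) (htbar : ∀ h, t (bar h) = s h)
    (hloopless : ∀ h, s h ≠ t h)
    (heps : ∀ h, eps h = 1 ∨ eps h = -1)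
    (hepsbar : ∀ h, eps h + eps (bar h) = 0)
    (ν μ2 μ1 : I → ℕ) :
    (∃ e : ℕ,
        2 * e = (∑ h : H, ν (s h) * ν (t h)) + 2 * ∑ i : I, ν i * (μ2 i + μ1 i) ∧
        ∀ C ∈ zIrr (PiSet s t bar eps ν μ2 μ1), zDimC C = (e : WithBot ℕ∞)) ∧
    (zIrr (PiSet s t bar eps ν μ2 μ1)).ncard =
      ∑ f : (i : I) → Fin (ν i + 1),
        zIrrProdCount
          (LsSet s t bar eps (fun i => (f i : ℕ)) μ1)
          (LSet s t bar eps (fun i => ν i - (f i : ℕ)) μ2) := by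
  set S := PiJ s t bar eps Set.univ (pr ν) (pr μ2) (pr μ1) with hS
  let T : Finset (I → ℕ) := Fintype.piFinset fun i => Finset.range (ν i + 1)
  have hT : ∀ k ∈ T, ∀ i, ν i = k i + (ν i - k i) := fun k hk i => by
    have := Fintype.mem_piFinset.1 hk i
    rw [Finset.mem_range] at this
    omega
  have hcT : ∀ X ∈ S, cdim Set.univ X ∈ T := fun X _ => Fintype.mem_piFinset.2 fun i =>
    Finset.mem_range_succ_iff.2 ((Submodule.finrank_le _).trans_eq (Module.finrank_fin_fun ℂ))
  have hΛ := fun κ : I → ℕ => pureDim_ΛV hsbar htbar hbarbar heps hepsbar hloopless _ κ rfl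
  have hst : ∀ k ∈ T, PureDim (stratum s t bar eps Set.univ μ2 μ1 ν k)
      (halfDim s t eps ν + ∑ i, ν i * (μ2 i + μ1 i)) := fun k hk =>
    pureDim_stratum' hsbar htbar hbarbar heps hepsbar (ν1 := fun i => ν i - k i) (hT k hk)
      (fun i hi => absurd (Set.mem_univ i) hi) (hΛ _) (hΛ _)
  have hpure : PureDim S (halfDim s t eps ν + ∑ i, ν i * (μ2 i + μ1 i)) := by
    refine pureDim_of_cover T (f := stratum s t bar eps Set.univ μ2 μ1 ν) ?_ hst
    ext X
    simp only [Set.mem_iUnion]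
    constructor
    · exact fun hX => ⟨_, hcT X hX, hX, rfl⟩
    · rintro ⟨k, -, hX⟩
      exact hX.1
  constructor
  · refine ⟨_, ?_, fun C hC => zDimC_eq (zcl_PiSet s t bar eps)
      ((piSetIso s t bar eps).pure hpure) hC⟩
    rw [mul_add, two_mul_halfDim hsbar htbar hbarbar heps hepsbar]
  · rw [ncard_zIrr, (piSetIso s t bar eps).ncard_comps,
      ncard_comps_strata T hcT (fun m _ => relOpen_cdim_le s t bar eps m) hst]
    refine Finset.sum_bij' (fun k _ i => ⟨ν i - k i, by omega⟩) (fun f _ i => ν i - (f i : ℕ))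
      (fun _ _ => Finset.mem_univ _) (fun f _ => Fintype.mem_piFinset.2 fun i =>
        Finset.mem_range_succ_iff.2 (Nat.sub_le _ _)) (fun k hk => funext fun i => ?_)
      (fun f _ => funext fun i => Fin.ext ?_) fun k hk => ?_
    · have := hT k hk i
      dsimp only
      omega
    · have := (f i).2
      dsimp only
      omega
    · have hk' : (fun i => ν i - (ν i - k i)) = k := funext fun i => by
        have := hT k hk i
        omega
      have hL : ∀ κ : I → ℕ, κ = k → (comps (LSet s t bar eps k μ2)).ncard =
          (comps (LSet s t bar eps κ μ2)).ncard := by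
        rintro _ rfl
        rfl
      rw [zIrrProdCount_eq, LsSet_eq]
      exact (ncard_comps_stratum s t bar eps hsbar htbar hbarbar heps hepsbar (hT k hk)
        fun i hi => absurd (Set.mem_univ i) hi).trans (congrArg (_ * ·) (hL _ hk'))
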